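/- arXiv:1812.08437 — 13 statements merged into one kernel-verified Lean document; each statement's English description precedes it below -/
import Mathlib

section
/- Lifting Theorem (existence and uniqueness, Theorem 3.1): Let μ̌ be an S-invariant Borel probability measure on Y and suppose the fibers of the extension T are (ā_n)-shrunk on average with respect to μ̌. Then there exists exactly one T-invariant Borel probability measure μ on X such that π_*μ = μ̌. -/
open MeasureTheory Filter Topology Metric Set

/-- A modulus of continuity: continuous, increasing, concave on `[0,∞)`, vanishing at `0`. -/
def IsModulus (ω : ℝ → ℝ) : Prop :=
  ContinuousOn ω (Set.Ici 0) ∧ MonotoneOn ω (Set.Ici 0) ∧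
    ConcaveOn ℝ (Set.Ici 0) ω ∧ ω 0 = 0 ∧ ∀ r ∈ Set.Ici (0 : ℝ), 0 ≤ ω r

/-- `T` is uniformly continuous along the fibers of `π`. -/
def UnifContAlongFibers {X Y : Type*} [PseudoMetricSpace X] (T : X → X) (π : X → Y) : Prop :=
  ∃ ω : ℝ → ℝ, IsModulus ω ∧ ∀ x x' : X, π x = π x' → dist (T x) (T x') ≤ ω (dist x x')

/-- The fibers of `π` are `(a n)`-shrunk on average by `T` with respect to `ν`. -/
def ShrunkOnAverage {X Y : Type*} [PseudoMetricSpace X] [MeasurableSpace Y]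
    (T : X → X) (π : X → Y) (ν : MeasureTheory.Measure Y) (a : ℕ → ℝ) : Prop :=
  UnifContAlongFibers T π ∧ (∀ n, 0 < a n) ∧ Filter.Tendsto a Filter.atTop (nhds 0) ∧
    ∀ n : ℕ, (∫ y, Metric.diam (T^[n] '' (π ⁻¹' {y})) ∂ν) ≤ a n

/-- Capacitability of analytic sets: the outer measure of a continuous image of the Baire space is
approximated from inside by compact sets. -/
theorem exists_isCompact_subset_range_le_measure {α : Type*} [TopologicalSpace α]
    [MeasurableSpace α] (μ : Measure α) [μ.OuterRegular]
    {f : (ℕ → ℕ) → α} (hf : Continuous f) {c : ENNReal} (hc : c < μ (range f)) :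
    ∃ K ⊆ range f, IsCompact K ∧ c ≤ μ K := by
  have step : ∀ (k : ℕ) (E : Set (ℕ → ℕ)), c < μ (f '' E) →
      ∃ n : ℕ, c < μ (f '' (E ∩ {x | x k ≤ n})) := by
    intro k E hE
    have hU : f '' E = ⋃ n : ℕ, f '' (E ∩ {x | x k ≤ n}) := by
      rw [← image_iUnion, ← inter_iUnion]
      congr 1
      ext x
      simpa using fun _ => ⟨x k, le_rfl⟩
    have hmono : Monotone fun n : ℕ => f '' (E ∩ {x | x k ≤ n}) := fun m n hmn =>
      image_mono (inter_subset_inter_right _ fun x hx => le_trans hx hmn)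
    rw [hU, hmono.measure_iUnion, lt_iSup_iff] at hE
    exact hE
  choose! n hn using step
  let E : ℕ → Set (ℕ → ℕ) := fun k =>
    Nat.rec univ (fun k E => E ∩ {x | x k ≤ n k E}) k
  let b : ℕ → ℕ := fun k => n k (E k)
  have hE : ∀ k, c < μ (f '' E k) := by
    intro k
    induction k with
    | zero => simpa [E] using hc
    | succ k ih => exact hn k (E k) ih
  have hEb : ∀ k, ∀ x ∈ E k, ∀ i < k, x i ≤ b i := by
    intro k
    induction k with
    | zero => simp
    | succ k ih =>
      rintro x ⟨hx, hxk⟩ i hi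
      rcases Nat.lt_succ_iff_lt_or_eq.1 hi with hi | rfl
      · exact ih x hx i hi
      · exact hxk
  have hK : IsCompact (univ.pi fun i => Iic (b i)) :=
    isCompact_univ_pi fun i => (finite_Iic (b i)).isCompact
  refine ⟨f '' univ.pi fun i => Iic (b i), image_subset_range _ _, hK.image hf, ?_⟩
  by_contra! hlt
  obtain ⟨U, hKU, hU, hUc⟩ := (f '' univ.pi fun i => Iic (b i)).exists_isOpen_lt_of_lt c hlt
  have hx : ∀ k, ∃ x ∈ E k, f x ∉ U := by
    intro k
    by_contra! h
    exact absurd (measure_mono (μ := μ) (image_subset_iff.2 h)) (hUc.trans (hE k)).not_ge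
  choose x hxE hxU using hx
  obtain ⟨z, hz, φ, hφ, hlim⟩ := hK.tendsto_subseq (x := fun k i => min (x k i) (b i))
    fun k i _ => mem_Iic.2 (min_le_right _ _)
  have hlim' : Tendsto (fun j => x (φ j)) atTop (𝓝 z) := by
    rw [tendsto_pi_nhds] at hlim ⊢
    intro i
    refine (hlim i).congr' ?_
    filter_upwards [eventually_gt_atTop i] with j hj
    exact min_eq_left (hEb _ _ (hxE _) i (hj.trans_le hφ.le_apply))
  have hzU : f z ∉ U := hU.isClosed_compl.mem_of_tendsto ((hf.tendsto z).comp hlim')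
    (Eventually.of_forall fun j => hxU (φ j))
  exact hzU (hKU (mem_image_of_mem f hz))

/-- Analytic sets are universally measurable. -/
theorem MeasureTheory.AnalyticSet.nullMeasurableSet {α : Type*} [TopologicalSpace α]
    [T2Space α] [MeasurableSpace α] [OpensMeasurableSpace α] {s : Set α} (hs : AnalyticSet s)
    (μ : Measure α) [IsFiniteMeasure μ] [μ.OuterRegular] : NullMeasurableSet s μ := by
  rw [AnalyticSet] at hs
  rcases hs with rfl | ⟨f, hf, rfl⟩
  · exact nullMeasurableSet_empty
  rcases eq_or_ne (μ (range f)) 0 with h0 | h0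
  · exact .of_null h0
  obtain ⟨c, -, hc, hlim⟩ := exists_seq_strictMono_tendsto' (pos_iff_ne_zero.2 h0)
  choose K hKs hK hcK using fun n =>
    exists_isCompact_subset_range_le_measure μ hf (hc n).2
  have hB : MeasurableSet (⋃ n, K n) := .iUnion fun n => (hK n).measurableSet
  refine ⟨_, hB, (ae_eq_of_subset_of_measure_ge (iUnion_subset hKs) ?_
    hB.nullMeasurableSet (measure_ne_top _ _)).symm⟩
  exact le_of_tendsto' hlim fun n => (hcK n).trans (measure_mono (subset_iUnion K n))

section FiberSup

variable {X Y : Type*} {p : X → Y} {u v : X → ℝ} {C : ℝ}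

/-- The supremum of `u` over the fiber of `p` above a given point. -/
noncomputable def fiberSup (p : X → Y) (u : X → ℝ) (y : Y) : ℝ := sSup (u '' (p ⁻¹' {y}))

theorem bddAbove_image_fiber (hu : ∀ x, |u x| ≤ C) (y : Y) : BddAbove (u '' (p ⁻¹' {y})) :=
  ⟨C, by rintro _ ⟨x, -, rfl⟩; exact (abs_le.1 (hu x)).2⟩

theorem le_fiberSup (hu : ∀ x, |u x| ≤ C) (x : X) : u x ≤ fiberSup p u (p x) :=
  le_csSup (bddAbove_image_fiber hu _) ⟨x, rfl, rfl⟩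

theorem fiberSup_le (hp : Function.Surjective p) {y : Y} {c : ℝ}
    (h : ∀ x, p x = y → u x ≤ c) : fiberSup p u y ≤ c := by
  obtain ⟨x, hx⟩ := hp y
  refine csSup_le ⟨u x, x, hx, rfl⟩ ?_
  rintro _ ⟨x, hx, rfl⟩
  exact h x hx

theorem abs_fiberSup_le (hp : Function.Surjective p) (hu : ∀ x, |u x| ≤ C) (y : Y) :
    |fiberSup p u y| ≤ C := by
  refine abs_le.2 ⟨?_, fiberSup_le hp fun x _ => (abs_le.1 (hu x)).2⟩
  obtain ⟨x, rfl⟩ := hp y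
  exact (abs_le.1 (hu x)).1.trans (le_fiberSup hu x)

theorem aemeasurable_fiberSup [MeasurableSpace X] [StandardBorelSpace X]
    [MetricSpace Y] [CompactSpace Y] [MeasurableSpace Y] [BorelSpace Y]
    (ν : Measure Y) [IsFiniteMeasure ν] (hpm : Measurable p) (hp : Function.Surjective p)
    (hum : Measurable u) (hu : ∀ x, |u x| ≤ C) : AEMeasurable (fiberSup p u) ν := by
  have key : Measurable (β := ℝ) (α := NullMeasurableSpace Y ν) (fiberSup p u) := by
    refine measurable_of_Ioi fun c => ?_
    have : fiberSup p u ⁻¹' Ioi c = p '' (u ⁻¹' Ioi c) := by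
      ext y
      constructor
      · intro hy
        by_contra hcon
        refine hy.not_ge (fiberSup_le hp fun x hx => ?_)
        by_contra! hc
        exact hcon ⟨x, hc, hx⟩
      · rintro ⟨x, hx, rfl⟩
        exact lt_of_lt_of_le hx (le_fiberSup hu x)
    change NullMeasurableSet (fiberSup p u ⁻¹' Ioi c) ν
    rw [this]
    exact ((hum measurableSet_Ioi).analyticSet_image hpm).nullMeasurableSet ν
  exact NullMeasurable.aemeasurable key

theorem integrable_fiberSup [MeasurableSpace X] [StandardBorelSpace X]
    [MetricSpace Y] [CompactSpace Y] [MeasurableSpace Y] [BorelSpace Y]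
    (ν : Measure Y) [IsFiniteMeasure ν] (hpm : Measurable p) (hp : Function.Surjective p)
    (hum : Measurable u) (hu : ∀ x, |u x| ≤ C) : Integrable (fiberSup p u) ν :=
  .of_bound (aemeasurable_fiberSup ν hpm hp hum hu).aestronglyMeasurable C
    (.of_forall fun y => abs_fiberSup_le hp hu y)

/-- The diameters of the images of the fibers under a Borel map are measurable. -/
theorem integrable_diam_image_fiber [MetricSpace X] [CompactSpace X] [MeasurableSpace X]
    [BorelSpace X] [MetricSpace Y] [CompactSpace Y] [MeasurableSpace Y] [BorelSpace Y]
    (ν : Measure Y) [IsFiniteMeasure ν] (hpc : Continuous p) (hp : Function.Surjective p)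
    {R : X → X} (hR : Measurable R) :
    Integrable (fun y => diam (R '' (p ⁻¹' {y}))) ν := by
  let Z := {q : X × X // p q.1 = p q.2}
  have hZ : MeasurableSet {q : X × X | p q.1 = p q.2} :=
    (isClosed_eq (hpc.comp continuous_fst) (hpc.comp continuous_snd)).measurableSet
  have : StandardBorelSpace Z := hZ.standardBorel
  let pZ : Z → Y := fun q => p q.1.1
  let uZ : Z → ℝ := fun q => dist (R q.1.1) (R q.1.2)
  have hpZ : Measurable pZ := hpc.measurable.comp (measurable_fst.comp measurable_subtype_coe)
  have hpZs : Function.Surjective pZ := fun y => by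
    obtain ⟨x, rfl⟩ := hp y
    exact ⟨⟨(x, x), rfl⟩, rfl⟩
  have huZ : Measurable uZ := (hR.comp (measurable_fst.comp measurable_subtype_coe)).dist
    (hR.comp (measurable_snd.comp measurable_subtype_coe))
  have hbd : ∀ q, |uZ q| ≤ diam (univ : Set X) := fun q => by
    rw [abs_of_nonneg dist_nonneg]
    exact dist_le_diam_of_mem isCompact_univ.isBounded (mem_univ _) (mem_univ _)
  convert integrable_fiberSup ν hpZ hpZs huZ hbd using 1
  ext y
  apply le_antisymm
  · obtain ⟨x, rfl⟩ := hp y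
    refine diam_le_of_forall_dist_le
      (dist_nonneg.trans (le_fiberSup hbd (⟨(x, x), rfl⟩ : Z))) ?_
    rintro _ ⟨a, ha, rfl⟩ _ ⟨b, hb, rfl⟩
    rw [mem_preimage, mem_singleton_iff] at ha hb
    rw [← ha]
    exact le_fiberSup hbd (⟨(a, b), ha.trans hb.symm⟩ : Z)
  · refine fiberSup_le hpZs fun q hq => ?_
    exact dist_le_diam_of_mem (isCompact_univ.isBounded.subset (subset_univ _))
      ⟨_, hq, rfl⟩ ⟨_, q.2.symm.trans hq, rfl⟩

end FiberSup

theorem integral_comp_of_map_eq {α β : Type*} [MeasurableSpace α] [MeasurableSpace β]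
    {μ : Measure α} {ρ : Measure β} {f : α → β} (hf : Measurable f) (h : μ.map f = ρ)
    {g : β → ℝ} (hg : AEStronglyMeasurable g ρ) : ∫ x, g (f x) ∂μ = ∫ y, g y ∂ρ := by
  subst h
  exact (integral_map hf.aemeasurable hg).symm

section UpperMean

variable {X Y : Type*} [MeasurableSpace Y] {T : X → X} {S : Y → Y} {p : X → Y} {ν : Measure Y}
  {u v : X → ℝ} {C D : ℝ}

/-- The mean of the fiberwise supremum of `u`. -/
noncomputable def upperMean (p : X → Y) (ν : Measure Y) (u : X → ℝ) : ℝ := ∫ y, fiberSup p u y ∂ν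

theorem upperMean_const_mul {c : ℝ} (hc : 0 ≤ c) (u : X → ℝ) :
    upperMean p ν (fun x => c * u x) = c * upperMean p ν u := by
  rw [upperMean, upperMean, ← integral_const_mul]
  refine integral_congr_ae (.of_forall fun y => ?_)
  simp only [fiberSup, sSup_image', Real.mul_iSup_of_nonneg hc]

theorem upperMean_comp_projection (hp : Function.Surjective p) (g : Y → ℝ) :
    upperMean p ν (g ∘ p) = ∫ y, g y ∂ν := by
  refine integral_congr_ae (.of_forall fun y => ?_)
  have : (g ∘ p) '' (p ⁻¹' {y}) = {g y} := by
    rw [image_comp, image_preimage_eq _ hp, image_singleton]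
  simp only [fiberSup, this, csSup_singleton]

theorem abs_upperMean_le [IsProbabilityMeasure ν] (hp : Function.Surjective p)
    (hu : ∀ x, |u x| ≤ C) : |upperMean p ν u| ≤ C := by
  simpa [upperMean] using norm_integral_le_of_norm_le_const (μ := ν) (f := fiberSup p u)
    (.of_forall (abs_fiberSup_le hp hu))

/-- The limit of the upper means of `h` along the iterates of `T`. -/
noncomputable def fiberLimit (T : X → X) (p : X → Y) (ν : Measure Y) (h : X → ℝ) : ℝ :=
  ⨅ n, upperMean p ν (h ∘ T^[n])

theorem fiberLimit_const_mul {c : ℝ} (hc : 0 ≤ c) (h : X → ℝ) :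
    fiberLimit T p ν (fun x => c * h x) = c * fiberLimit T p ν h := by
  rw [fiberLimit, fiberLimit, Real.mul_iInf_of_nonneg hc]
  exact iInf_congr fun n => upperMean_const_mul hc _

theorem fiberLimit_zero : fiberLimit T p ν 0 = 0 := by
  simpa [Pi.zero_def] using fiberLimit_const_mul (T := T) (p := p) (ν := ν) le_rfl 0

variable [MetricSpace X] [CompactSpace X] [MeasurableSpace X] [BorelSpace X]
  [MetricSpace Y] [CompactSpace Y] [BorelSpace Y]

theorem upperMean_le_add [IsFiniteMeasure ν] (hpm : Measurable p) (hp : Function.Surjective p)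
    (hum : Measurable u) (hu : ∀ x, |u x| ≤ C) (hvm : Measurable v) (hv : ∀ x, |v x| ≤ D)
    {k : Y → ℝ} (hk : Integrable k ν) (huv : ∀ x, u x ≤ v x + k (p x)) :
    upperMean p ν u ≤ upperMean p ν v + ∫ y, k y ∂ν := by
  have hvi := integrable_fiberSup ν hpm hp hvm hv
  rw [upperMean, upperMean, ← integral_add hvi hk]
  refine integral_mono (integrable_fiberSup ν hpm hp hum hu) (hvi.add hk) fun y =>
    fiberSup_le hp ?_
  rintro x rfl
  exact (huv x).trans (add_le_add_left (le_fiberSup hv x) _)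

theorem upperMean_add_le [IsFiniteMeasure ν] (hpm : Measurable p) (hp : Function.Surjective p)
    (hum : Measurable u) (hu : ∀ x, |u x| ≤ C) (hvm : Measurable v) (hv : ∀ x, |v x| ≤ D) :
    upperMean p ν (u + v) ≤ upperMean p ν u + upperMean p ν v :=
  upperMean_le_add (C := C + D) hpm hp (hum.add hvm)
    (fun x => (abs_add_le _ _).trans (add_le_add (hu x) (hv x))) hum hu
    (integrable_fiberSup ν hpm hp hvm hv) fun x => add_le_add_right (le_fiberSup hv x) _

theorem upperMean_comp_le [IsFiniteMeasure ν] (hpm : Measurable p) (hp : Function.Surjective p)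
    (hT : Measurable T) (hS : Measurable S) (hcomm : ∀ x, p (T x) = S (p x))
    (hν : ν.map S = ν) (hum : Measurable u) (hu : ∀ x, |u x| ≤ C) :
    upperMean p ν (u ∘ T) ≤ upperMean p ν u := by
  have hi := integrable_fiberSup ν hpm hp hum hu
  have hi' : Integrable (fun y => fiberSup p u (S y)) ν := by
    refine Integrable.comp_measurable (g := fiberSup p u) ?_ hS
    rwa [hν]
  rw [upperMean, upperMean, ← integral_comp_of_map_eq hS hν hi.aestronglyMeasurable]
  refine integral_mono (integrable_fiberSup ν hpm hp (hum.comp hT) fun x => hu _) hi' fun y =>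
    fiberSup_le hp ?_
  rintro x rfl
  exact (le_fiberSup (p := p) hu (T x)).trans_eq (by rw [hcomm])

theorem integral_le_upperMean [IsFiniteMeasure ν] (hpm : Measurable p)
    (hp : Function.Surjective p) (hum : Measurable u) (hu : ∀ x, |u x| ≤ C)
    {μ : Measure X} [IsFiniteMeasure μ] (hμ : μ.map p = ν) :
    ∫ x, u x ∂μ ≤ upperMean p ν u := by
  have hi := integrable_fiberSup ν hpm hp hum hu
  rw [upperMean, ← integral_comp_of_map_eq hpm hμ hi.aestronglyMeasurable]
  refine integral_mono (.of_bound hum.aestronglyMeasurable C (.of_forall hu)) ?_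
    fun x => le_fiberSup hu x
  refine Integrable.comp_measurable (g := fiberSup p u) ?_ hpm
  rwa [hμ]

end UpperMean

section FiberTest

variable {X Y : Type*} [MetricSpace X] [MeasurableSpace X] {p : X → Y} {h g : X → ℝ}

/-- Bounded Borel functions which are uniformly continuous along the fibers of `p`. -/
structure IsFiberTest (p : X → Y) (h : X → ℝ) : Prop where
  measurable : Measurable h
  bounded : ∃ C, ∀ x, |h x| ≤ C
  uniform : ∀ ε > 0, ∃ δ > 0, ∀ x x', p x = p x' → dist x x' < δ → |h x - h x'| ≤ ε

theorem IsFiberTest.of_continuous [CompactSpace X] [BorelSpace X] (hc : Continuous h) :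
    IsFiberTest p h where
  measurable := hc.measurable
  bounded := by
    obtain ⟨C, hC⟩ := isCompact_univ.exists_bound_of_continuousOn hc.continuousOn
    exact ⟨C, fun x => hC x (mem_univ x)⟩
  uniform ε hε := by
    obtain ⟨δ, hδ, H⟩ := Metric.uniformContinuous_iff.1
      (CompactSpace.uniformContinuous_of_continuous hc) ε hε
    exact ⟨δ, hδ, fun x x' _ hd => (H hd).le⟩

theorem IsFiberTest.neg (hh : IsFiberTest p h) : IsFiberTest p (-h) where
  measurable := hh.measurable.neg
  bounded := by simpa using hh.bounded
  uniform ε hε := by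
    obtain ⟨δ, hδ, H⟩ := hh.uniform ε hε
    refine ⟨δ, hδ, fun x x' hp hd => ?_⟩
    rw [Pi.neg_apply, Pi.neg_apply, neg_sub_neg, abs_sub_comm]
    exact H x x' hp hd

theorem IsFiberTest.add (hh : IsFiberTest p h) (hg : IsFiberTest p g) :
    IsFiberTest p (h + g) where
  measurable := hh.measurable.add hg.measurable
  bounded := by
    obtain ⟨C, hC⟩ := hh.bounded
    obtain ⟨D, hD⟩ := hg.bounded
    exact ⟨C + D, fun x => (abs_add_le _ _).trans (add_le_add (hC x) (hD x))⟩
  uniform ε hε := by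
    obtain ⟨δ, hδ, H⟩ := hh.uniform (ε / 2) (half_pos hε)
    obtain ⟨η, hη, G⟩ := hg.uniform (ε / 2) (half_pos hε)
    refine ⟨min δ η, lt_min hδ hη, fun x x' hp hd => ?_⟩
    have h1 := H x x' hp (hd.trans_le (min_le_left _ _))
    have h2 := G x x' hp (hd.trans_le (min_le_right _ _))
    rw [Pi.add_apply, Pi.add_apply, add_sub_add_comm]
    linarith [abs_add_le (h x - h x') (g x - g x')]

theorem IsFiberTest.comp {T : X → X} {S : Y → Y} (hh : IsFiberTest p h) (hT : Measurable T)
    (hcomm : ∀ x, p (T x) = S (p x)) (hω : UnifContAlongFibers T p) :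
    IsFiberTest p (h ∘ T) where
  measurable := hh.measurable.comp hT
  bounded := by
    obtain ⟨C, hC⟩ := hh.bounded
    exact ⟨C, fun x => hC _⟩
  uniform ε hε := by
    obtain ⟨δ, hδ, H⟩ := hh.uniform ε hε
    obtain ⟨ω, ⟨hωc, -, -, hω0, -⟩, hωT⟩ := hω
    obtain ⟨η, hη, G⟩ := Metric.continuousOn_iff.1 hωc 0 self_mem_Ici δ hδ
    refine ⟨η, hη, fun x x' hp hd => H _ _ (by rw [hcomm, hcomm, hp]) ?_⟩
    have h1 := G (dist x x') dist_nonneg (by simpa using hd)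
    rw [hω0, Real.dist_eq, sub_zero] at h1
    exact (hωT x x' hp).trans_lt ((le_abs_self _).trans_lt h1)

end FiberTest

section Approximation

variable {X Y : Type*} [MetricSpace X] [CompactSpace X] [MeasurableSpace X] [BorelSpace X]
  [MetricSpace Y] [CompactSpace Y] [MeasurableSpace Y] [BorelSpace Y]
  {p : X → Y} {ν : Measure Y} {h : X → ℝ}

/-- A finite partition of unity on a compact metric space whose members live in small balls. -/
theorem exists_partition_balls (X : Type*) [MetricSpace X] [CompactSpace X] {r : ℝ} (hr : 0 < r) :
    ∃ (s : Finset X) (q : X → X → ℝ), (∀ z, Continuous (q z)) ∧ (∀ z x, 0 ≤ q z x) ∧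
      (∀ x, ∑ z ∈ s, q z x = 1) ∧ ∀ z x, q z x ≠ 0 → dist x z < r := by
  obtain ⟨s, -, hs⟩ := isCompact_univ.elim_nhds_subcover (fun z : X => ball z r)
    fun z _ => ball_mem_nhds z hr
  have hpos : ∀ x, 0 < ∑ z ∈ s, max 0 (r - dist x z) := fun x => by
    obtain ⟨z, hz, hxz⟩ : ∃ z ∈ s, x ∈ ball z r := by simpa using hs (mem_univ x)
    refine Finset.sum_pos' (fun _ _ => le_max_left _ _) ⟨z, hz, ?_⟩
    exact lt_max_of_lt_right (sub_pos.2 hxz)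
  refine ⟨s, fun z x => max 0 (r - dist x z) / ∑ w ∈ s, max 0 (r - dist x w), fun z => ?_,
    fun z x => div_nonneg (le_max_left _ _) (hpos x).le, fun x => ?_, fun z x hzx => ?_⟩
  · exact Continuous.div (by fun_prop) (by fun_prop) fun x => (hpos x).ne'
  · rw [← Finset.sum_div, div_self (hpos x).ne']
  · by_contra! hle
    exact hzx (by simp [max_eq_left (sub_nonpos.2 hle)])

/-- A bounded Borel function, uniformly continuous along fibers, is approximated by functions
depending only on the fiber near any given point. -/
theorem exists_integrable_near [IsFiniteMeasure ν] (hpm : Measurable p)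
    (hp : Function.Surjective p) (hhm : Measurable h) {C : ℝ} (hC : ∀ x, |h x| ≤ C) {ε r : ℝ}
    (H : ∀ x x', p x = p x' → dist x x' < 2 * r → |h x - h x'| ≤ ε) (hε : 0 ≤ ε) (z : X) :
    ∃ g : Y → ℝ, Integrable g ν ∧ ∀ x, dist x z < r → |h x - g (p x)| ≤ ε := by
  classical
  let u : X → ℝ := (ball z r).piecewise h fun _ => -C
  have hu : ∀ x, |u x| ≤ C := fun x => by
    by_cases hx : x ∈ ball z r
    · simpa [u, hx] using hC x
    · simp [u, hx, abs_of_nonneg ((abs_nonneg (h x)).trans (hC x))]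
  refine ⟨fiberSup p u, integrable_fiberSup ν hpm hp
    (hhm.piecewise isOpen_ball.measurableSet measurable_const) hu, fun x hx => ?_⟩
  have h1 : h x ≤ fiberSup p u (p x) := by
    simpa [u, hx] using le_fiberSup (p := p) hu x
  have h2 : fiberSup p u (p x) ≤ h x + ε := by
    refine fiberSup_le hp fun x' hx' => ?_
    by_cases hxz : x' ∈ ball z r
    · have hd : dist x x' < 2 * r := by
        linarith [dist_triangle_right x x' z, mem_ball.1 hxz]
      have := abs_le.1 (H x x' hx'.symm hd)
      simp only [u, piecewise_eq_of_mem _ _ _ hxz]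
      linarith [this.1]
    · simp only [u, piecewise_eq_of_notMem _ _ _ hxz]
      linarith [(abs_le.1 (hC x)).1]
  rw [abs_sub_comm, abs_of_nonneg (sub_nonneg.2 h1)]
  linarith

/-- Functions that are uniformly continuous along fibers are approximated by continuous functions,
uniformly with respect to all measures projecting to `ν`. -/
theorem IsFiberTest.exists_continuous_approx [IsProbabilityMeasure ν] (hpc : Continuous p)
    (hp : Function.Surjective p) (hh : IsFiberTest p h) {ε : ℝ} (hε : 0 < ε) :
    ∃ (φ : X → ℝ) (k : Y → ℝ), Continuous φ ∧ Integrable k ν ∧ ∫ y, k y ∂ν ≤ ε ∧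
      ∀ x, |h x - φ x| ≤ k (p x) := by
  obtain ⟨C, hC⟩ := hh.bounded
  obtain ⟨δ, hδ, H⟩ := hh.uniform (ε / 2) (half_pos hε)
  obtain ⟨s, q, hqc, hq0, hq1, hqr⟩ := exists_partition_balls X (half_pos hδ)
  choose G hGi hG using exists_integrable_near (ν := ν) hpc.measurable hp hh.measurable hC
    (r := δ / 2) (by rwa [mul_div_cancel₀ δ two_ne_zero]) (half_pos hε).le
  have hη : 0 < ε / 2 / (s.card + 1) := by positivity
  choose g hg hgi using fun z => (hGi z).exists_boundedContinuous_integral_sub_le hη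
  have hki : ∀ z, Integrable (fun y => ‖G z y - g z y‖) ν := fun z => ((hGi z).sub (hgi z)).norm
  refine ⟨fun x => ∑ z ∈ s, q z x * g z (p x), fun y => ε / 2 + ∑ z ∈ s, ‖G z y - g z y‖,
    ?_, ?_, ?_, fun x => ?_⟩
  · exact continuous_finsetSum _ fun z _ => (hqc z).mul ((g z).continuous.comp hpc)
  · exact (integrable_const _).add (integrable_finsetSum _ fun z _ => hki z)
  · rw [integral_add (integrable_const _) (integrable_finsetSum _ fun z _ => hki z),
      integral_finsetSum _ fun z _ => hki z]
    have h1 : ∑ z ∈ s, ∫ y, ‖G z y - g z y‖ ∂ν ≤ s.card * (ε / 2 / (s.card + 1)) := by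
      simpa using Finset.sum_le_sum fun z (_ : z ∈ s) => hg z
    have h2 : s.card * (ε / 2 / (s.card + 1)) ≤ ε / 2 := by
      rw [mul_div_assoc', div_le_iff₀ (by positivity)]
      nlinarith
    simp only [integral_const, probReal_univ, one_smul]
    linarith
  · have hq_le : ∀ z ∈ s, q z x ≤ 1 := fun z hz => by
      rw [← hq1 x]
      exact Finset.single_le_sum (fun w _ => hq0 w x) hz
    have hsum : h x - ∑ z ∈ s, q z x * g z (p x) = ∑ z ∈ s, q z x * (h x - g z (p x)) := by
      simp only [mul_sub, Finset.sum_sub_distrib, ← Finset.sum_mul, hq1, one_mul]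
    have hterm : ∀ z ∈ s, |q z x * (h x - g z (p x))| ≤
        q z x * (ε / 2) + ‖G z (p x) - g z (p x)‖ := fun z hz => by
      rw [abs_mul, abs_of_nonneg (hq0 z x)]
      by_cases hzx : q z x = 0
      · simp [hzx]
      · have h1 := hG z x (hqr z x hzx)
        have h2 := abs_sub_le (h x) (G z (p x)) (g z (p x))
        rw [Real.norm_eq_abs]
        nlinarith [hq0 z x, hq_le z hz, abs_nonneg (G z (p x) - g z (p x))]
    rw [hsum]
    refine (Finset.abs_sum_le_sum_abs _ _).trans ((Finset.sum_le_sum hterm).trans_eq ?_)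
    rw [Finset.sum_add_distrib, ← Finset.sum_mul, hq1, one_mul]

end Approximation

section ShrinkingExtension

variable {X Y : Type*} [MetricSpace X] [MeasurableSpace X] [MetricSpace Y] [MeasurableSpace Y]
  {T : X → X} {S : Y → Y} {p : X → Y} {ν : Measure Y} {h g : X → ℝ}

/-- An extension `T` of a measure preserving map `S` whose fibers shrink on average. -/
structure IsShrinkingExtension (T : X → X) (S : Y → Y) (p : X → Y) (ν : Measure Y) : Prop where
  measurable : Measurable T
  measurable_base : Measurable S
  continuous : Continuous p
  surjective : Function.Surjective p
  comm : ∀ x, p (T x) = S (p x)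
  map_eq : ν.map S = ν
  unifCont : UnifContAlongFibers T p
  tendsto_diam : Tendsto (fun n => ∫ y, diam (T^[n] '' (p ⁻¹' {y})) ∂ν) atTop (𝓝 0)

namespace IsShrinkingExtension

theorem comm_iterate (H : IsShrinkingExtension T S p ν) (n : ℕ) (x : X) :
    p (T^[n] x) = S^[n] (p x) :=
  Function.Semiconj.iterate_right (f := p) H.comm n x

theorem test_iterate (H : IsShrinkingExtension T S p ν) (hh : IsFiberTest p h) (n : ℕ) :
    IsFiberTest p (h ∘ T^[n]) := by
  induction n with
  | zero => simpa using hh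
  | succ n ih =>
    rw [Function.iterate_succ]
    exact ih.comp H.measurable H.comm H.unifCont

theorem measurePreserving_iterate (H : IsShrinkingExtension T S p ν) (n : ℕ) :
    MeasurePreserving S^[n] ν ν :=
  MeasurePreserving.iterate ⟨H.measurable_base, H.map_eq⟩ n

theorem fiberLimit_comp_projection (H : IsShrinkingExtension T S p ν) {g : Y → ℝ}
    (hg : AEStronglyMeasurable g ν) : fiberLimit T p ν (g ∘ p) = ∫ y, g y ∂ν := by
  have key : ∀ n, upperMean p ν ((g ∘ p) ∘ T^[n]) = ∫ y, g y ∂ν := fun n => by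
    have : (g ∘ p) ∘ T^[n] = (g ∘ S^[n]) ∘ p := funext fun x => congrArg g (H.comm_iterate n x)
    have hS := H.measurePreserving_iterate n
    rw [this, upperMean_comp_projection H.surjective,
      ← integral_comp_of_map_eq hS.measurable hS.map_eq hg]
    rfl
  simp only [fiberLimit, key, ciInf_const]

variable [CompactSpace X] [BorelSpace X] [CompactSpace Y] [BorelSpace Y] [IsProbabilityMeasure ν]

theorem tendsto_upperMean (H : IsShrinkingExtension T S p ν) (hh : IsFiberTest p h) :
    Tendsto (fun n => upperMean p ν (h ∘ T^[n])) atTop (𝓝 (fiberLimit T p ν h)) := by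
  obtain ⟨C, hC⟩ := hh.bounded
  refine tendsto_atTop_ciInf (antitone_nat_of_succ_le fun n => ?_) ⟨-C, ?_⟩
  · rw [Function.iterate_succ]
    exact upperMean_comp_le H.continuous.measurable H.surjective H.measurable H.measurable_base
      H.comm H.map_eq (H.test_iterate hh n).measurable fun x => hC _
  · rintro _ ⟨n, rfl⟩
    exact (abs_le.1 (abs_upperMean_le H.surjective fun x => hC _)).1

theorem fiberLimit_comp (H : IsShrinkingExtension T S p ν) (hh : IsFiberTest p h) :
    fiberLimit T p ν (h ∘ T) = fiberLimit T p ν h := by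
  refine tendsto_nhds_unique
    (H.tendsto_upperMean (hh.comp H.measurable H.comm H.unifCont)) ?_
  simpa only [Function.iterate_succ', Function.comp_assoc] using
    (tendsto_add_atTop_iff_nat 1).2 (H.tendsto_upperMean hh)

theorem fiberLimit_le_add (H : IsShrinkingExtension T S p ν) (hh : IsFiberTest p h)
    (hg : IsFiberTest p g) {k : Y → ℝ} (hk : Integrable k ν) (hle : ∀ x, h x ≤ g x + k (p x)) :
    fiberLimit T p ν h ≤ fiberLimit T p ν g + ∫ y, k y ∂ν := by
  obtain ⟨C, hC⟩ := hh.bounded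
  obtain ⟨D, hD⟩ := hg.bounded
  refine le_of_tendsto_of_tendsto' (H.tendsto_upperMean hh)
    ((H.tendsto_upperMean hg).add_const _) fun n => ?_
  have hS := H.measurePreserving_iterate n
  rw [← integral_comp_of_map_eq hS.measurable hS.map_eq hk.aestronglyMeasurable]
  refine upperMean_le_add H.continuous.measurable H.surjective (H.test_iterate hh n).measurable
    (fun x => hC _) (H.test_iterate hg n).measurable (fun x => hD _)
    (hS.integrable_comp_of_integrable hk) fun x => ?_
  simpa only [Function.comp_apply, H.comm_iterate] using hle (T^[n] x)

theorem fiberLimit_add_le (H : IsShrinkingExtension T S p ν) (hh : IsFiberTest p h)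
    (hg : IsFiberTest p g) :
    fiberLimit T p ν (h + g) ≤ fiberLimit T p ν h + fiberLimit T p ν g := by
  obtain ⟨C, hC⟩ := hh.bounded
  obtain ⟨D, hD⟩ := hg.bounded
  exact le_of_tendsto_of_tendsto' (H.tendsto_upperMean (hh.add hg))
    ((H.tendsto_upperMean hh).add (H.tendsto_upperMean hg)) fun n =>
      upperMean_add_le H.continuous.measurable H.surjective (H.test_iterate hh n).measurable
        (fun x => hC _) (H.test_iterate hg n).measurable fun x => hD _

theorem fiberLimit_neg (H : IsShrinkingExtension T S p ν) (hh : IsFiberTest p h) :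
    fiberLimit T p ν (-h) = -fiberLimit T p ν h := by
  obtain ⟨C, hC⟩ := hh.bounded
  have hlim := (H.tendsto_upperMean hh).add (H.tendsto_upperMean hh.neg)
  have hpm := H.continuous.measurable
  apply le_antisymm
  · refine le_neg_iff_add_nonpos_right.2 (le_of_forall_pos_le_add fun ε hε => ?_)
    obtain ⟨δ, hδ, hu⟩ := hh.uniform ε hε
    have hlim' : Tendsto (fun n => ε + 2 * C / δ * ∫ y, diam (T^[n] '' (p ⁻¹' {y})) ∂ν) atTop
        (𝓝 (0 + ε)) := by
      simpa using (H.tendsto_diam.const_mul (2 * C / δ)).const_add ε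
    rw [add_comm (fiberLimit T p ν (-h))]
    refine le_of_tendsto_of_tendsto' hlim hlim' fun n => ?_
    have hi := integrable_fiberSup ν hpm H.surjective (H.test_iterate hh n).measurable
      fun x => hC (T^[n] x)
    have hi' := integrable_fiberSup ν hpm H.surjective (H.test_iterate hh.neg n).measurable
      (C := C) fun x => by simpa using hC (T^[n] x)
    have hd := integrable_diam_image_fiber ν H.continuous H.surjective (H.measurable.iterate n)
    have hrhs : ε + 2 * C / δ * ∫ y, diam (T^[n] '' (p ⁻¹' {y})) ∂ν =
        ∫ y, (ε + 2 * C / δ * diam (T^[n] '' (p ⁻¹' {y}))) ∂ν := by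
      rw [integral_add (integrable_const _) (hd.const_mul _), integral_const_mul]
      simp
    rw [hrhs, upperMean, upperMean, ← integral_add hi hi']
    refine integral_mono (hi.add hi') ((integrable_const _).add (hd.const_mul _)) fun y => ?_
    refine le_sub_iff_add_le.1 (fiberSup_le H.surjective fun x hx => ?_)
    rw [le_sub_comm]
    refine fiberSup_le H.surjective fun x' hx' => ?_
    have hdist : dist (T^[n] x) (T^[n] x') ≤ diam (T^[n] '' (p ⁻¹' {y})) :=
      dist_le_diam_of_mem (isCompact_univ.isBounded.subset (subset_univ _))
        ⟨x, hx, rfl⟩ ⟨x', hx', rfl⟩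
    have hC0 : 0 ≤ C := (abs_nonneg _).trans (hC x)
    have hD0 := dist_nonneg.trans hdist
    suffices h (T^[n] x) - h (T^[n] x') ≤ ε + 2 * C / δ * diam (T^[n] '' (p ⁻¹' {y})) by
      simp only [Function.comp_apply, Pi.neg_apply]
      linarith
    rcases lt_or_ge (dist (T^[n] x) (T^[n] x')) δ with hlt | hge
    · have h1 := hu _ _ (by rw [H.comm_iterate, H.comm_iterate, hx, hx']) hlt
      have h2 : 0 ≤ 2 * C / δ * diam (T^[n] '' (p ⁻¹' {y})) := by positivity
      linarith [le_abs_self (h (T^[n] x) - h (T^[n] x'))]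
    · have h1 : 2 * C ≤ 2 * C / δ * diam (T^[n] '' (p ⁻¹' {y})) := by
        rw [div_mul_eq_mul_div, le_div_iff₀ hδ]
        exact mul_le_mul_of_nonneg_left (hge.trans hdist) (by positivity)
      linarith [(abs_le.1 (hC (T^[n] x))).2, (abs_le.1 (hC (T^[n] x'))).1]
  · have h1 := H.fiberLimit_add_le hh hh.neg
    rw [add_neg_cancel, fiberLimit_zero] at h1
    linarith

theorem fiberLimit_add (H : IsShrinkingExtension T S p ν) (hh : IsFiberTest p h)
    (hg : IsFiberTest p g) :
    fiberLimit T p ν (h + g) = fiberLimit T p ν h + fiberLimit T p ν g := by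
  refine le_antisymm (H.fiberLimit_add_le hh hg) ?_
  have h1 := H.fiberLimit_add_le hh.neg hg.neg
  rw [← neg_add, H.fiberLimit_neg hh, H.fiberLimit_neg hg, H.fiberLimit_neg (hh.add hg)] at h1
  linarith

theorem fiberLimit_smul (H : IsShrinkingExtension T S p ν) (hh : IsFiberTest p h) (c : ℝ) :
    fiberLimit T p ν (fun x => c * h x) = c * fiberLimit T p ν h := by
  rcases le_total 0 c with hc | hc
  · exact fiberLimit_const_mul hc h
  · have h1 := fiberLimit_const_mul (T := T) (p := p) (ν := ν) (neg_nonneg.2 hc) (-h)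
    rw [H.fiberLimit_neg hh] at h1
    simpa using h1

/-- Invariant lifts of `ν` are determined by `fiberLimit`. -/
theorem integral_eq_fiberLimit (H : IsShrinkingExtension T S p ν) {μ : Measure X}
    [IsFiniteMeasure μ] (hT : μ.map T = μ) (hμ : μ.map p = ν) (hh : IsFiberTest p h) :
    ∫ x, h x ∂μ = fiberLimit T p ν h := by
  have key : ∀ u : X → ℝ, IsFiberTest p u → ∫ x, u x ∂μ ≤ fiberLimit T p ν u := fun u hu => by
    obtain ⟨C, hC⟩ := hu.bounded
    refine ge_of_tendsto' (H.tendsto_upperMean hu) fun n => ?_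
    have hTn : MeasurePreserving T^[n] μ μ := .iterate ⟨H.measurable, hT⟩ n
    rw [← integral_comp_of_map_eq hTn.measurable hTn.map_eq hu.measurable.aestronglyMeasurable]
    exact integral_le_upperMean H.continuous.measurable H.surjective
      (H.test_iterate hu n).measurable (fun x => hC _) hμ
  refine le_antisymm (key h hh) ?_
  have h1 := key (-h) hh.neg
  rw [H.fiberLimit_neg hh] at h1
  simp only [Pi.neg_apply, integral_neg] at h1
  linarith

theorem eq_of_map_eq (H : IsShrinkingExtension T S p ν) {μ μ' : Measure X}
    [IsFiniteMeasure μ] [IsFiniteMeasure μ'] (hT : μ.map T = μ) (hμ : μ.map p = ν)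
    (hT' : μ'.map T = μ') (hμ' : μ'.map p = ν) : μ = μ' := by
  refine ext_of_forall_integral_eq_of_IsFiniteMeasure fun f => ?_
  rw [H.integral_eq_fiberLimit hT hμ (.of_continuous f.continuous),
    H.integral_eq_fiberLimit hT' hμ' (.of_continuous f.continuous)]

/-- If `fiberLimit` is integration against a lift `μ` of `ν` on continuous functions, then also
on bounded Borel functions that are uniformly continuous along fibers. -/
theorem integral_eq_fiberLimit_of_continuous (H : IsShrinkingExtension T S p ν) {μ : Measure X}
    [IsFiniteMeasure μ] (hμ : μ.map p = ν)
    (hc : ∀ φ : X → ℝ, Continuous φ → ∫ x, φ x ∂μ = fiberLimit T p ν φ)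
    (hh : IsFiberTest p h) : ∫ x, h x ∂μ = fiberLimit T p ν h := by
  have key : ∀ u : X → ℝ, IsFiberTest p u → ∫ x, u x ∂μ ≤ fiberLimit T p ν u := fun u hu => by
    refine le_of_forall_pos_le_add fun ε hε => ?_
    obtain ⟨φ, k, hφ, hk, hkε, hle⟩ :=
      hu.exists_continuous_approx (ν := ν) H.continuous H.surjective (half_pos hε)
    have hint : ∀ {w : X → ℝ}, IsFiberTest p w → Integrable w μ := fun hw => by
      obtain ⟨C, hC⟩ := hw.bounded
      exact .of_bound hw.measurable.aestronglyMeasurable C (.of_forall hC)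
    have hkp : Integrable (fun x => k (p x)) μ := by
      refine Integrable.comp_measurable (g := k) ?_ H.continuous.measurable
      rwa [hμ]
    have h1 : ∫ x, u x ∂μ ≤ ∫ x, φ x ∂μ + ∫ y, k y ∂ν := by
      rw [← integral_comp_of_map_eq H.continuous.measurable hμ hk.aestronglyMeasurable,
        ← integral_add (hint (.of_continuous hφ)) hkp]
      refine integral_mono (hint hu) ((hint (.of_continuous hφ)).add hkp) fun x => ?_
      have := (abs_le.1 (hle x)).2
      linarith
    have h2 := H.fiberLimit_le_add (.of_continuous hφ) hu hk fun x => by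
      linarith [(abs_le.1 (hle x)).1]
    rw [hc φ hφ] at h1
    linarith
  refine le_antisymm (key h hh) ?_
  have h1 := key (-h) hh.neg
  rw [H.fiberLimit_neg hh] at h1
  simp only [Pi.neg_apply, integral_neg] at h1
  linarith

/-- `fiberLimit` as a positive linear functional on continuous functions. -/
noncomputable def functional (H : IsShrinkingExtension T S p ν) :
    CompactlySupportedContinuousMap X ℝ →ₚ[ℝ] ℝ :=
  .mk₀
    { toFun := fun φ => fiberLimit T p ν φ
      map_add' := fun φ ψ =>
        H.fiberLimit_add (.of_continuous φ.continuous) (.of_continuous ψ.continuous)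
      map_smul' := fun c φ => H.fiberLimit_smul (.of_continuous φ.continuous) c }
    fun φ hφ => by
      have h1 := H.fiberLimit_le_add (h := 0) (g := φ) (k := 0) (.of_continuous continuous_const)
        (.of_continuous φ.continuous) (integrable_zero _ _ _) fun x => by simpa using hφ x
      simpa [fiberLimit_zero] using h1

theorem exists_invariant_lift (H : IsShrinkingExtension T S p ν) :
    ∃ μ : Measure X, IsProbabilityMeasure μ ∧ μ.map T = μ ∧ μ.map p = ν := by
  let μ := RealRMK.rieszMeasure H.functional
  have hc : ∀ φ : X → ℝ, Continuous φ → ∫ x, φ x ∂μ = fiberLimit T p ν φ := fun φ hφ =>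
    RealRMK.integral_rieszMeasure H.functional
      ⟨⟨φ, hφ⟩, HasCompactSupport.of_compactSpace _⟩
  have : IsFiniteMeasure μ := ⟨isCompact_univ.measure_lt_top⟩
  have hμ : μ.map p = ν := by
    refine ext_of_forall_integral_eq_of_IsFiniteMeasure fun f => ?_
    rw [integral_map H.continuous.aemeasurable f.continuous.aestronglyMeasurable,
      ← H.fiberLimit_comp_projection f.continuous.aestronglyMeasurable]
    exact hc _ (f.continuous.comp H.continuous)
  refine ⟨μ, ⟨?_⟩, ?_, hμ⟩
  · rw [← preimage_univ (f := p), ← Measure.map_apply H.continuous.measurable .univ, hμ,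
      measure_univ]
  · refine ext_of_forall_integral_eq_of_IsFiniteMeasure fun f => ?_
    have hf : IsFiberTest p f := .of_continuous f.continuous
    rw [integral_map H.measurable.aemeasurable f.continuous.aestronglyMeasurable,
      hc _ f.continuous, ← H.fiberLimit_comp hf]
    exact H.integral_eq_fiberLimit_of_continuous hμ hc
      (hf.comp H.measurable H.comm H.unifCont)

end IsShrinkingExtension

end ShrinkingExtension

/-- Lifting Theorem (existence and uniqueness): if the fibers of the extension `T` of `S`
are `(a n)`-shrunk on average with respect to the `S`-invariant probability measure `ν`,
then there is exactly one `T`-invariant Borel probability measure `μ` on `X`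
with `π_* μ = ν`. -/
theorem lifting_exists_unique
    {X Y : Type*} [MetricSpace X] [CompactSpace X] [MeasurableSpace X] [BorelSpace X]
    [MetricSpace Y] [CompactSpace Y] [MeasurableSpace Y] [BorelSpace Y]
    (T : X → X) (S : Y → Y) (π : X → Y)
    (hT : Measurable T) (hS : Measurable S)
    (hπc : Continuous π) (hπs : Function.Surjective π)
    (hcomm : ∀ x, π (T x) = S (π x))
    (ν : Measure Y) [IsProbabilityMeasure ν] (hνinv : Measure.map S ν = ν)
    (a : ℕ → ℝ) (hshrink : ShrunkOnAverage T π ν a) :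
    ∃! μ : Measure X, IsProbabilityMeasure μ ∧ Measure.map T μ = μ ∧ Measure.map π μ = ν := by
  obtain ⟨hω, -, ha, hle⟩ := hshrink
  have H : IsShrinkingExtension T S π ν :=
    ⟨hT, hS, hπc, hπs, hcomm, hνinv, hω,
      squeeze_zero (fun n => integral_nonneg fun y => diam_nonneg) hle ha⟩
  obtain ⟨μ, hμp, hμT, hμ⟩ := H.exists_invariant_lift
  refine ⟨μ, ⟨hμp, hμT, hμ⟩, ?_⟩
  rintro μ' ⟨hμp', hμT', hμ'⟩
  exact H.eq_of_map_eq hμT' hμ' hμT hμ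
end

section
/- Corollary 3.3: If T is continuous and is an extension of S with (a_n)-shrinking fibers, then the pushforward map π_* restricts to a bijection from the set P_T(X) of T-invariant Borel probability measures on X onto the set P_S(Y) of S-invariant Borel probability measures on Y, and this restriction is a homeomorphism when both sets carry the weak-* topology. -/
open MeasureTheory Filter Topology Metric Set

/-- `T` has `(a n)`-shrinking fibers over the factor map `π`. -/
def ShrinkingFibers {X Y : Type*} [PseudoMetricSpace X] (T : X → X) (π : X → Y)
    (a : ℕ → ℝ) : Prop :=
  UnifContAlongFibers T π ∧ (∀ n, 0 < a n) ∧ Filter.Tendsto a Filter.atTop (nhds 0) ∧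
    ∀ (n : ℕ) (x x' : X), π x = π x' → dist (T^[n] x) (T^[n] x') ≤ a n

section FactorMap

variable {X Y : Type*} [MetricSpace X] [CompactSpace X]
  [MetricSpace Y] [MeasurableSpace Y] [BorelSpace Y]

/-- A continuous function oscillating by at most `δ` along the fibers of `π` is within `δ` of a
measurable function of the factor. -/
lemma exists_measurable_abs_sub_comp_le {π : X → Y} (hπc : Continuous π)
    (hπs : Function.Surjective π) {h : X → ℝ} (hc : Continuous h) {δ : ℝ}
    (hosc : ∀ x x', π x = π x' → |h x - h x'| ≤ δ) :
    ∃ g : Y → ℝ, Measurable g ∧ ∀ x, |h x - g (π x)| ≤ δ := by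
  have hmax : ∀ y, ∃ x, π x = y ∧ ∀ x', π x' = y → h x' ≤ h x := fun y ↦ by
    obtain ⟨x, hx, hx'⟩ := ((isClosed_singleton (x := y)).preimage hπc).isCompact.exists_isMaxOn
      (hπs y) hc.continuousOn
    exact ⟨x, hx, fun x' h' ↦ hx' h'⟩
  choose s hs hmax using hmax
  refine ⟨h ∘ s, measurable_of_Ici fun c ↦ ?_, fun x ↦ hosc _ _ (hs _).symm⟩
  have : h ∘ s ⁻¹' Ici c = π '' (h ⁻¹' Ici c) := by
    ext y
    constructor
    · intro hy
      exact ⟨s y, hy, hs y⟩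
    · rintro ⟨x, hx, rfl⟩
      exact le_trans (mem_Ici.1 hx) (hmax _ x rfl)
  rw [this]
  exact ((isClosed_Ici.preimage hc).isCompact.image hπc).isClosed.measurableSet

variable [MeasurableSpace X] [BorelSpace X]

/-- Measures with the same image in the factor almost agree on continuous functions that
oscillate little along the fibers. -/
lemma abs_integral_sub_le_of_map_eq {π : X → Y} (hπc : Continuous π)
    (hπs : Function.Surjective π) {h : X → ℝ} (hc : Continuous h) {δ : ℝ}
    (hosc : ∀ x x', π x = π x' → |h x - h x'| ≤ δ) (μ μ' : Measure X) [IsProbabilityMeasure μ]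
    [IsProbabilityMeasure μ'] (hμ : μ.map π = μ'.map π) :
    |∫ x, h x ∂μ - ∫ x, h x ∂μ'| ≤ 2 * δ := by
  obtain ⟨g, hg, hgh⟩ := exists_measurable_abs_sub_comp_le hπc hπs hc hosc
  have key : ∀ (m : Measure X) [IsProbabilityMeasure m],
      |∫ x, h x ∂m - ∫ y, g y ∂(m.map π)| ≤ δ := by
    intro m _
    have hint : Integrable h m :=
      hc.integrable_of_hasCompactSupport (HasCompactSupport.of_compactSpace h)
    have hdiff : Integrable (fun x ↦ h x - g (π x)) m :=
      Integrable.of_bound (hc.measurable.sub (hg.comp hπc.measurable)).aestronglyMeasurable δ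
        (ae_of_all _ hgh)
    have hgint : Integrable (fun x ↦ g (π x)) m :=
      (hint.sub hdiff).congr (ae_of_all _ fun x ↦ by simp)
    rw [integral_map hπc.aemeasurable hg.aestronglyMeasurable, ← integral_sub hint hgint]
    simpa using norm_integral_le_of_norm_le_const (μ := m) (f := fun x ↦ h x - g (π x))
      (ae_of_all _ hgh)
  have h₁ := abs_le.1 (key μ)
  have h₂ := abs_le.1 (key μ')
  rw [hμ] at h₁
  exact abs_le.2 ⟨by linarith, by linarith⟩

/-- If the fibers shrink under iteration, then the images under `T^[n]` of two measures over the
same measure of the factor become indistinguishable by continuous functions. -/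
lemma ShrinkingFibers.tendsto_integral_iterate_sub {T : X → X} {π : X → Y} {a : ℕ → ℝ}
    (hshrink : ShrinkingFibers T π a) (hTc : Continuous T) (hπc : Continuous π)
    (hπs : Function.Surjective π) {f : X → ℝ} (hf : Continuous f) (μ μ' : Measure X)
    [IsProbabilityMeasure μ] [IsProbabilityMeasure μ'] (hμ : μ.map π = μ'.map π) :
    Tendsto (fun n ↦ ∫ x, f (T^[n] x) ∂μ - ∫ x, f (T^[n] x) ∂μ') atTop (𝓝 0) := by
  obtain ⟨-, -, ha, hdist⟩ := hshrink
  rw [Metric.tendsto_atTop]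
  intro ε hε
  obtain ⟨δ, hδ, hfδ⟩ := Metric.uniformContinuous_iff.1
    (CompactSpace.uniformContinuous_of_continuous hf) (ε / 4) (by positivity)
  obtain ⟨N, hN⟩ := eventually_atTop.1 (ha.eventually_lt_const hδ)
  refine ⟨N, fun n hn ↦ ?_⟩
  have := abs_integral_sub_le_of_map_eq hπc hπs (hf.comp (hTc.iterate n)) (δ := ε / 4)
    (fun x x' hx ↦ (hfδ ((hdist n x x' hx).trans_lt (hN n hn))).le) μ μ' hμ
  rw [Real.dist_eq, sub_zero]
  simp only [Function.comp_apply] at this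
  linarith

/-- Invariant measures of an extension with shrinking fibers are determined by their image in the
factor. -/
lemma ShrinkingFibers.eq_of_map_eq {T : X → X} {π : X → Y} {a : ℕ → ℝ}
    (hshrink : ShrinkingFibers T π a) (hTc : Continuous T) (hπc : Continuous π)
    (hπs : Function.Surjective π) (μ μ' : Measure X) [IsProbabilityMeasure μ]
    [IsProbabilityMeasure μ'] (hTμ : μ.map T = μ) (hTμ' : μ'.map T = μ')
    (hμ : μ.map π = μ'.map π) : μ = μ' := by
  refine ext_of_forall_integral_eq_of_IsFiniteMeasure fun f ↦ ?_
  have hinv : ∀ m : Measure X, m.map T = m → ∀ n, ∫ x, f (T^[n] x) ∂m = ∫ x, f x ∂m := by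
    intro m hm n
    have hmp : MeasurePreserving T m m := ⟨hTc.measurable, hm⟩
    rw [← integral_map (hmp.iterate n).measurable.aemeasurable
      f.continuous.aestronglyMeasurable, (hmp.iterate n).map_eq]
  have := hshrink.tendsto_integral_iterate_sub hTc hπc hπs f.continuous μ μ' hμ
  simp only [hinv μ hTμ, hinv μ' hTμ'] at this
  exact sub_eq_zero.1 (tendsto_nhds_unique tendsto_const_nhds this)

variable [CompactSpace Y]

/-- Every probability measure on the factor lifts to a probability measure on the extension. -/
lemma exists_probabilityMeasure_map_eq {π : X → Y} (hπc : Continuous π)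
    (hπs : Function.Surjective π) (ν : ProbabilityMeasure Y) :
    ∃ μ : ProbabilityMeasure X, μ.map hπc.aemeasurable = ν := by
  have hclosed : IsClosed (range fun μ : ProbabilityMeasure X ↦ μ.map hπc.aemeasurable) :=
    (isCompact_range (ProbabilityMeasure.continuous_map hπc)).isClosed
  obtain ⟨y₀⟩ := ν.nonempty
  let u : ℕ → SimpleFunc Y Y := SimpleFunc.approxOn id measurable_id univ y₀ (mem_univ y₀)
  have hu : ∀ y, Tendsto (fun n ↦ u n y) atTop (𝓝 y) := fun y ↦
    SimpleFunc.tendsto_approxOn measurable_id (mem_univ y₀) (by simp)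
  let s : Y → X := Function.surjInv hπs
  have hmem : ν ∈ range fun μ : ProbabilityMeasure X ↦ μ.map hπc.aemeasurable := by
    refine hclosed.mem_of_tendsto (b := atTop)
      (f := fun n ↦ ν.map (u n).measurable.aemeasurable) ?_ (Eventually.of_forall fun n ↦ ?_)
    · rw [ProbabilityMeasure.tendsto_iff_forall_integral_tendsto]
      intro f
      have hmap : ∀ n, ∫ y, f y ∂(ν.map (u n).measurable.aemeasurable : Measure Y)
          = ∫ y, f (u n y) ∂(ν : Measure Y) := fun n ↦
        integral_map (u n).measurable.aemeasurable f.continuous.aestronglyMeasurable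
      simp only [hmap]
      refine tendsto_integral_of_dominated_convergence (fun _ ↦ ‖f‖)
        (fun n ↦ (f.continuous.measurable.comp (u n).measurable).aestronglyMeasurable)
        (integrable_const _) (fun n ↦ ae_of_all _ fun y ↦ f.norm_coe_le_norm _)
        (ae_of_all _ fun y ↦ (f.continuous.tendsto y).comp (hu y))
    · have hs : Measurable fun y ↦ s (u n y) := ((u n).map s).measurable
      refine ⟨ν.map hs.aemeasurable, Subtype.ext ?_⟩
      change Measure.map π (Measure.map _ (ν : Measure Y)) = Measure.map (u n) (ν : Measure Y)
      rw [Measure.map_map hπc.measurable hs]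
      congr 1
      ext y
      exact Function.surjInv_eq hπs _
  exact hmem

/-- Every invariant probability measure of the factor is the image of an invariant probability
measure of an extension with shrinking fibers. -/
lemma ShrinkingFibers.exists_invariant_map_eq {T : X → X} {S : Y → Y} {π : X → Y} {a : ℕ → ℝ}
    (hshrink : ShrinkingFibers T π a) (hTc : Continuous T) (hS : Measurable S)
    (hπc : Continuous π) (hπs : Function.Surjective π) (hcomm : Function.Semiconj π T S)
    (ν : ProbabilityMeasure Y) (hν : (ν : Measure Y).map S = ν) :
    ∃ μ : ProbabilityMeasure X, (μ : Measure X).map T = μ ∧ (μ : Measure X).map π = ν := by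
  obtain ⟨μ₀, hμ₀⟩ := exists_probabilityMeasure_map_eq hπc hπs ν
  replace hμ₀ : (μ₀ : Measure X).map π = ν := congrArg Subtype.val hμ₀
  have hνmp : MeasurePreserving S (ν : Measure Y) ν := ⟨hS, hν⟩
  have hπT : ∀ n, ((μ₀ : Measure X).map T^[n]).map π = ν := fun n ↦ by
    rw [Measure.map_map hπc.measurable (hTc.iterate n).measurable,
      (hcomm.iterate_right n).comp_eq, ← Measure.map_map (hνmp.iterate n).measurable
      hπc.measurable, hμ₀, (hνmp.iterate n).map_eq]
  let μs : ℕ → ProbabilityMeasure X := fun n ↦ μ₀.map (hTc.iterate n).aemeasurable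
  let U : Ultrafilter (ProbabilityMeasure X) := (hyperfilter ℕ).map μs
  obtain ⟨μ, -, hμ⟩ := isCompact_univ.ultrafilter_le_nhds U (by simp)
  replace hμ : Tendsto μs (hyperfilter ℕ) (𝓝 μ) := hμ
  refine ⟨μ, ext_of_forall_integral_eq_of_IsFiniteMeasure fun f ↦ ?_, ?_⟩
  · have hlim := ((ProbabilityMeasure.tendsto_iff_forall_integral_tendsto.1
      (ProbabilityMeasure.tendsto_map_of_tendsto_of_continuous _ _ hμ hTc)) f).sub
      (ProbabilityMeasure.tendsto_iff_forall_integral_tendsto.1 hμ f)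
    have hT₀ : IsProbabilityMeasure ((μ₀ : Measure X).map T) :=
      Measure.isProbabilityMeasure_map hTc.aemeasurable
    have hzero := (hshrink.tendsto_integral_iterate_sub hTc hπc hπs f.continuous
      ((μ₀ : Measure X).map T) μ₀ (by rw [hμ₀]; exact hπT 1)).mono_left
      Nat.hyperfilter_le_atTop
    refine sub_eq_zero.1 (tendsto_nhds_unique hlim (hzero.congr fun n ↦ ?_))
    have hcn := (hTc.iterate n).measurable
    simp only [μs, ProbabilityMeasure.toMeasure_map]
    rw [Measure.map_map hTc.measurable hcn, ← Function.iterate_succ', Function.iterate_succ,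
      ← Measure.map_map hcn hTc.measurable,
      integral_map hcn.aemeasurable f.continuous.aestronglyMeasurable,
      integral_map hcn.aemeasurable f.continuous.aestronglyMeasurable]
  · have hlim := ProbabilityMeasure.tendsto_map_of_tendsto_of_continuous _ _ hμ hπc
    have hconst : ∀ n, (μs n).map hπc.aemeasurable = ν := fun n ↦ Subtype.ext (hπT n)
    simp only [hconst] at hlim
    have hμν : μ.map hπc.aemeasurable = ν := tendsto_nhds_unique hlim tendsto_const_nhds
    exact congrArg Subtype.val hμν

end FactorMap

/-- Corollary 3.3: if `T` is continuous and is an extension of `S` with `(a n)`-shrinking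
fibers, then the pushforward by `π` restricts to a homeomorphism (in particular a bijection)
from the set of `T`-invariant Borel probability measures on `X`, with the weak-* topology,
onto the set of `S`-invariant Borel probability measures on `Y`. -/
theorem pushforward_homeomorphism_of_invariant_measures
    {X Y : Type*} [MetricSpace X] [CompactSpace X] [MeasurableSpace X] [BorelSpace X]
    [MetricSpace Y] [CompactSpace Y] [MeasurableSpace Y] [BorelSpace Y]
    (T : X → X) (S : Y → Y) (π : X → Y)
    (hT : Measurable T) (hS : Measurable S) (hTc : Continuous T)
    (hπc : Continuous π) (hπs : Function.Surjective π)
    (hcomm : ∀ x, π (T x) = S (π x))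
    (a : ℕ → ℝ) (hshrink : ShrinkingFibers T π a) :
    ∃ e : {μ : ProbabilityMeasure X // Measure.map T (μ : Measure X) = (μ : Measure X)} ≃ₜ
        {ν : ProbabilityMeasure Y // Measure.map S (ν : Measure Y) = (ν : Measure Y)},
      ∀ μ : {μ : ProbabilityMeasure X // Measure.map T (μ : Measure X) = (μ : Measure X)},
        ((e μ).1 : Measure Y) = Measure.map π (μ.1 : Measure X) := by
  have hmaps : ∀ μ : ProbabilityMeasure X, (μ : Measure X).map T = μ →
      ((μ.map hπc.aemeasurable : ProbabilityMeasure Y) : Measure Y).map S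
        = (μ.map hπc.aemeasurable : ProbabilityMeasure Y) := fun μ hμ ↦ by
    rw [ProbabilityMeasure.toMeasure_map, Measure.map_map hS hπc.measurable,
      show S ∘ π = π ∘ T from funext fun x ↦ (hcomm x).symm,
      ← Measure.map_map hπc.measurable hT, hμ]
  have hclosed : IsClosed {μ : ProbabilityMeasure X | (μ : Measure X).map T = μ} := by
    have : {μ : ProbabilityMeasure X | (μ : Measure X).map T = μ}
        = {μ | μ.map hTc.aemeasurable = μ} := by
      ext μ
      exact (Subtype.ext_iff (a1 := μ.map hTc.aemeasurable) (a2 := μ)).symm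
    rw [this]
    exact isClosed_eq (ProbabilityMeasure.continuous_map hTc) continuous_id
  have : CompactSpace {μ : ProbabilityMeasure X // (μ : Measure X).map T = μ} :=
    isCompact_iff_compactSpace.1 hclosed.isCompact
  let F : {μ : ProbabilityMeasure X // (μ : Measure X).map T = μ} →
      {ν : ProbabilityMeasure Y // (ν : Measure Y).map S = ν} :=
    Subtype.map (fun μ ↦ μ.map hπc.aemeasurable) hmaps
  have hF : Function.Bijective F := by
    refine ⟨fun μ μ' h ↦ ?_, fun ν ↦ ?_⟩
    · exact Subtype.ext (Subtype.ext (hshrink.eq_of_map_eq hTc hπc hπs μ.1 μ'.1 μ.2 μ'.2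
        (congrArg (fun ν ↦ (ν.1 : Measure Y)) h)))
    · obtain ⟨μ, hμ, hμν⟩ := hshrink.exists_invariant_map_eq hTc hS hπc hπs hcomm ν.1 ν.2
      exact ⟨⟨μ, hμ⟩, Subtype.ext (Subtype.ext hμν)⟩
  have hFc : Continuous F := (ProbabilityMeasure.continuous_map hπc).subtype_map hmaps
  exact ⟨Continuous.homeoOfEquivCompactToT2 (f := Equiv.ofBijective F hF) hFc, fun μ ↦ rfl⟩
end

section
/- Corollary 3.6 (stable leaves): Suppose T is continuous, π induces a continuous fibration with some modulus ω̄_π, μ̌ is an S-invariant Borel probability measure on Y whose fibers are (ā_n)-shrunk on average with respect to μ̌, and μ is the unique T-invariant lift of μ̌. Then for every Borel probability measure ν on X, the sequence T^n_*ν converges to μ in the weak-* topology if and only if S^n_*(π_*ν) converges to μ̌ in the weak-* topology. -/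
open MeasureTheory Filter Topology Metric Set

/-- Fibers of a continuous fibration depend continuously on the base point. -/
theorem exists_dist_lt_of_fibration {X Y : Type*} [PseudoMetricSpace X] [PseudoMetricSpace Y]
    {π : X → Y} {ω : ℝ → ℝ} (hω : IsModulus ω)
    (hfib : ∀ y y' : Y, ∀ x ∈ π ⁻¹' {y}, ∃ x' ∈ π ⁻¹' {y'}, dist x x' ≤ ω (dist y y'))
    {ε : ℝ} (hε : 0 < ε) :
    ∃ δ > 0, ∀ y y' : Y, dist y y' < δ → ∀ x, π x = y → ∃ x', π x' = y' ∧ dist x x' < ε := by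
  obtain ⟨hc, -, -, h0, -⟩ := hω
  obtain ⟨δ, hδ, h⟩ := Metric.continuousWithinAt_iff.1 (hc 0 self_mem_Ici) ε hε
  refine ⟨δ, hδ, fun y y' hy x hx => ?_⟩
  obtain ⟨x', hx', hd⟩ := hfib y y' x hx
  refine ⟨x', hx', hd.trans_lt ?_⟩
  have := h (x := dist y y') dist_nonneg (by simpa [Real.dist_eq] using hy)
  rw [h0, Real.dist_eq, sub_zero] at this
  exact (le_abs_self _).trans_lt this

/-- A one-sided uniform estimate, being symmetric, gives continuity of a real function. -/
theorem continuous_of_forall_le_add {Y : Type*} [PseudoMetricSpace Y] {φ : Y → ℝ}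
    (h : ∀ ε > 0, ∃ δ > 0, ∀ y y' : Y, dist y y' < δ → φ y ≤ φ y' + ε) : Continuous φ := by
  refine Metric.continuous_iff.2 fun y ε hε => ?_
  obtain ⟨δ, hδ, h⟩ := h (ε / 2) (half_pos hε)
  refine ⟨δ, hδ, fun y' hy' => ?_⟩
  have h₁ := h y' y hy'
  have h₂ := h y y' (by rwa [dist_comm])
  rw [Real.dist_eq, abs_lt]
  constructor <;> linarith

/-- The fiberwise supremum of a continuous function along a continuous fibration is continuous. -/
theorem continuous_sSup_image_fiber {X Y : Type*} [PseudoMetricSpace X] [CompactSpace X]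
    [PseudoMetricSpace Y] {π : X → Y} (hπs : Function.Surjective π) {ω : ℝ → ℝ} (hω : IsModulus ω)
    (hfib : ∀ y y' : Y, ∀ x ∈ π ⁻¹' {y}, ∃ x' ∈ π ⁻¹' {y'}, dist x x' ≤ ω (dist y y'))
    {F : X → ℝ} (hF : Continuous F) : Continuous fun y => sSup (F '' (π ⁻¹' {y})) := by
  refine continuous_of_forall_le_add fun ε hε => ?_
  obtain ⟨η, hη, hFη⟩ := Metric.uniformContinuous_iff.1
    (CompactSpace.uniformContinuous_of_continuous hF) ε hε
  obtain ⟨δ, hδ, h⟩ := exists_dist_lt_of_fibration hω hfib hη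
  refine ⟨δ, hδ, fun y y' hy => ?_⟩
  refine csSup_le (Set.Nonempty.image F (hπs y)) ?_
  rintro _ ⟨x, hx, rfl⟩
  obtain ⟨x', hx', hd⟩ := h y y' hy x hx
  have hle : F x' ≤ sSup (F '' (π ⁻¹' {y'})) :=
    le_csSup ((isCompact_range hF).bddAbove.mono (image_subset_range F _)) ⟨x', hx', rfl⟩
  have := (abs_lt.1 (Real.dist_eq (F x) (F x') ▸ hFη hd)).2
  linarith

/-- The diameter of the image of a fiber of a continuous fibration under a continuous map is
a continuous function of the base point. -/
theorem continuous_diam_image_fiber {X Y Z : Type*} [PseudoMetricSpace X] [CompactSpace X]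
    [PseudoMetricSpace Y] [PseudoMetricSpace Z] {π : X → Y} {ω : ℝ → ℝ} (hω : IsModulus ω)
    (hfib : ∀ y y' : Y, ∀ x ∈ π ⁻¹' {y}, ∃ x' ∈ π ⁻¹' {y'}, dist x x' ≤ ω (dist y y'))
    {G : X → Z} (hG : Continuous G) : Continuous fun y => diam (G '' (π ⁻¹' {y})) := by
  refine continuous_of_forall_le_add fun ε hε => ?_
  obtain ⟨η, hη, hGη⟩ := Metric.uniformContinuous_iff.1
    (CompactSpace.uniformContinuous_of_continuous hG) (ε / 2) (half_pos hε)
  obtain ⟨δ, hδ, h⟩ := exists_dist_lt_of_fibration hω hfib hη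
  refine ⟨δ, hδ, fun y y' hy => ?_⟩
  refine diam_le_of_forall_dist_le (add_nonneg diam_nonneg hε.le) ?_
  rintro _ ⟨x₁, hx₁, rfl⟩ _ ⟨x₂, hx₂, rfl⟩
  obtain ⟨x₁', hx₁', hd₁⟩ := h y y' hy x₁ hx₁
  obtain ⟨x₂', hx₂', hd₂⟩ := h y y' hy x₂ hx₂
  have hle : dist (G x₁') (G x₂') ≤ diam (G '' (π ⁻¹' {y'})) :=
    dist_le_diam_of_mem ((isCompact_range hG).isBounded.subset (image_subset_range G _))
      ⟨x₁', hx₁', rfl⟩ ⟨x₂', hx₂', rfl⟩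
  have h₁ := hGη hd₁
  have h₂ := hGη hd₂
  rw [dist_comm] at h₂
  linarith [dist_triangle4 (G x₁) (G x₁') (G x₂') (G x₂)]

/-- A continuous function on a compact space is Lipschitz up to an arbitrarily small error. -/
theorem exists_abs_sub_le_add_mul_dist {X : Type*} [PseudoMetricSpace X] [CompactSpace X]
    {f : X → ℝ} (hf : Continuous f) {ε : ℝ} (hε : 0 < ε) :
    ∃ K, 0 ≤ K ∧ ∀ x x', |f x - f x'| ≤ ε + K * dist x x' := by
  obtain ⟨δ, hδ, h⟩ := Metric.uniformContinuous_iff.1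
    (CompactSpace.uniformContinuous_of_continuous hf) ε hε
  have hbdd := (isCompact_range hf).isBounded
  have hK : 0 ≤ diam (range f) / δ := div_nonneg diam_nonneg hδ.le
  refine ⟨diam (range f) / δ, hK, fun x x' => ?_⟩
  rcases lt_or_ge (dist x x') δ with hx | hx
  · have := h hx
    rw [Real.dist_eq] at this
    linarith [mul_nonneg hK (dist_nonneg (x := x) (y := x'))]
  · have h₁ : |f x - f x'| ≤ diam (range f) := by
      rw [← Real.dist_eq]
      exact dist_le_diam_of_mem hbdd ⟨x, rfl⟩ ⟨x', rfl⟩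
    have h₂ := mul_le_mul_of_nonneg_left hx hK
    rw [div_mul_cancel₀ _ hδ.ne'] at h₂
    linarith

/-- A continuous real function on a compact space is integrable for any finite Borel measure. -/
theorem integrable_of_continuous_of_compactSpace {X : Type*} [MetricSpace X] [CompactSpace X]
    [MeasurableSpace X] [BorelSpace X] {F : X → ℝ} (hF : Continuous F) (ρ : Measure X)
    [IsFiniteMeasure ρ] : Integrable F ρ :=
  hF.integrable_of_hasCompactSupport (HasCompactSupport.of_compactSpace F)

/-- A fiberwise bound between a function upstairs and one downstairs integrates. -/
theorem abs_integral_sub_integral_map_le {X Y : Type*} [MetricSpace X] [CompactSpace X]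
    [MeasurableSpace X] [BorelSpace X] [MetricSpace Y] [CompactSpace Y] [MeasurableSpace Y]
    [BorelSpace Y] {π : X → Y} (hπ : Continuous π) {F : X → ℝ} {g D : Y → ℝ}
    (hF : Continuous F) (hg : Continuous g) (hD : Continuous D)
    (h : ∀ x, |F x - g (π x)| ≤ D (π x)) (ρ : Measure X) [IsFiniteMeasure ρ] :
    |(∫ x, F x ∂ρ) - ∫ y, g y ∂(Measure.map π ρ)| ≤ ∫ y, D y ∂(Measure.map π ρ) := by
  rw [integral_map hπ.aemeasurable hg.aestronglyMeasurable,
    integral_map hπ.aemeasurable hD.aestronglyMeasurable,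
    ← integral_sub (integrable_of_continuous_of_compactSpace hF ρ)
      (integrable_of_continuous_of_compactSpace (F := fun x => g (π x)) (hg.comp hπ) ρ)]
  refine abs_integral_le_integral_abs.trans (integral_mono ?_ ?_ h)
  · exact integrable_of_continuous_of_compactSpace (hF.sub (hg.comp hπ)).abs ρ
  · exact integrable_of_continuous_of_compactSpace (hD.comp hπ) ρ

/-- Corollary 3.6 (stable leaves): with `T` continuous, `π` inducing a continuous fibration,
fibers shrunk on average with respect to the `S`-invariant measure `μY`, and `μ` the unique
`T`-invariant lift of `μY`, a probability measure `ν` on `X` satisfies `T^n_* ν → μ`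
weakly-* if and only if `S^n_*(π_* ν) → μY` weakly-*. -/
theorem stable_leaf_iff
    {X Y : Type*} [MetricSpace X] [CompactSpace X] [MeasurableSpace X] [BorelSpace X]
    [MetricSpace Y] [CompactSpace Y] [MeasurableSpace Y] [BorelSpace Y]
    (T : X → X) (S : Y → Y) (π : X → Y)
    (hT : Measurable T) (hS : Measurable S) (hTc : Continuous T)
    (hπc : Continuous π) (hπs : Function.Surjective π)
    (hcomm : ∀ x, π (T x) = S (π x))
    (ωπ : ℝ → ℝ) (hωπmod : IsModulus ωπ)
    (hfib : ∀ y y' : Y, ∀ x ∈ π ⁻¹' {y}, ∃ x' ∈ π ⁻¹' {y'}, dist x x' ≤ ωπ (dist y y'))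
    (μY : Measure Y) [IsProbabilityMeasure μY] (hμYinv : Measure.map S μY = μY)
    (a : ℕ → ℝ) (hshrink : ShrunkOnAverage T π μY a)
    (μ : Measure X) [IsProbabilityMeasure μ]
    (hμinv : Measure.map T μ = μ) (hμlift : Measure.map π μ = μY)
    (ν : Measure X) [IsProbabilityMeasure ν] :
    (∀ f : X → ℝ, Continuous f →
        Filter.Tendsto (fun n : ℕ => ∫ x, f x ∂(Measure.map T^[n] ν)) Filter.atTop
          (nhds (∫ x, f x ∂μ))) ↔
      ∀ g : Y → ℝ, Continuous g →
        Filter.Tendsto (fun n : ℕ => ∫ y, g y ∂(Measure.map S^[n] (Measure.map π ν)))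
          Filter.atTop (nhds (∫ y, g y ∂μY)) := by
  have hSc : Continuous S := by
    have hq : IsQuotientMap π := hπc.isClosedMap.isQuotientMap hπc hπs
    refine hq.continuous_iff.2 ?_
    have : S ∘ π = π ∘ T := funext fun x => (hcomm x).symm
    rw [this]
    exact hπc.comp hTc
  have hsemi : ∀ n : ℕ, Measure.map π (Measure.map T^[n] ν) =
      Measure.map S^[n] (Measure.map π ν) := fun n => by
    rw [Measure.map_map hπc.measurable (hT.iterate n), Measure.map_map (hS.iterate n) hπc.measurable]
    congr 1
    exact funext ((show Function.Semiconj π T S from hcomm).iterate_right n)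
  constructor
  · intro h g hg
    have := h (fun x => g (π x)) (hg.comp hπc)
    simp only [← hsemi, ← hμlift]
    simpa only [integral_map hπc.aemeasurable hg.aestronglyMeasurable] using this
  · intro h f hf
    obtain ⟨-, -, ha, hshr⟩ := hshrink
    refine Metric.tendsto_atTop'.2 fun ε hε => ?_
    have hε' : 0 < ε / 7 := by positivity
    obtain ⟨K, hK, hfK⟩ := exists_abs_sub_le_add_mul_dist hf hε'
    obtain ⟨N, hN⟩ : ∃ N, K * a N < ε / 7 := by
      have : Tendsto (fun n => K * a n) atTop (𝓝 0) := by simpa using ha.const_mul K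
      exact (this.eventually_lt_const hε').exists
    have hTN : Continuous T^[N] := hTc.iterate N
    set F : X → ℝ := fun x => f (T^[N] x) with hF_def
    have hF : Continuous F := hf.comp hTN
    set g : Y → ℝ := fun y => sSup (F '' (π ⁻¹' {y}))
    have hg : Continuous g := continuous_sSup_image_fiber hπs hωπmod hfib hF
    set d : Y → ℝ := fun y => diam (T^[N] '' (π ⁻¹' {y}))
    have hd : Continuous d := continuous_diam_image_fiber hωπmod hfib hTN
    set D : Y → ℝ := fun y => ε / 7 + K * d y
    have hD : Continuous D := by fun_prop
    have hFgD : ∀ x, |F x - g (π x)| ≤ D (π x) := fun x => by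
      have hlow : F x ≤ g (π x) :=
        le_csSup ((isCompact_range hF).bddAbove.mono (image_subset_range F _)) ⟨x, rfl, rfl⟩
      have hup : g (π x) ≤ F x + D (π x) := by
        refine csSup_le ⟨_, x, rfl, rfl⟩ ?_
        rintro _ ⟨x', hx', rfl⟩
        have h₁ : dist (T^[N] x') (T^[N] x) ≤ d (π x) :=
          dist_le_diam_of_mem (isBounded_of_compactSpace) ⟨x', hx', rfl⟩ ⟨x, rfl, rfl⟩
        have h₂ := (abs_le.1 (hfK (T^[N] x') (T^[N] x))).2
        have h₃ := mul_le_mul_of_nonneg_left h₁ hK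
        simp only [hF_def, D]
        linarith
      rw [abs_le]
      constructor <;> linarith
    have hDμ : ∫ y, D y ∂μY < 2 * (ε / 7) := by
      have hKd : Integrable (fun y => K * d y) μY :=
        (integrable_of_continuous_of_compactSpace hd μY).const_mul K
      have h₁ : ∫ y, D y ∂μY = ε / 7 + K * ∫ y, d y ∂μY := by
        rw [integral_add (integrable_const _) hKd, integral_const_mul]
        simp
      have h₂ := mul_le_mul_of_nonneg_left (hshr N) hK
      linarith
    have hFμ : ∫ x, F x ∂μ = ∫ x, f x ∂μ := by
      have hinv : Measure.map T^[N] μ = μ :=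
        ((⟨hT, hμinv⟩ : MeasurePreserving T μ μ).iterate N).map_eq
      conv_rhs => rw [← hinv]
      rw [integral_map hTN.aemeasurable hf.aestronglyMeasurable]
    have hlim := abs_integral_sub_integral_map_le hπc hF hg hD hFgD μ
    rw [hμlift, hFμ, abs_le] at hlim
    have hev := ((h D hD).eventually_lt_const hDμ).and
      (Metric.tendsto_nhds.1 (h g hg) (ε / 7) hε')
    obtain ⟨M, hM⟩ := eventually_atTop.1 hev
    refine ⟨M + N, fun n hn => ?_⟩
    obtain ⟨m, rfl⟩ : ∃ m, n = N + m := ⟨n - N, by omega⟩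
    obtain ⟨hm₁, hm₂⟩ := hM m (by omega)
    have : IsProbabilityMeasure (Measure.map T^[m] ν) :=
      Measure.isProbabilityMeasure_map (hT.iterate m).aemeasurable
    have hfin := abs_integral_sub_integral_map_le hπc hF hg hD hFgD (Measure.map T^[m] ν)
    have hsplit : ∫ x, f x ∂(Measure.map T^[N + m] ν) = ∫ x, F x ∂(Measure.map T^[m] ν) := by
      rw [Function.iterate_add, ← Measure.map_map (hT.iterate N) (hT.iterate m),
        integral_map hTN.aemeasurable hf.aestronglyMeasurable]
    rw [hsemi, abs_le] at hfin
    rw [Real.dist_eq, abs_lt] at hm₂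
    rw [hsplit, Real.dist_eq, abs_lt]
    constructor <;> linarith
end

section
/- Quantitative core of Theorem B: Assume diam Y ≤ 1, T is L-Lipschitz (L ≥ 1) and has (a_n)-shrinking fibers with a_n ≤ C₀θ^n for some C₀ > 0 and θ ∈ (0,1), and π induces a Hölder fibration: there exist K > 0 and α' ∈ (0,1] such that for all y,y' ∈ Y and every x ∈ π⁻¹(y) there is x' ∈ π⁻¹(y') with d(x,x') ≤ K·d(y,y')^{α'}. Let μ̌ be an S-invariant Borel probability measure on Y and μ its unique T-invariant lift. If ν is a Borel probability measure on X for which there exist C₁ > 0 and δ ∈ (0,1) with ‖S^n_*(π_*ν) − μ̌‖_{TV} ≤ C₁(1−δ)^n for all n (total variation norm), then there exist C > 0 and η ∈ (0,1) such that for all n and every 1-Lipschitz f : X → ℝ, |∫ f d(T^n_*ν) − ∫ f dμ| ≤ C·η^n. -/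
open MeasureTheory Filter Topology Metric Set

/-- The integrals of a function bounded by `M` against two finite measures differ by at most
`M` times the total variation of the difference of the measures. -/
theorem abs_integral_sub_integral_le_totalVariation {Y : Type*} [MeasurableSpace Y]
    (ρ σ : Measure Y) [IsFiniteMeasure ρ] [IsFiniteMeasure σ] {h : Y → ℝ} (hh : Measurable h)
    {M : ℝ} (hM : ∀ y, |h y| ≤ M) :
    |(∫ y, h y ∂ρ) - ∫ y, h y ∂σ| ≤
      M * ((ρ.toSignedMeasure - σ.toSignedMeasure).totalVariation univ).toReal := by
  set s := ρ.toSignedMeasure - σ.toSignedMeasure with hs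
  set p := s.toJordanDecomposition.posPart
  set q := s.toJordanDecomposition.negPart
  have hpq : p.toSignedMeasure - q.toSignedMeasure = s :=
    s.toSignedMeasure_toJordanDecomposition
  have hadd : ρ + q = σ + p := by
    rw [← Measure.toSignedMeasure_eq_toSignedMeasure_iff, Measure.toSignedMeasure_add,
      Measure.toSignedMeasure_add,
      ← sub_eq_sub_iff_add_eq_add.mp (hpq.trans hs), add_comm]
  have hint : ∀ (τ : Measure Y) [IsFiniteMeasure τ], Integrable h τ := fun τ _ =>
    Integrable.of_bound hh.aestronglyMeasurable M (Eventually.of_forall hM)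
  have hbd : ∀ (τ : Measure Y) [IsFiniteMeasure τ], |∫ y, h y ∂τ| ≤ M * (τ univ).toReal :=
    fun τ _ => by
    simpa only [Real.norm_eq_abs, measureReal_def] using
      norm_integral_le_of_norm_le_const (μ := τ) (f := h) (Eventually.of_forall hM)
  have hI := congrArg (fun τ => ∫ y, h y ∂τ) hadd
  simp only [integral_add_measure (hint _) (hint _)] at hI
  have htv : (s.totalVariation univ).toReal = (p univ).toReal + (q univ).toReal :=
    ENNReal.toReal_add (measure_ne_top _ _) (measure_ne_top _ _)
  rw [htv, show (∫ y, h y ∂ρ) - ∫ y, h y ∂σ = (∫ y, h y ∂p) - ∫ y, h y ∂q by linarith, mul_add]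
  exact (abs_sub _ _).trans (add_le_add (hbd p) (hbd q))

/-- The maximum of a continuous function over the fibers of a continuous surjection from a
compact space is a measurable function on the base, attained on each fiber. -/
theorem exists_measurable_fiber_maximum {X Y : Type*} [TopologicalSpace X] [CompactSpace X]
    [TopologicalSpace Y] [T2Space Y] [MeasurableSpace Y] [BorelSpace Y]
    {π : X → Y} (hπc : Continuous π) (hπs : Function.Surjective π)
    {g : X → ℝ} (hg : Continuous g) :
    ∃ h : Y → ℝ, Measurable h ∧
      ∀ y, ∃ x, π x = y ∧ h y = g x ∧ ∀ x', π x' = y → g x' ≤ h y := by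
  have hmax : ∀ y, ∃ x, π x = y ∧ ∀ x', π x' = y → g x' ≤ g x := by
    intro y
    obtain ⟨x, hx, hx'⟩ := ((isClosed_singleton (x := y)).preimage hπc).isCompact.exists_isMaxOn
      (hπs y) hg.continuousOn
    exact ⟨x, hx, fun x' h => hx' h⟩
  choose φ hφ hφmax using hmax
  refine ⟨fun y => g (φ y), measurable_of_Ici fun c => ?_,
    fun y => ⟨φ y, hφ y, rfl, hφmax y⟩⟩
  have himage : (fun y => g (φ y)) ⁻¹' Ici c = π '' (g ⁻¹' Ici c) := by
    ext y
    constructor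
    · exact fun h => ⟨φ y, h, hφ y⟩
    · rintro ⟨x, hx, rfl⟩
      exact le_trans (mem_Ici.mp hx) (hφmax _ x rfl)
  rw [himage]
  exact (((isClosed_Ici.preimage hg).isCompact.image hπc).isClosed).measurableSet

/-- If `g` is bounded by `M` and varies by at most `ε` on each fiber of `π`, then its integrals
against two probability measures are close as soon as the images of these measures under `π`
are close in total variation. -/
theorem abs_integral_sub_integral_le_of_fiber_oscillation {X Y : Type*}
    [TopologicalSpace X] [CompactSpace X] [MeasurableSpace X] [BorelSpace X]
    [TopologicalSpace Y] [T2Space Y] [MeasurableSpace Y] [BorelSpace Y]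
    {π : X → Y} (hπc : Continuous π) (hπs : Function.Surjective π)
    {g : X → ℝ} (hg : Continuous g) {M ε : ℝ} (hM : ∀ x, |g x| ≤ M)
    (hε : ∀ x x', π x = π x' → |g x - g x'| ≤ ε)
    (ρ σ : Measure X) [IsProbabilityMeasure ρ] [IsProbabilityMeasure σ] :
    |(∫ x, g x ∂ρ) - ∫ x, g x ∂σ| ≤ 2 * ε +
      M * (((ρ.map π).toSignedMeasure - (σ.map π).toSignedMeasure).totalVariation univ).toReal := by
  obtain ⟨h, hh, hatt⟩ := exists_measurable_fiber_maximum hπc hπs hg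
  have hclose : ∀ x, |g x - h (π x)| ≤ ε := by
    intro x
    obtain ⟨x', hx', hy, -⟩ := hatt (π x)
    rw [hy]
    exact hε x x' hx'.symm
  have hhM : ∀ y, |h y| ≤ M := by
    intro y
    obtain ⟨x, -, hy, -⟩ := hatt y
    rw [hy]
    exact hM x
  have hstep : ∀ (τ : Measure X) [IsProbabilityMeasure τ],
      |(∫ x, g x ∂τ) - ∫ y, h y ∂(τ.map π)| ≤ ε := by
    intro τ _
    rw [integral_map hπc.measurable.aemeasurable hh.aestronglyMeasurable, ← integral_sub]
    · simpa using norm_integral_le_of_norm_le_const (μ := τ) (f := fun x => g x - h (π x))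
        (Eventually.of_forall hclose)
    · exact Integrable.of_bound hg.measurable.aestronglyMeasurable M (Eventually.of_forall hM)
    · exact Integrable.of_bound (hh.comp hπc.measurable).aestronglyMeasurable M
        (Eventually.of_forall fun x => hhM _)
  have hρ := abs_le.mp (hstep ρ)
  have hσ := abs_le.mp (hstep σ)
  have hbase := abs_le.mp
    (abs_integral_sub_integral_le_totalVariation (ρ.map π) (σ.map π) hh hhM)
  rw [abs_le]
  constructor <;> linarith [hρ.1, hρ.2, hσ.1, hσ.2, hbase.1, hbase.2]

/-- A geometric sequence evaluated at an index at least `n / 2` decays geometrically in `n`. -/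
theorem pow_le_inv_mul_sqrt_pow {r s : ℝ} (hr : 0 ≤ r) (hrs : r ≤ s) (hs : 0 < s) (hs1 : s ≤ 1)
    {k n : ℕ} (hk : n / 2 ≤ k) : r ^ k ≤ (√s)⁻¹ * √s ^ n := by
  have hpos : 0 < √s := Real.sqrt_pos.mpr hs
  have hle : √s ≤ 1 := Real.sqrt_le_one.mpr hs1
  calc r ^ k ≤ s ^ k := pow_le_pow_left₀ hr hrs k
    _ = (√s)⁻¹ * √s ^ (2 * k + 1) := by
        rw [pow_succ, pow_mul, Real.sq_sqrt hs.le]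
        field_simp
    _ ≤ (√s)⁻¹ * √s ^ n :=
        mul_le_mul_of_nonneg_left (pow_le_pow_of_le_one hpos.le hle (by omega))
          (inv_nonneg.mpr hpos.le)

/-- Quantitative core of Theorem B: exponentially shrinking fibers, a Lipschitz `T`, a
Hölder fibration, and exponential total-variation convergence of `S^n_*(π_* ν)` to `μY`
imply exponential Wasserstein (Kantorovich-dual) convergence of `T^n_* ν` to the unique
invariant lift `μ` of `μY`. -/
theorem exponential_convergence_of_pushforwards
    {X Y : Type*} [MetricSpace X] [CompactSpace X] [MeasurableSpace X] [BorelSpace X]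
    [MetricSpace Y] [CompactSpace Y] [MeasurableSpace Y] [BorelSpace Y]
    (hdiamY : Metric.diam (Set.univ : Set Y) ≤ 1)
    (T : X → X) (S : Y → Y) (π : X → Y)
    (hT : Measurable T) (hS : Measurable S)
    (L : ℝ) (hL : 1 ≤ L) (hTLip : LipschitzWith (Real.toNNReal L) T)
    (hπc : Continuous π) (hπs : Function.Surjective π)
    (hcomm : ∀ x, π (T x) = S (π x))
    (a : ℕ → ℝ) (hshrink : ShrinkingFibers T π a)
    (C₀ : ℝ) (hC₀ : 0 < C₀) (θ : ℝ) (hθ : θ ∈ Set.Ioo (0 : ℝ) 1)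
    (ha : ∀ n, a n ≤ C₀ * θ ^ n)
    (K : ℝ) (hK : 0 < K) (α' : ℝ) (hα' : α' ∈ Set.Ioc (0 : ℝ) 1)
    (hfib : ∀ y y' : Y, ∀ x ∈ π ⁻¹' {y}, ∃ x' ∈ π ⁻¹' {y'},
      dist x x' ≤ K * dist y y' ^ α')
    (μY : Measure Y) [IsProbabilityMeasure μY] (hμYinv : Measure.map S μY = μY)
    (μ : Measure X) [IsProbabilityMeasure μ]
    (hμinv : Measure.map T μ = μ) (hμlift : Measure.map π μ = μY)
    (ν : Measure X) [IsProbabilityMeasure ν]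
    (C₁ : ℝ) (hC₁ : 0 < C₁) (δ : ℝ) (hδ : δ ∈ Set.Ioo (0 : ℝ) 1)
    (hTV : ∀ n : ℕ,
      ((Measure.map S^[n] (Measure.map π ν)).toSignedMeasure -
          μY.toSignedMeasure).totalVariation Set.univ ≤ ENNReal.ofReal (C₁ * (1 - δ) ^ n)) :
    ∃ C > (0 : ℝ), ∃ η ∈ Set.Ioo (0 : ℝ) 1, ∀ (n : ℕ) (f : X → ℝ), LipschitzWith 1 f →
      |(∫ x, f x ∂(Measure.map T^[n] ν)) - ∫ x, f x ∂μ| ≤ C * η ^ n := by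
  have hTc : Continuous T := hTLip.continuous
  obtain ⟨-, -, -, hfiber⟩ := hshrink
  obtain ⟨x₀⟩ : Nonempty X := nonempty_of_isProbabilityMeasure ν
  set D := diam (univ : Set X)
  set s := max θ (1 - δ)
  have hD : 0 ≤ D := diam_nonneg
  have hs : 0 < s := hθ.1.trans_le (le_max_left _ _)
  have hs1 : s < 1 := max_lt hθ.2 (by linarith [hδ.1])
  have hsqrt : 0 < √s := Real.sqrt_pos.mpr hs
  refine ⟨(2 * C₀ + D * C₁) * (√s)⁻¹, by positivity, √s,
    ⟨hsqrt, (Real.sqrt_lt' one_pos).mpr (by simpa using hs1)⟩, fun n f hf => ?_⟩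
  obtain ⟨k, m, hkm, hk, hm⟩ : ∃ k m, m + k = n ∧ n / 2 ≤ k ∧ n / 2 ≤ m :=
    ⟨n - n / 2, n / 2, by omega, by omega, le_rfl⟩
  have hfc : Continuous f := hf.continuous
  set g : X → ℝ := fun x => f (T^[m] x) - f x₀
  have hgc : Continuous g := (hfc.comp (hTc.iterate m)).sub continuous_const
  have hfd : ∀ x x', |f x - f x'| ≤ dist x x' := fun x x' => by
    simpa [Real.dist_eq] using hf.dist_le_mul x x'
  have hgD : ∀ x, |g x| ≤ D := fun x =>
    (hfd _ _).trans (dist_le_diam_of_mem isCompact_univ.isBounded (mem_univ _) (mem_univ _))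
  have hgosc : ∀ x x', π x = π x' → |g x - g x'| ≤ C₀ * θ ^ m := by
    intro x x' h
    rw [sub_sub_sub_cancel_right]
    exact (hfd _ _).trans ((hfiber m x x' h).trans (ha m))
  have hmapπ : (ν.map T^[k]).map π = (ν.map π).map S^[k] := by
    rw [Measure.map_map hπc.measurable (hT.iterate k),
      Measure.map_map (hS.iterate k) hπc.measurable]
    congr 1
    exact ((show Function.Semiconj π T S from hcomm).iterate_right k).comp_eq
  have : IsProbabilityMeasure (ν.map T^[k]) :=
    Measure.isProbabilityMeasure_map (hT.iterate k).aemeasurable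
  have hgint : ∀ (τ : Measure X) [IsProbabilityMeasure τ],
      ∫ x, g x ∂τ = (∫ x, f x ∂(τ.map T^[m])) - f x₀ := by
    intro τ _
    rw [integral_map (hT.iterate m).aemeasurable hfc.measurable.aestronglyMeasurable,
      integral_sub _ (integrable_const _)]
    · simp
    · exact (hfc.comp (hTc.iterate m)).integrable_of_hasCompactSupport
        (HasCompactSupport.of_compactSpace _)
  have hν : (ν.map T^[k]).map T^[m] = ν.map T^[n] := by
    rw [Measure.map_map (hT.iterate m) (hT.iterate k), ← Function.iterate_add, hkm]
  have hμ : μ.map T^[m] = μ := (MeasurePreserving.iterate ⟨hT, hμinv⟩ m).map_eq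
  have hmain := abs_integral_sub_integral_le_of_fiber_oscillation hπc hπs hgc hgD hgosc
    (ν.map T^[k]) μ
  rw [hgint, hgint, hν, hμ, sub_sub_sub_cancel_right] at hmain
  simp only [hmapπ, hμlift] at hmain
  have hδ0 : 0 ≤ 1 - δ := by linarith [hδ.2]
  have htv := ENNReal.toReal_le_of_le_ofReal (by positivity) (hTV k)
  refine hmain.trans ?_
  calc _ ≤ 2 * (C₀ * θ ^ m) + D * (C₁ * (1 - δ) ^ k) := by gcongr
    _ ≤ 2 * (C₀ * ((√s)⁻¹ * √s ^ n)) + D * (C₁ * ((√s)⁻¹ * √s ^ n)) := by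
        gcongr
        · exact pow_le_inv_mul_sqrt_pow hθ.1.le (le_max_left _ _) hs hs1.le hm
        · exact pow_le_inv_mul_sqrt_pow hδ0 (le_max_right _ _) hs hs1.le hk
    _ = (2 * C₀ + D * C₁) * (√s)⁻¹ * √s ^ n := by ring
end

section
/- Proposition 4.1: Suppose T is an extension of S with (a_n)-shrinking fibers and μ is a T-invariant Borel probability measure on X. Then the measure-preserving system (X,T,μ) is ergodic if and only if (Y,S,π_*μ) is ergodic. -/
open MeasureTheory Filter Topology Metric Set

/-- A measurable set invariant under a map whose iterates shrink the fibers of `π` agrees, up to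
small measure, with the preimage under `π` of a measurable set. -/
lemma exists_measurableSet_measure_symmDiff_preimage_lt
    {X Y : Type*} [MetricSpace X] [CompactSpace X] [MeasurableSpace X] [BorelSpace X]
    [MetricSpace Y] [CompactSpace Y] [MeasurableSpace Y] [BorelSpace Y]
    {T : X → X} {π : X → Y} {μ : Measure X} [IsFiniteMeasure μ]
    (hT : MeasurePreserving T μ μ) (hπ : Measurable π)
    {a : ℕ → ℝ} (ha : Tendsto a atTop (𝓝 0))
    (hdist : ∀ (n : ℕ) (x x' : X), π x = π x' → dist (T^[n] x) (T^[n] x') ≤ a n)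
    {A : Set X} (hA : MeasurableSet A) (hTA : T ⁻¹' A = A) {ε : ENNReal} (hε : ε ≠ 0) :
    ∃ B : Set Y, MeasurableSet B ∧ μ (symmDiff A (π ⁻¹' B)) < ε := by
  have hε2 : ε / 2 ≠ 0 := (ENNReal.half_pos hε).ne'
  obtain ⟨K, hKA, hK, hμK⟩ := hA.exists_isCompact_sdiff_lt (measure_ne_top μ A) hε2
  obtain ⟨L, hLA, hL, hμL⟩ := hA.compl.exists_isCompact_sdiff_lt (measure_ne_top μ Aᶜ) hε2
  obtain ⟨r, hr, hKL⟩ := exists_pos_forall_lt_edist hK hL.isClosed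
    ((disjoint_compl_right (a := A)).mono hKA hLA)
  obtain ⟨n, hn⟩ := (ha.eventually_lt_const (NNReal.coe_pos.2 hr)).exists
  have hTn := hT.iterate n
  have hTnA : T^[n] ⁻¹' A = A := by
    rw [Set.preimage_iterate_eq]
    exact Function.iterate_fixed hTA n
  have hdisj : Disjoint (π '' (T^[n] ⁻¹' K)) (π '' (T^[n] ⁻¹' L)) := by
    rw [Set.disjoint_left]
    rintro _ ⟨x, hx, rfl⟩ ⟨x', hx', h⟩
    have hlt := hKL _ hx _ hx'
    rw [edist_nndist, ENNReal.coe_lt_coe] at hlt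
    have hlt' : (r : ℝ) < dist (T^[n] x) (T^[n] x') := by exact_mod_cast hlt
    linarith [hdist n x x' h.symm]
  obtain ⟨B, hKB, hLB, hB⟩ :=
    ((hTn.measurable hK.measurableSet).analyticSet_image hπ).measurablySeparable
      ((hTn.measurable hL.measurableSet).analyticSet_image hπ) hdisj
  refine ⟨B, hB, ?_⟩
  have hsub : symmDiff A (π ⁻¹' B) ⊆ T^[n] ⁻¹' (A \ K) ∪ T^[n] ⁻¹' (Aᶜ \ L) := by
    rintro x (⟨hxA, hxB⟩ | ⟨hxB, hxA⟩)
    · exact Or.inl ⟨(show x ∈ T^[n] ⁻¹' A from hTnA.symm ▸ hxA),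
        fun hxK => hxB (hKB ⟨x, hxK, rfl⟩)⟩
    · refine Or.inr ⟨fun h => hxA (hTnA ▸ (show x ∈ T^[n] ⁻¹' A from h)), fun hxL => ?_⟩
      exact Set.disjoint_left.1 hLB ⟨x, hxL, rfl⟩ hxB
  calc μ (symmDiff A (π ⁻¹' B))
      ≤ μ (T^[n] ⁻¹' (A \ K)) + μ (T^[n] ⁻¹' (Aᶜ \ L)) :=
        (measure_mono hsub).trans (measure_union_le _ _)
    _ = μ (A \ K) + μ (Aᶜ \ L) := by
        rw [hTn.measure_preimage (hA.diff hK.measurableSet).nullMeasurableSet,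
          hTn.measure_preimage (hA.compl.diff hL.measurableSet).nullMeasurableSet]
    _ < ε / 2 + ε / 2 := ENNReal.add_lt_add hμK hμL
    _ = ε := ENNReal.add_halves ε

/-- A set approximable in measure by preimages of measurable sets is almost everywhere equal to
such a preimage. -/
lemma exists_measurableSet_ae_eq_preimage {X Y : Type*} [MeasurableSpace X] [MeasurableSpace Y]
    {π : X → Y} {μ : Measure X} {A : Set X}
    (h : ∀ ε : ENNReal, ε ≠ 0 →
      ∃ B : Set Y, MeasurableSet B ∧ μ (symmDiff A (π ⁻¹' B)) < ε) :
    ∃ B : Set Y, MeasurableSet B ∧ π ⁻¹' B =ᵐ[μ] A := by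
  obtain ⟨ε, hε, hsum⟩ := ENNReal.exists_pos_sum_of_countable' (one_ne_zero (α := ENNReal)) ℕ
  choose B hB hμB using fun n => h (ε n) (hε n).ne'
  refine ⟨limsup B atTop, .measurableSet_limsup hB, ?_⟩
  have htsum : ∑' n, μ (symmDiff A (π ⁻¹' B n)) ≠ ⊤ :=
    ((ENNReal.tsum_le_tsum fun n => (hμB n).le).trans_lt (hsum.trans ENNReal.one_lt_top)).ne
  filter_upwards [ae_eventually_notMem htsum] with x hx
  have hiff : ∀ᶠ n in atTop, π x ∈ B n ↔ x ∈ A := by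
    filter_upwards [hx] with n hn
    rw [Set.mem_symmDiff] at hn
    rw [Set.mem_preimage] at hn
    tauto
  refine propext (?_ : π x ∈ limsup B atTop ↔ x ∈ A)
  rw [mem_limsup_iff_frequently_mem, frequently_congr hiff, frequently_const]

/-- Proposition 4.1: for an extension with shrinking fibers, a `T`-invariant probability
measure `μ` is ergodic if and only if its projection `π_* μ` is ergodic for `S`. -/
theorem ergodic_iff_ergodic_factor
    {X Y : Type*} [MetricSpace X] [CompactSpace X] [MeasurableSpace X] [BorelSpace X]
    [MetricSpace Y] [CompactSpace Y] [MeasurableSpace Y] [BorelSpace Y]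
    (T : X → X) (S : Y → Y) (π : X → Y)
    (hT : Measurable T) (hS : Measurable S)
    (hπc : Continuous π) (hπs : Function.Surjective π)
    (hcomm : ∀ x, π (T x) = S (π x))
    (a : ℕ → ℝ) (hshrink : ShrinkingFibers T π a)
    (μ : Measure X) [IsProbabilityMeasure μ] (hμinv : Measure.map T μ = μ) :
    (∀ A : Set X, MeasurableSet A → T ⁻¹' A = A → μ A = 0 ∨ μ A = 1) ↔
      ∀ B : Set Y, MeasurableSet B → S ⁻¹' B = B →
        (Measure.map π μ) B = 0 ∨ (Measure.map π μ) B = 1 := by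
  have hmp : MeasurePreserving T μ μ := ⟨hT, hμinv⟩
  have hπ : Measurable π := hπc.measurable
  have hsemi : π ∘ T = S ∘ π := funext hcomm
  constructor
  · intro h B hB hSB
    rw [Measure.map_apply hπ hB]
    refine h _ (hπ hB) ?_
    rw [← Set.preimage_comp, hsemi, Set.preimage_comp, hSB]
  · intro h A hA hTA
    obtain ⟨-, -, ha, hdist⟩ := hshrink
    obtain ⟨B, hB, hBA⟩ := exists_measurableSet_ae_eq_preimage fun ε hε =>
      exists_measurableSet_measure_symmDiff_preimage_lt hmp hπ ha hdist hA hTA (ε := ε) hε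
    have : IsProbabilityMeasure (μ.map π) := Measure.isProbabilityMeasure_map hπ.aemeasurable
    have hSmp : MeasurePreserving S (μ.map π) (μ.map π) :=
      ⟨hS, by rw [Measure.map_map hS hπ, ← hsemi, ← Measure.map_map hπ hT, hμinv]⟩
    have hSerg : QuasiErgodic S (μ.map π) :=
      { hSmp.quasiMeasurePreserving with
        aeconst_set := fun s hs hSs => by
          rw [eventuallyConst_set']
          refine (h s hs hSs).imp ae_eq_empty.2 fun h1 => ?_
          rw [ae_eq_univ, prob_compl_eq_zero_iff hs]
          exact h1 }
    have hinv : S ⁻¹' B =ᵐ[μ.map π] B := by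
      have hpre : π ⁻¹' (S ⁻¹' B) =ᵐ[μ] π ⁻¹' B := by
        rw [← Set.preimage_comp, ← hsemi, Set.preimage_comp]
        refine (hmp.quasiMeasurePreserving.preimage_ae_eq hBA).trans ?_
        rw [hTA]
        exact hBA.symm
      exact eventuallyEq_set.2 ((ae_map_iff hπ.aemeasurable
        (measurableSet_setOfPred.2 ((hS hB).mem.iff hB.mem))).2 (eventuallyEq_set.1 hpre))
    rw [← measure_congr hBA, ← Measure.map_apply hπ hB]
    refine (hSerg.ae_empty_or_univ₀ hB.nullMeasurableSet hinv).imp ae_eq_empty.1 fun h1 => ?_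
    rw [measure_congr h1, measure_univ]
end

section
/- Proposition 4.2: Suppose T is an extension of S with (a_n)-shrinking fibers and μ is a T-invariant Borel probability measure on X. Then μ is weakly mixing for T if and only if π_*μ is weakly mixing for S, where an invariant measure μ is called weakly mixing when the product measure μ⊗μ is ergodic for the diagonal map T×T : X×X → X×X, (x₀,x₁) ↦ (T x₀, T x₁). -/
open MeasureTheory Filter Topology Metric Set

/-- A sequence of sets that approximates `A` with summable errors has upper limit equal to `A`
almost everywhere. -/
theorem ae_eq_setOf_frequently_mem {α : Type*} [MeasurableSpace α] {m : Measure α} {A : Set α}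
    {C : ℕ → Set α} (h : ∑' k, m (symmDiff (C k) A) ≠ ⊤) :
    {x | ∃ᶠ k in atTop, x ∈ C k} =ᵐ[m] A := by
  filter_upwards [ae_eventually_notMem h] with x hx
  refine propext ⟨fun hC => ?_, fun hA => ?_⟩
  · obtain ⟨k, hk, hxk⟩ := (hC.and_eventually hx).exists
    by_contra hA
    exact hxk (Or.inl ⟨hk, hA⟩)
  · refine Eventually.frequently ?_
    filter_upwards [hx] with k hk
    by_contra hC
    exact hk (Or.inr ⟨hA, hC⟩)

/-- If the iterates of `T` shrink the fibers of `π` uniformly, every invariant set of a finite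
invariant measure is approximated in measure by preimages of measurable sets under `π`. -/
theorem exists_measurableSet_preimage_symmDiff_lt
    {X Y : Type*} [MetricSpace X] [CompactSpace X] [MeasurableSpace X] [BorelSpace X]
    [MetricSpace Y] [CompactSpace Y] [MeasurableSpace Y] [BorelSpace Y]
    {T : X → X} {π : X → Y} (hπ : Measurable π) {a : ℕ → ℝ} (ha : Tendsto a atTop (𝓝 0))
    (hfib : ∀ n x x', π x = π x' → dist (T^[n] x) (T^[n] x') ≤ a n)
    {m : Measure X} [IsFiniteMeasure m] (hT : MeasurePreserving T m m)
    {A : Set X} (hA : MeasurableSet A) (hinv : T ⁻¹' A = A) {ε : ENNReal} (hε : ε ≠ 0) :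
    ∃ B : Set Y, MeasurableSet B ∧ m (symmDiff (π ⁻¹' B) A) < ε := by
  have hε2 : ε / 2 ≠ 0 := (ENNReal.half_pos hε).ne'
  obtain ⟨K, hKA, hK, hKm⟩ := hA.exists_isClosed_sdiff_lt (measure_ne_top m A) hε2
  obtain ⟨L, hLA, hL, hLm⟩ := hA.compl.exists_isClosed_sdiff_lt (measure_ne_top m Aᶜ) hε2
  have hKL : Disjoint K L := disjoint_compl_right.mono hKA hLA
  obtain ⟨r, hr, hrKL⟩ := Metric.exists_pos_forall_lt_edist hK.isCompact hL hKL
  obtain ⟨n, hn⟩ := (ha.eventually_lt_const (NNReal.coe_pos.2 hr)).exists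
  have hTn : MeasurePreserving T^[n] m m := hT.iterate n
  have hdisj : Disjoint (π '' (T^[n] ⁻¹' K)) (π '' (T^[n] ⁻¹' L)) := by
    rw [Set.disjoint_left]
    rintro _ ⟨x, hx, rfl⟩ ⟨x', hx', hxx'⟩
    have h₁ := hrKL _ hx _ hx'
    have h₂ := hfib n x x' hxx'.symm
    rw [edist_nndist, ENNReal.coe_lt_coe, ← NNReal.coe_lt_coe, coe_nndist] at h₁
    exact absurd h₂ (not_le.2 (hn.trans h₁))
  obtain ⟨B, hKB, hLB, hB⟩ :=
    ((hTn.measurable hK.measurableSet).analyticSet_image hπ).measurablySeparable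
      ((hTn.measurable hL.measurableSet).analyticSet_image hπ) hdisj
  have hAn : T^[n] ⁻¹' A = A := by
    rw [Set.preimage_iterate_eq]
    exact Function.iterate_fixed hinv n
  refine ⟨B, hB, ?_⟩
  have hsub : symmDiff (π ⁻¹' B) A ⊆ T^[n] ⁻¹' (A \ K) ∪ T^[n] ⁻¹' (Aᶜ \ L) := by
    rw [Set.preimage_sdiff, Set.preimage_sdiff, Set.preimage_compl, hAn]
    rintro x (⟨hxB, hxA⟩ | ⟨hxA, hxB⟩)
    · exact Or.inr ⟨hxA, fun hx => Set.disjoint_left.1 hLB ⟨x, hx, rfl⟩ hxB⟩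
    · exact Or.inl ⟨hxA, fun hx => hxB (hKB ⟨x, hx, rfl⟩)⟩
  calc m (symmDiff (π ⁻¹' B) A)
      ≤ m (T^[n] ⁻¹' (A \ K)) + m (T^[n] ⁻¹' (Aᶜ \ L)) :=
        (measure_mono hsub).trans (measure_union_le _ _)
    _ = m (A \ K) + m (Aᶜ \ L) := by
        rw [hTn.measure_preimage (hA.diff hK.measurableSet).nullMeasurableSet,
          hTn.measure_preimage (hA.compl.diff hL.measurableSet).nullMeasurableSet]
    _ < ε / 2 + ε / 2 := ENNReal.add_lt_add hKm hLm
    _ = ε := ENNReal.add_halves ε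

/-- If the iterates of `T` shrink the fibers of `π` uniformly, every invariant set of a finite
invariant measure agrees almost everywhere with the preimage of a measurable set under `π`. -/
theorem exists_measurableSet_preimage_ae_eq
    {X Y : Type*} [MetricSpace X] [CompactSpace X] [MeasurableSpace X] [BorelSpace X]
    [MetricSpace Y] [CompactSpace Y] [MeasurableSpace Y] [BorelSpace Y]
    {T : X → X} {π : X → Y} (hπ : Measurable π) {a : ℕ → ℝ} (ha : Tendsto a atTop (𝓝 0))
    (hfib : ∀ n x x', π x = π x' → dist (T^[n] x) (T^[n] x') ≤ a n)
    {m : Measure X} [IsFiniteMeasure m] (hT : MeasurePreserving T m m)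
    {A : Set X} (hA : MeasurableSet A) (hinv : T ⁻¹' A = A) :
    ∃ B : Set Y, MeasurableSet B ∧ π ⁻¹' B =ᵐ[m] A := by
  choose B hB hBA using fun k : ℕ => exists_measurableSet_preimage_symmDiff_lt hπ ha hfib hT hA
    hinv (ε := 2⁻¹ ^ k) (pow_ne_zero k (by simp))
  refine ⟨{y | ∃ᶠ k in atTop, y ∈ B k}, ?_, ae_eq_setOf_frequently_mem (C := fun k => π ⁻¹' B k) ?_⟩
  · have : {y | ∃ᶠ k in atTop, y ∈ B k} = limsup B atTop := by
      ext y
      rw [Set.mem_ofPred_eq, mem_limsup_iff_frequently_mem]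
    exact this ▸ MeasurableSet.measurableSet_limsup hB
  · refine ne_top_of_le_ne_top ?_ (ENNReal.tsum_le_tsum fun k => (hBA k).le)
    rw [ENNReal.tsum_geometric]
    simp

/-- Ergodicity lifts from a factor to an extension whose fibers are shrunk uniformly. -/
theorem measure_eq_zero_or_one_of_shrinking
    {X Y : Type*} [MetricSpace X] [CompactSpace X] [MeasurableSpace X] [BorelSpace X]
    [MetricSpace Y] [CompactSpace Y] [MeasurableSpace Y] [BorelSpace Y]
    {T : X → X} {S : Y → Y} {π : X → Y} (hS : Measurable S) (hπ : Measurable π)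
    (hcomm : Function.Semiconj π T S) {a : ℕ → ℝ} (ha : Tendsto a atTop (𝓝 0))
    (hfib : ∀ n x x', π x = π x' → dist (T^[n] x) (T^[n] x') ≤ a n)
    {m : Measure X} [IsProbabilityMeasure m] (hT : MeasurePreserving T m m)
    (herg : ∀ B : Set Y, MeasurableSet B → S ⁻¹' B = B → m.map π B = 0 ∨ m.map π B = 1)
    {A : Set X} (hA : MeasurableSet A) (hinv : T ⁻¹' A = A) : m A = 0 ∨ m A = 1 := by
  obtain ⟨B, hB, hBA⟩ := exists_measurableSet_preimage_ae_eq hπ ha hfib hT hA hinv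
  have : IsProbabilityMeasure (m.map π) := Measure.isProbabilityMeasure_map hπ.aemeasurable
  have hmπ : MeasurePreserving π m (m.map π) := hπ.measurePreserving m
  have hSm : MeasurePreserving S (m.map π) (m.map π) := hmπ.of_semiconj hT hcomm hS
  have hSerg : Ergodic S (m.map π) := by
    refine ⟨hSm, ⟨fun C hC hCinv => ?_⟩⟩
    rw [Filter.eventuallyConst_set']
    refine (herg C hC hCinv).imp (fun h => ae_eq_empty.2 h) fun h => ?_
    rwa [eventuallyEq_univ, mem_ae_iff, prob_compl_eq_zero_iff hC]
  have hSB : S ⁻¹' B =ᵐ[m.map π] B := by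
    have h : π ⁻¹' (S ⁻¹' B) =ᵐ[m] π ⁻¹' B := by
      rw [← Set.preimage_comp, ← hcomm.comp_eq, Set.preimage_comp]
      have hTB := hT.quasiMeasurePreserving.preimage_ae_eq hBA
      rw [hinv] at hTB
      exact hTB.trans hBA.symm
    rw [← measure_symmDiff_eq_zero_iff] at h ⊢
    rwa [← Set.preimage_symmDiff,
      hmπ.measure_preimage ((hS hB).symmDiff hB).nullMeasurableSet] at h
  have hmB : m A = m.map π B := by
    rw [← measure_congr hBA, hmπ.measure_preimage hB.nullMeasurableSet]
  rw [hmB]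
  refine (hSerg.quasiErgodic.ae_empty_or_univ₀ hB.nullMeasurableSet hSB).imp
    (fun h => ae_eq_empty.1 h) fun h => ?_
  rw [measure_congr h, measure_univ]

/-- Proposition 4.2: for an extension with shrinking fibers, a `T`-invariant probability
measure `μ` is weakly mixing (i.e. `μ ⊗ μ` is ergodic for the diagonal map `T × T`)
if and only if `π_* μ` is weakly mixing for `S`. -/
theorem weakly_mixing_iff_weakly_mixing_factor
    {X Y : Type*} [MetricSpace X] [CompactSpace X] [MeasurableSpace X] [BorelSpace X]
    [MetricSpace Y] [CompactSpace Y] [MeasurableSpace Y] [BorelSpace Y]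
    (T : X → X) (S : Y → Y) (π : X → Y)
    (hT : Measurable T) (hS : Measurable S)
    (hπc : Continuous π) (hπs : Function.Surjective π)
    (hcomm : ∀ x, π (T x) = S (π x))
    (a : ℕ → ℝ) (hshrink : ShrinkingFibers T π a)
    (μ : Measure X) [IsProbabilityMeasure μ] (hμinv : Measure.map T μ = μ) :
    (∀ A : Set (X × X), MeasurableSet A → Prod.map T T ⁻¹' A = A →
        (μ.prod μ) A = 0 ∨ (μ.prod μ) A = 1) ↔
      ∀ B : Set (Y × Y), MeasurableSet B → Prod.map S S ⁻¹' B = B →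
        ((Measure.map π μ).prod (Measure.map π μ)) B = 0 ∨
          ((Measure.map π μ).prod (Measure.map π μ)) B = 1 := by
  have hπ : Measurable π := hπc.measurable
  have hTμ : MeasurePreserving T μ μ := ⟨hT, hμinv⟩
  have hTT : MeasurePreserving (Prod.map T T) (μ.prod μ) (μ.prod μ) := hTμ.prod hTμ
  have hππ : Measurable (Prod.map π π) := hπ.prodMap hπ
  have hSS : Measurable (Prod.map S S) := hS.prodMap hS
  have hsemi : Function.Semiconj (Prod.map π π) (Prod.map T T) (Prod.map S S) :=
    fun p => Prod.ext (hcomm p.1) (hcomm p.2)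
  rw [Measure.map_prod_map μ μ hπ hπ]
  constructor
  · intro h B hB hBinv
    rw [Measure.map_apply hππ hB]
    refine h _ (hππ hB) ?_
    rw [← Set.preimage_comp, hsemi.comp_eq, Set.preimage_comp, hBinv]
  · intro h A hA hAinv
    obtain ⟨-, -, ha, hfib⟩ := hshrink
    refine measure_eq_zero_or_one_of_shrinking hSS hππ hsemi ha (fun n p q hpq => ?_) hTT h hA hAinv
    rw [Prod.map_iterate, Prod.dist_eq]
    exact max_le (hfib n _ _ (congrArg Prod.fst hpq)) (hfib n _ _ (congrArg Prod.snd hpq))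
end

section
/- Lemma 4.4: Assume T has (a_n)-shrinking fibers, let μ be a T-invariant Borel probability measure on X, μ̌ = π_*μ, and (ξ_y)_{y∈Y} a disintegration of μ over π. Let f : X → ℝ be continuous with modulus of continuity ω (i.e. |f(x) − f(x')| ≤ ω(d(x,x')) for all x,x') and let g ∈ L¹(μ). Then for all k, m ∈ ℕ: Corr_{k+m}^μ(f,g) ≤ Corr_m^{μ̌}(ξ(f∘T^k), ξ(g)) + ω(a_k)·‖g‖_{L¹(μ)}. -/
open MeasureTheory Filter Topology Metric Set

/-- The integral against a mixture of measures is the iterated integral. -/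
theorem integral_bind_kernel {α β : Type*} [MeasurableSpace α] [MeasurableSpace β]
    {ν : Measure β} {κ : ProbabilityTheory.Kernel β α} {f : α → ℝ}
    (hf : Integrable f (ν.bind κ)) :
    ∫ x, f x ∂(ν.bind κ) = ∫ y, ∫ x, f x ∂(κ y) ∂ν := by
  rw [Measure.comp_eq_comp_const_apply] at hf ⊢
  rw [ProbabilityTheory.Kernel.integral_comp hf, ProbabilityTheory.Kernel.const_apply]

/-- A disintegration identity on bounded measurable functions determines the mixture. -/
theorem comp_eq_of_integral_integral_eq {α β : Type*} [MeasurableSpace α] [MeasurableSpace β]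
    (ν : Measure β) [IsFiniteMeasure ν] (μ : Measure α) [IsFiniteMeasure μ]
    (κ : ProbabilityTheory.Kernel β α) [ProbabilityTheory.IsMarkovKernel κ]
    (h : ∀ f : α → ℝ, Measurable f → (∃ M, ∀ x, |f x| ≤ M) →
      ∫ y, ∫ x, f x ∂(κ y) ∂ν = ∫ x, f x ∂μ) :
    ν.bind κ = μ := by
  ext s hs
  have hbdd : ∃ M, ∀ x, |s.indicator (fun _ => (1 : ℝ)) x| ≤ M :=
    ⟨1, fun x => by by_cases hx : x ∈ s <;> simp [hx]⟩
  have hint : ∫ x, s.indicator (fun _ => (1 : ℝ)) x ∂(ν.bind κ) =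
      ∫ x, s.indicator (fun _ => (1 : ℝ)) x ∂μ := by
    rw [← h _ (measurable_const.indicator hs) hbdd]
    exact integral_bind_kernel ((integrable_const (1 : ℝ)).indicator hs)
  rw [← measureReal_eq_measureReal_iff]
  simpa [integral_indicator hs] using hint

/-- Integrating against a fiber measure, a factor depending only on the base point is constant. -/
theorem integral_comp_mul_of_ae_eq {α β : Type*} [MeasurableSpace α] {ρ : Measure α}
    {p : α → β} {y : β} (hp : ∀ᵐ x ∂ρ, p x = y) (φ : β → ℝ) (g : α → ℝ) :
    ∫ x, φ (p x) * g x ∂ρ = φ y * ∫ x, g x ∂ρ := by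
  rw [← integral_const_mul]
  exact integral_congr_ae (hp.mono fun x hx => by simp only [hx])

/-- The mean of a function over a probability measure is close to every value that is
uniformly close to almost all values of the function. -/
theorem abs_sub_integral_le_of_ae {α : Type*} [MeasurableSpace α] {ρ : Measure α}
    [IsProbabilityMeasure ρ] {F : α → ℝ} (hF : Integrable F ρ) {c C : ℝ}
    (h : ∀ᵐ x ∂ρ, |c - F x| ≤ C) : |c - ∫ x, F x ∂ρ| ≤ C := by
  have hc : c - ∫ x, F x ∂ρ = ∫ x, (c - F x) ∂ρ := by
    rw [integral_sub (integrable_const c) hF]; simp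
  rw [hc, ← Real.norm_eq_abs]
  simp only [← Real.norm_eq_abs] at h
  simpa using norm_integral_le_of_norm_le_const h

/-- Lemma 4.4: correlation bound. For `f` continuous with modulus `ω` and `g ∈ L¹(μ)`,
`Corr_{k+m}^μ(f,g) ≤ Corr_m^{μY}(ξ(f∘T^k), ξ(g)) + ω(a_k)·‖g‖_{L¹(μ)}`, where `ξ` is a
disintegration of the `T`-invariant measure `μ` over `π` and `μY = π_* μ`. -/
theorem correlation_bound_via_disintegration
    {X Y : Type*} [MetricSpace X] [CompactSpace X] [MeasurableSpace X] [BorelSpace X]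
    [MetricSpace Y] [CompactSpace Y] [MeasurableSpace Y] [BorelSpace Y]
    (T : X → X) (S : Y → Y) (π : X → Y)
    (hT : Measurable T) (hS : Measurable S)
    (hπc : Continuous π) (hπs : Function.Surjective π)
    (hcomm : ∀ x, π (T x) = S (π x))
    (a : ℕ → ℝ) (hshrink : ShrinkingFibers T π a)
    (μ : Measure X) [IsProbabilityMeasure μ] (hμinv : Measure.map T μ = μ)
    -- `ξ` is a disintegration of `μ` over `π`:
    (ξ : Y → Measure X) (hξmeas : Measurable ξ)
    (hξprob : ∀ y, IsProbabilityMeasure (ξ y))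
    (hξconc : ∀ y, ξ y (π ⁻¹' {y}) = 1)
    (hξdis : ∀ h : X → ℝ, Measurable h → (∃ M, ∀ x, |h x| ≤ M) →
      (∫ y, (∫ x, h x ∂(ξ y)) ∂(Measure.map π μ)) = ∫ x, h x ∂μ)
    -- observables:
    (ω : ℝ → ℝ) (hω : IsModulus ω)
    (f : X → ℝ) (hfc : Continuous f) (hfω : ∀ x x' : X, |f x - f x'| ≤ ω (dist x x'))
    (g : X → ℝ) (hg : Integrable g μ) (k m : ℕ) :
    |(∫ x, f (T^[k + m] x) * g x ∂μ) - (∫ x, f x ∂μ) * ∫ x, g x ∂μ| ≤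
      |(∫ y, (∫ x, f (T^[k] x) ∂(ξ (S^[m] y))) * (∫ x, g x ∂(ξ y)) ∂(Measure.map π μ)) -
          (∫ y, (∫ x, f (T^[k] x) ∂(ξ y)) ∂(Measure.map π μ)) *
            ∫ y, (∫ x, g x ∂(ξ y)) ∂(Measure.map π μ)| +
        ω (a k) * ∫ x, |g x| ∂μ := by
  obtain ⟨-, ha, -, hT'⟩ := hshrink
  obtain ⟨-, hωmono, -, -, -⟩ := hω
  have hπ := hπc.measurable
  let κ : ProbabilityTheory.Kernel Y X := ⟨ξ, hξmeas⟩
  have hκ : ProbabilityTheory.IsMarkovKernel κ := ⟨hξprob⟩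
  have := Measure.isProbabilityMeasure_map (μ := μ) hπ.aemeasurable
  have hbind : (Measure.map π μ).bind κ = μ :=
    comp_eq_of_integral_integral_eq _ μ κ hξdis
  have hdis : ∀ h : X → ℝ, Integrable h μ →
      ∫ y, ∫ x, h x ∂(ξ y) ∂(Measure.map π μ) = ∫ x, h x ∂μ := fun h hh => by
    rw [← hbind] at hh
    conv_rhs => rw [← hbind]
    exact (integral_bind_kernel hh).symm
  have hfib : ∀ y, ∀ᵐ x ∂(ξ y), π x = y := fun y =>
    (prob_compl_eq_zero_iff (hπ (measurableSet_singleton y))).2 (hξconc y)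
  have hsemi : ∀ x, π (T^[m] x) = S^[m] (π x) :=
    fun x => (Function.Semiconj.iterate_right (f := π) hcomm m) x
  obtain ⟨M, hM⟩ : ∃ M, ∀ x, |f x| ≤ M := by
    obtain ⟨M, hM⟩ := isCompact_univ.exists_bound_of_continuousOn hfc.continuousOn
    exact ⟨M, fun x => hM x (mem_univ x)⟩
  set F : X → ℝ := fun x => f (T^[k] x) with hFdef
  have hFm : Measurable F := hfc.measurable.comp (hT.iterate k)
  have hFint : ∀ ρ : Measure X, IsProbabilityMeasure ρ → Integrable F ρ := fun ρ _ =>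
    Integrable.of_bound hFm.aestronglyMeasurable M (Eventually.of_forall fun x => hM _)
  set φ : Y → ℝ := fun y => ∫ x, F x ∂(ξ y) with hφdef
  have hφm : Measurable φ := (hFm.stronglyMeasurable.integral_kernel (κ := κ)).measurable
  have hφM : ∀ y, |φ y| ≤ M := fun y => by
    have := hξprob y
    rw [← Real.norm_eq_abs]
    simpa using norm_integral_le_of_norm_le_const (μ := ξ y) (f := F)
      (Eventually.of_forall fun x => hM (T^[k] x))
  have hFω : ∀ z z', π z = π z' → |F z - F z'| ≤ ω (a k) := fun z z' hz =>
    (hfω _ _).trans (hωmono dist_nonneg (ha k).le (hT' k z z' hz))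
  have hFφ : ∀ z, |F z - φ (π z)| ≤ ω (a k) := fun z =>
    abs_sub_integral_le_of_ae (hFint _ (hξprob _))
      ((hfib (π z)).mono fun x hx => hFω z x hx.symm)
  have hφS : Measurable fun x => φ (S^[m] (π x)) := hφm.comp ((hS.iterate m).comp hπ)
  have hint₁ : Integrable (fun x => F (T^[m] x) * g x) μ :=
    hg.bdd_mul (hFm.comp (hT.iterate m)).aestronglyMeasurable (Eventually.of_forall fun x => hM _)
  have hint₂ : Integrable (fun x => φ (S^[m] (π x)) * g x) μ :=
    hg.bdd_mul hφS.aestronglyMeasurable (Eventually.of_forall fun x => hφM _)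
  have hbase : ∫ y, φ (S^[m] y) * ∫ x, g x ∂(ξ y) ∂(Measure.map π μ) =
      ∫ x, φ (S^[m] (π x)) * g x ∂μ := by
    rw [← hdis _ hint₂]
    exact integral_congr_ae (Eventually.of_forall fun y =>
      (integral_comp_mul_of_ae_eq (hfib y) (fun y => φ (S^[m] y)) g).symm)
  have hmean : ∫ y, φ y ∂(Measure.map π μ) = ∫ x, f x ∂μ := by
    have hTk : MeasurePreserving T^[k] μ μ := MeasurePreserving.iterate ⟨hT, hμinv⟩ k
    rw [hdis F (hFint μ inferInstance)]
    conv_rhs => rw [← hTk.map_eq]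
    exact (integral_map hTk.aemeasurable hfc.measurable.aestronglyMeasurable).symm
  have herr : |(∫ x, F (T^[m] x) * g x ∂μ) - ∫ x, φ (S^[m] (π x)) * g x ∂μ| ≤
      ω (a k) * ∫ x, |g x| ∂μ := by
    rw [← integral_sub hint₁ hint₂, ← integral_const_mul, ← Real.norm_eq_abs]
    refine norm_integral_le_of_norm_le (hg.abs.const_mul _) (Eventually.of_forall fun x => ?_)
    rw [← sub_mul, norm_mul, ← hsemi]
    exact mul_le_mul_of_nonneg_right (hFφ _) (abs_nonneg _)
  simp only [Function.iterate_add_apply]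
  rw [hbase, hmean, hdis g hg]
  rw [add_comm]
  refine le_trans ?_ (add_le_add_left herr _)
  refine (abs_add_le _ _).trans' (le_of_eq ?_)
  congr 1
  ring
end

section
/- Zero topological entropy of fibers (from the proof of Proposition 4.6): If T is an extension of S with (a_n)-shrinking fibers, then for every y ∈ Y the topological entropy of T on the fiber π⁻¹(y), defined via the exponential growth rate of maximal (n,δ)-separated sets (equivalently, minimal (n,δ)-spanning sets in the Bowen–Dinaburg dynamical metrics), is at most 0. -/
open MeasureTheory Filter Topology Metric Set

/-- `E` is an `(n,δ)`-separated set for `T`: any two distinct points of `E` are separated by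
more than `δ` at some time `k < n` of their orbits (Bowen–Dinaburg dynamical metrics). -/
def IsDynSeparated {X : Type*} [PseudoMetricSpace X] (T : X → X) (n : ℕ) (δ : ℝ)
    (E : Finset X) : Prop :=
  ∀ x ∈ E, ∀ x' ∈ E, x ≠ x' → ∃ k < n, δ < dist (T^[k] x) (T^[k] x')

/-- The maximal cardinality of an `(n,δ)`-separated subset of `F` for `T`. -/
noncomputable def maxSepCard {X : Type*} [PseudoMetricSpace X] (T : X → X) (F : Set X)
    (n : ℕ) (δ : ℝ) : ℕ :=
  sSup {N : ℕ | ∃ E : Finset X, ↑E ⊆ F ∧ IsDynSeparated T n δ E ∧ E.card = N}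

/-- If `T` is uniformly continuous along the fibers, then so is each iterate of `T`. -/
theorem UnifContAlongFibers.iterate {X Y : Type*} [PseudoMetricSpace X] {T : X → X} {S : Y → Y}
    {π : X → Y} (h : UnifContAlongFibers T π) (hcomm : ∀ x, π (T x) = S (π x)) (k : ℕ) :
    ∀ δ > 0, ∃ ε > 0, ∀ x x' : X, π x = π x' → dist x x' < ε →
      dist (T^[k] x) (T^[k] x') < δ := by
  induction k with
  | zero => exact fun δ hδ => ⟨δ, hδ, fun x x' _ hd => hd⟩
  | succ k ih =>
    intro δ hδ
    obtain ⟨η, hη, hk⟩ := ih δ hδ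
    obtain ⟨ω, ⟨hc, -, -, h0, -⟩, hω⟩ := h
    obtain ⟨ε, hε, hωε⟩ := Metric.continuousWithinAt_iff.mp (hc 0 Set.self_mem_Ici) η hη
    refine ⟨ε, hε, fun x x' hx hd => ?_⟩
    rw [Function.iterate_succ_apply, Function.iterate_succ_apply]
    refine hk _ _ (by rw [hcomm, hcomm, hx]) ((hω x x' hx).trans_lt ?_)
    have hlt : dist (ω (dist x x')) (ω 0) < η :=
      hωε (Set.mem_Ici.mpr dist_nonneg) (by simpa [abs_of_nonneg dist_nonneg] using hd)
    rw [h0, Real.dist_eq, sub_zero] at hlt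
    exact (le_abs_self _).trans_lt hlt

/-- Finitely many iterates are uniformly equicontinuous along the fibers. -/
theorem UnifContAlongFibers.iterate_lt {X Y : Type*} [PseudoMetricSpace X] {T : X → X}
    {S : Y → Y} {π : X → Y} (h : UnifContAlongFibers T π) (hcomm : ∀ x, π (T x) = S (π x))
    {δ : ℝ} (hδ : 0 < δ) (N : ℕ) :
    ∃ ε > 0, ∀ k < N, ∀ x x' : X, π x = π x' → dist x x' < ε →
      dist (T^[k] x) (T^[k] x') < δ := by
  induction N with
  | zero => exact ⟨1, one_pos, fun k hk => absurd hk k.not_lt_zero⟩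
  | succ N ih =>
    obtain ⟨ε₁, hε₁, h₁⟩ := ih
    obtain ⟨ε₂, hε₂, h₂⟩ := h.iterate hcomm N δ hδ
    refine ⟨min ε₁ ε₂, lt_min hε₁ hε₂, fun k hk x x' hx hd => ?_⟩
    rcases Nat.lt_succ_iff_lt_or_eq.mp hk with hk | rfl
    · exact h₁ k hk x x' hx (hd.trans_le (min_le_left _ _))
    · exact h₂ x x' hx (hd.trans_le (min_le_right _ _))

/-- Shrinking fibers: all iterates are uniformly equicontinuous along the fibers. -/
theorem ShrinkingFibers.uniform_iterate {X Y : Type*} [PseudoMetricSpace X] {T : X → X}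
    {S : Y → Y} {π : X → Y} {a : ℕ → ℝ} (h : ShrinkingFibers T π a)
    (hcomm : ∀ x, π (T x) = S (π x)) {δ : ℝ} (hδ : 0 < δ) :
    ∃ ε > 0, ∀ k, ∀ x x' : X, π x = π x' → dist x x' < ε →
      dist (T^[k] x) (T^[k] x') < δ := by
  obtain ⟨hu, -, ha, hT⟩ := h
  obtain ⟨N, hN⟩ := Filter.eventually_atTop.mp (ha.eventually_lt_const hδ)
  obtain ⟨ε, hε, hlt⟩ := hu.iterate_lt hcomm hδ N
  refine ⟨ε, hε, fun k x x' hx hd => ?_⟩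
  rcases lt_or_ge k N with hk | hk
  · exact hlt k hk x x' hx hd
  · exact (hT k x x' hx).trans_lt (hN k hk)

/-- In a compact space with shrinking fibers, the cardinality of dynamically separated subsets
of a fiber is bounded independently of the time horizon. -/
theorem ShrinkingFibers.exists_maxSepCard_le {X Y : Type*} [PseudoMetricSpace X] [CompactSpace X]
    {T : X → X} {S : Y → Y} {π : X → Y} {a : ℕ → ℝ} (h : ShrinkingFibers T π a)
    (hcomm : ∀ x, π (T x) = S (π x)) (y : Y) {δ : ℝ} (hδ : 0 < δ) :
    ∃ C : ℕ, ∀ n, maxSepCard T (π ⁻¹' {y}) n δ ≤ C := by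
  obtain ⟨ε, hε, hT⟩ := h.uniform_iterate hcomm hδ
  obtain ⟨t, -, ht, hcover⟩ :=
    (isCompact_univ (X := X)).finite_cover_balls (half_pos hε)
  lift t to Finset X using ht
  have hnear : ∀ x : X, ∃ c ∈ t, dist x c < ε / 2 := fun x => by
    simpa using hcover (Set.mem_univ x)
  choose c hc hd using hnear
  refine ⟨t.card, fun n => csSup_le ⟨0, ∅, by simp, by simp [IsDynSeparated], rfl⟩ ?_⟩
  rintro _ ⟨E, hE, hsep, rfl⟩
  refine Finset.card_le_card_of_injOn c (fun x _ => hc x) fun x hx x' hx' hcc => ?_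
  by_contra hne
  obtain ⟨k, -, hk⟩ := hsep x hx x' hx' hne
  refine hk.not_gt (hT k x x' ?_ ?_)
  · exact (hE hx : π x = y).trans (hE hx' : π x' = y).symm
  · have hd' := hd x'
    rw [← hcc] at hd'
    linarith [dist_triangle_right x x' (c x), hd x]

/-- Zero topological entropy of fibers: for an extension with shrinking fibers, the
topological entropy of `T` on each fiber `π⁻¹(y)`, computed through the exponential growth
rate of maximal `(n,δ)`-separated sets, is at most `0`: for every `δ > 0`, the upper limit
of `(1/n)·log maxSepCard` is `≤ 0` (hence so is the supremum over `δ > 0`). -/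
theorem topological_entropy_of_fiber_nonpos
    {X Y : Type*} [MetricSpace X] [CompactSpace X] [MeasurableSpace X] [BorelSpace X]
    [MetricSpace Y] [CompactSpace Y] [MeasurableSpace Y] [BorelSpace Y]
    (T : X → X) (S : Y → Y) (π : X → Y)
    (hT : Measurable T) (hS : Measurable S)
    (hπc : Continuous π) (hπs : Function.Surjective π)
    (hcomm : ∀ x, π (T x) = S (π x))
    (a : ℕ → ℝ) (hshrink : ShrinkingFibers T π a) :
    ∀ y : Y, ∀ δ : ℝ, 0 < δ →
      Filter.limsup
        (fun n : ℕ => Real.log (maxSepCard T (π ⁻¹' {y}) n δ) / n) Filter.atTop ≤ 0 := by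
  intro y δ hδ
  obtain ⟨C, hC⟩ := hshrink.exists_maxSepCard_le hcomm y hδ
  have hlim : Tendsto (fun n : ℕ => Real.log C / n) atTop (𝓝 0) :=
    tendsto_const_div_atTop_nhds_zero_nat _
  rw [← (squeeze_zero (fun n => ?_) (fun n => ?_) hlim :
    Tendsto (fun n : ℕ => Real.log (maxSepCard T (π ⁻¹' {y}) n δ) / n) atTop (𝓝 0)).limsup_eq]
  · exact div_nonneg (Real.log_natCast_nonneg _) n.cast_nonneg
  · refine div_le_div_of_nonneg_right ?_ n.cast_nonneg
    rcases (maxSepCard T (π ⁻¹' {y}) n δ).eq_zero_or_pos with h0 | hpos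
    · simpa [h0] using Real.log_natCast_nonneg C
    · exact Real.log_le_log (by exact_mod_cast hpos) (by exact_mod_cast hC n)
end

section
/- Proposition 4.7: Assume T is continuous and has (a_n)-shrinking fibers, and that X and Y carry reference Borel measures λ_X and λ_Y with respect to which π is non-singular (λ_Y(B) > 0 if and only if λ_X(π⁻¹(B)) > 0 for every Borel B ⊆ Y). Let μ be a T-invariant Borel probability measure on X. Then μ is physical with respect to (T, λ_X) if and only if π_*μ is physical with respect to (S, λ_Y). -/
open MeasureTheory Filter Topology Metric Set

/-- The basin of attraction of an invariant measure `μ` of `T`: the set of points whose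
empirical measures converge weakly-* to `μ` (tested against continuous functions). -/
def Basin {X : Type*} [MetricSpace X] [MeasurableSpace X] (T : X → X)
    (μ : MeasureTheory.Measure X) : Set X :=
  {x : X | ∀ f : X → ℝ, Continuous f →
    Filter.Tendsto (fun n : ℕ => (∑ k ∈ Finset.range n, f (T^[k] x)) / n) Filter.atTop
      (nhds (∫ z, f z ∂μ))}

/-- A real sequence that is approximated, to any precision, by convergent sequences with nearby
limits converges. -/
theorem tendsto_of_forall_approx {v : ℕ → ℝ} {M : ℝ}
    (h : ∀ ε > 0, ∃ (u : ℕ → ℝ) (L : ℝ), Tendsto u atTop (𝓝 L) ∧ (∀ n, |v n - u n| ≤ ε) ∧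
      |M - L| ≤ ε) : Tendsto v atTop (𝓝 M) := by
  rw [Metric.tendsto_atTop]
  intro ε hε
  obtain ⟨u, L, hu, hvu, hML⟩ := h (ε / 4) (by positivity)
  obtain ⟨N, hN⟩ := Metric.tendsto_atTop.1 hu (ε / 4) (by positivity)
  refine ⟨N, fun n hn => ?_⟩
  have h1 := hN n hn
  have h2 := hvu n
  rw [Real.dist_eq, abs_lt] at *
  rw [abs_le] at h2 hML
  constructor <;> linarith [h1.1, h1.2, h2.1, h2.2, hML.1, hML.2]

theorem abs_average_sub_average_le {u v : ℕ → ℝ} {ε : ℝ} (hε : 0 ≤ ε)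
    (h : ∀ k, |u k - v k| ≤ ε) (n : ℕ) :
    |(∑ k ∈ Finset.range n, u k) / n - (∑ k ∈ Finset.range n, v k) / n| ≤ ε := by
  rcases Nat.eq_zero_or_pos n with rfl | hn
  · simpa using hε
  have hn' : (0 : ℝ) < n := by exact_mod_cast hn
  rw [← sub_div, ← Finset.sum_sub_distrib, abs_div, abs_of_pos hn', div_le_iff₀ hn']
  calc |∑ k ∈ Finset.range n, (u k - v k)| ≤ ∑ k ∈ Finset.range n, |u k - v k| :=
        Finset.abs_sum_le_sum_abs _ _
    _ ≤ ∑ _k ∈ Finset.range n, ε := Finset.sum_le_sum fun k _ => h k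
    _ = ε * n := by simp [mul_comm]

theorem abs_integral_sub_integral_le {X : Type*} [MeasurableSpace X] {μ : Measure X}
    [IsProbabilityMeasure μ] {f g : X → ℝ} {ε : ℝ} (hf : Integrable f μ) (hg : Integrable g μ)
    (h : ∀ x, |f x - g x| ≤ ε) : |∫ x, f x ∂μ - ∫ x, g x ∂μ| ≤ ε := by
  rw [← integral_sub hf hg]
  simpa using norm_integral_le_of_norm_le_const (μ := μ) (f := fun x => f x - g x)
    (Eventually.of_forall h)

theorem Continuous.integrable_of_compactSpace {X : Type*} [TopologicalSpace X] [CompactSpace X]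
    [MeasurableSpace X] [OpensMeasurableSpace X] {μ : Measure X} [IsFiniteMeasure μ] {f : X → ℝ}
    (hf : Continuous f) : Integrable f μ :=
  (BoundedContinuousFunction.mkOfCompact ⟨f, hf⟩).integrable μ

/-- Replacing `f` by `f ∘ T^[N]` does not change the asymptotics of Birkhoff averages. -/
theorem tendsto_average_sub_average_comp_iterate {X : Type*} [TopologicalSpace X] [CompactSpace X]
    {T : X → X} (hT : Continuous T) {f : X → ℝ} (hf : Continuous f) (x : X) (N : ℕ) :
    Tendsto (fun n : ℕ => (∑ k ∈ Finset.range n, f (T^[k] x)) / n -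
      (∑ k ∈ Finset.range n, f (T^[N] (T^[k] x))) / n) atTop (𝓝 0) := by
  induction N with
  | zero => simp
  | succ N ih =>
    have hb : Bornology.IsBounded (range fun k => (f ∘ T^[N]) (T^[k] x)) :=
      (isCompact_range (hf.comp (hT.iterate N))).isBounded.subset <| by
        rintro _ ⟨k, rfl⟩
        exact mem_range_self _
    have h := ih.sub (tendsto_birkhoffAverage_apply_sub_birkhoffAverage ℝ hb)
    rw [sub_zero] at h
    have e : ∀ k, T^[N + 1] (T^[k] x) = T^[N] (T^[k] (T x)) := fun k => by
      rw [Function.iterate_succ_apply, ← Function.iterate_succ_apply' T k,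
        Function.iterate_succ_apply]
    refine h.congr fun n => ?_
    simp only [birkhoffAverage, birkhoffSum, smul_eq_mul, Function.comp_apply, e]
    ring

/-- A continuous function that varies little along the fibers of `π` is uniformly close to the
pullback of a continuous function. -/
theorem exists_continuous_abs_sub_comp_le {X Y : Type*} [TopologicalSpace X] [CompactSpace X]
    [MetricSpace Y] {π : X → Y} (hπ : Continuous π) (hπs : Function.Surjective π) {f : X → ℝ}
    (hf : Continuous f) {ε : ℝ} (h : ∀ x x', π x = π x' → |f x - f x'| < ε) :
    ∃ g : Y → ℝ, Continuous g ∧ ∀ x, |f x - g (π x)| ≤ ε := by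
  have hconv : ∀ y, Convex ℝ {c : ℝ | ∀ x, π x = y → |f x - c| ≤ ε} := by
    intro y c hc d hd a b ha hb hab x hx
    have h1 := hc x hx
    have h2 := hd x hx
    have e : f x - (a • c + b • d) = a * (f x - c) + b * (f x - d) := by
      have : f x = (a + b) * f x := by rw [hab, one_mul]
      simp only [smul_eq_mul]
      linear_combination this
    rw [e]
    calc |a * (f x - c) + b * (f x - d)| ≤ |a * (f x - c)| + |b * (f x - d)| := abs_add_le _ _
      _ = a * |f x - c| + b * |f x - d| := by
        rw [abs_mul, abs_mul, abs_of_nonneg ha, abs_of_nonneg hb]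
      _ ≤ a * ε + b * ε := by gcongr
      _ = ε := by rw [← add_mul, hab, one_mul]
  have hloc : ∀ y, ∃ c : ℝ, ∀ᶠ y' in 𝓝 y, c ∈ {c : ℝ | ∀ x, π x = y' → |f x - c| ≤ ε} := by
    intro y
    obtain ⟨x₀, rfl⟩ := hπs y
    refine ⟨f x₀, ?_⟩
    have hU : IsOpen {x | |f x - f x₀| < ε} :=
      isOpen_lt (hf.sub continuous_const).abs continuous_const
    have hC : IsClosed (π '' {x | |f x - f x₀| < ε}ᶜ) := hπ.isClosedMap _ hU.isClosed_compl
    have hy : π x₀ ∈ (π '' {x | |f x - f x₀| < ε}ᶜ)ᶜ := by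
      rintro ⟨x, hx, hxx⟩
      exact hx (h x x₀ hxx)
    filter_upwards [hC.isOpen_compl.mem_nhds hy] with y' hy' x hx
    by_contra hlt
    exact hy' ⟨x, fun hlt' => hlt (le_of_lt hlt'), hx⟩
  obtain ⟨g, hg⟩ := exists_continuous_forall_mem_convex_of_local_const hconv hloc
  exact ⟨g, g.continuous, fun x => hg (π x) x rfl⟩

theorem measurableSet_basin {Y : Type*} [MetricSpace Y] [CompactSpace Y] [MeasurableSpace Y]
    [BorelSpace Y] {S : Y → Y} (hS : Measurable S) (ν : Measure Y) [IsProbabilityMeasure ν] :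
    MeasurableSet (Basin S ν) := by
  obtain ⟨D, hDc, hDd⟩ := TopologicalSpace.exists_countable_dense C(Y, ℝ)
  have hB : Basin S ν = ⋂ g ∈ D, {y | Tendsto
      (fun n : ℕ => (∑ k ∈ Finset.range n, g (S^[k] y)) / n) atTop (𝓝 (∫ z, g z ∂ν))} := by
    ext y
    simp only [mem_iInter, mem_ofPred_eq]
    refine ⟨fun hy g _ => hy g g.continuous, fun hy f hf => ?_⟩
    refine tendsto_of_forall_approx fun ε hε => ?_
    obtain ⟨g, hg, hgD⟩ := hDd.exists_dist_lt ⟨f, hf⟩ hε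
    have hfg : ∀ z, |f z - g z| ≤ ε := fun z =>
      (ContinuousMap.dist_apply_le_dist (f := ⟨f, hf⟩) (g := g) z).trans hgD.le
    exact ⟨_, _, hy g hg, abs_average_sub_average_le hε.le fun k => hfg _,
      abs_integral_sub_integral_le hf.integrable_of_compactSpace
        g.continuous.integrable_of_compactSpace hfg⟩
  rw [hB]
  refine MeasurableSet.biInter hDc fun g _ => ?_
  refine measurableSet_tendsto _ fun n => ?_
  exact (Finset.measurable_fun_sum _ fun k _ =>
    g.continuous.measurable.comp (hS.iterate k)).div_const _

theorem integral_comp_iterate_of_map_eq {X : Type*} [MeasurableSpace X] {T : X → X}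
    (hT : Measurable T) {μ : Measure X} (hμ : Measure.map T μ = μ) {f : X → ℝ}
    (hf : StronglyMeasurable f) (N : ℕ) : ∫ x, f (T^[N] x) ∂μ = ∫ x, f x ∂μ := by
  have h := (MeasurePreserving.mk hT hμ).iterate N
  rw [← integral_map h.measurable.aemeasurable hf.aestronglyMeasurable, h.map_eq]

theorem ShrinkingFibers.exists_iterate_abs_sub_lt {X Y : Type*} [PseudoMetricSpace X]
    [CompactSpace X] {T : X → X} {π : X → Y} {a : ℕ → ℝ} (h : ShrinkingFibers T π a) {f : X → ℝ}
    (hf : Continuous f) {ε : ℝ} (hε : 0 < ε) :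
    ∃ N, ∀ x x', π x = π x' → |f (T^[N] x) - f (T^[N] x')| < ε := by
  obtain ⟨δ, hδ, hfδ⟩ :=
    Metric.uniformContinuous_iff.1 (CompactSpace.uniformContinuous_of_continuous hf) ε hε
  obtain ⟨N, hN⟩ := (h.2.2.1.eventually_lt_const hδ).exists
  exact ⟨N, fun x x' hx => hfδ ((h.2.2.2 N x x' hx).trans_lt hN)⟩

/-- For a continuous extension with shrinking fibers, the basin of an invariant measure is
saturated: it is the preimage of the basin of its projection. -/
theorem basin_eq_preimage_basin_map {X Y : Type*} [MetricSpace X] [CompactSpace X]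
    [MeasurableSpace X] [BorelSpace X] [MetricSpace Y] [MeasurableSpace Y] [BorelSpace Y]
    {T : X → X} {S : Y → Y} {π : X → Y} (hT : Continuous T) (hπ : Continuous π)
    (hπs : Function.Surjective π) (hcomm : Function.Semiconj π T S) {a : ℕ → ℝ}
    (hshrink : ShrinkingFibers T π a) {μ : Measure X} [IsProbabilityMeasure μ]
    (hμ : Measure.map T μ = μ) : Basin T μ = π ⁻¹' Basin S (Measure.map π μ) := by
  have hiter : ∀ k x, S^[k] (π x) = π (T^[k] x) := fun k x =>
    ((hcomm.iterate_right k).eq x).symm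
  have hint : ∀ g : Y → ℝ, Continuous g → ∫ y, g y ∂(Measure.map π μ) = ∫ x, g (π x) ∂μ :=
    fun g hg => integral_map_of_stronglyMeasurable hπ.measurable
      hg.measurable.stronglyMeasurable
  ext x
  constructor
  · intro hx g hg
    simpa only [hint g hg, hiter, Function.comp_apply] using hx _ (hg.comp hπ)
  · intro hx f hf
    refine tendsto_of_forall_approx fun ε hε => ?_
    obtain ⟨N, hN⟩ := hshrink.exists_iterate_abs_sub_lt hf hε
    have hfN : Continuous fun z => f (T^[N] z) := hf.comp (hT.iterate N)
    obtain ⟨g, hg, hfg⟩ := exists_continuous_abs_sub_comp_le hπ hπs hfN hN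
    refine ⟨_, _, (tendsto_average_sub_average_comp_iterate hT hf x N).add (hx g hg),
      fun n => ?_, ?_⟩
    · have h := abs_average_sub_average_le hε.le (fun k => hfg (T^[k] x)) n
      simp only [hiter]
      convert h using 2
      ring
    · rw [zero_add, hint g hg,
        ← integral_comp_iterate_of_map_eq hT.measurable hμ hf.measurable.stronglyMeasurable N]
      exact abs_integral_sub_integral_le hfN.integrable_of_compactSpace
        (hg.comp hπ).integrable_of_compactSpace hfg

/-- Proposition 4.7: for a continuous extension with shrinking fibers and a projection `π`
non-singular with respect to reference measures `lamX`, `lamY`, a `T`-invariant probability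
measure `μ` is physical (its basin has positive `lamX`-measure) if and only if `π_* μ` is
physical for `S` with respect to `lamY`. -/
theorem physical_iff_physical_factor
    {X Y : Type*} [MetricSpace X] [CompactSpace X] [MeasurableSpace X] [BorelSpace X]
    [MetricSpace Y] [CompactSpace Y] [MeasurableSpace Y] [BorelSpace Y]
    (T : X → X) (S : Y → Y) (π : X → Y)
    (hT : Measurable T) (hS : Measurable S) (hTc : Continuous T)
    (hπc : Continuous π) (hπs : Function.Surjective π)
    (hcomm : ∀ x, π (T x) = S (π x))
    (a : ℕ → ℝ) (hshrink : ShrinkingFibers T π a)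
    (lamX : Measure X) (lamY : Measure Y)
    (hnonsing : ∀ B : Set Y, MeasurableSet B → (0 < lamY B ↔ 0 < lamX (π ⁻¹' B)))
    (μ : Measure X) [IsProbabilityMeasure μ] (hμinv : Measure.map T μ = μ) :
    0 < lamX (Basin T μ) ↔ 0 < lamY (Basin S (Measure.map π μ)) := by
  have : IsProbabilityMeasure (Measure.map π μ) :=
    Measure.isProbabilityMeasure_map hπc.measurable.aemeasurable
  rw [basin_eq_preimage_basin_map hTc hπc hπs hcomm hshrink hμinv]
  exact (hnonsing _ (measurableSet_basin hS _)).symm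
end

section
/- Proposition 4.8: Assume T is continuous and has (a_n)-shrinking fibers, and that X and Y carry reference Borel measures λ_X and λ_Y with respect to which π is non-singular (λ_Y(B) > 0 if and only if λ_X(π⁻¹(B)) > 0 for every Borel B ⊆ Y). Let μ be a T-invariant Borel probability measure on X. Then μ is observable with respect to (T, λ_X) if and only if π_*μ is observable with respect to (S, λ_Y). -/
open MeasureTheory Filter Topology Metric Set
open scoped ENNReal

/-- The empirical (Birkhoff) probability measure `(1/(n+1)) Σ_{k=0}^{n} δ_{T^k x}`. -/
noncomputable def empirical {X : Type*} [MeasurableSpace X] (T : X → X) (x : X) (n : ℕ) :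
    ProbabilityMeasure X :=
  ⟨((n : ℝ≥0∞) + 1)⁻¹ • ∑ k ∈ Finset.range (n + 1), MeasureTheory.Measure.dirac (T^[k] x),
    by
      constructor
      simp only [Measure.smul_apply, Measure.coe_finset_sum, Finset.sum_apply, measure_univ,
        Finset.sum_const, Finset.card_range, nsmul_eq_mul, mul_one, smul_eq_mul]
      rw [Nat.cast_add, Nat.cast_one]
      exact ENNReal.inv_mul_cancel (by simp) (by simp)⟩

/-- The set `pω(x)` of weak-* cluster points of the sequence of empirical measures of `x`. -/
def clusterMeasures {X : Type*} [MeasurableSpace X] [TopologicalSpace X]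
    [OpensMeasurableSpace X] (T : X → X)
    (x : X) : Set (ProbabilityMeasure X) :=
  {ν : ProbabilityMeasure X | MapClusterPt ν Filter.atTop (empirical T x)}

/-- `μ` is observable: every weak-* neighborhood `U` of `μ` has an associated basin
(the set of points having an empirical cluster point in `U`) of positive reference
measure.  (Through a metric metrizing the weak-* topology, the sets `U` can be taken to be
the `ε`-balls around `μ`, recovering the `ε`-basins `Ba_ε(μ)`.) -/
def Observable {X : Type*} [MeasurableSpace X] [TopologicalSpace X]
    [OpensMeasurableSpace X] (T : X → X)
    (lam : MeasureTheory.Measure X) (μ : ProbabilityMeasure X) : Prop :=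
  ∀ U : Set (ProbabilityMeasure X), IsOpen U → μ ∈ U →
    0 < lam {x : X | ∃ ν ∈ clusterMeasures T x, ν ∈ U}

/-- A continuous function on a compact space which oscillates by at most `ε` along the fibers of a
continuous surjection is within `ε` of a Borel function of the base point. -/
theorem exists_measurable_comp_dist_le {X Y : Type*} [TopologicalSpace X] [CompactSpace X]
    [TopologicalSpace Y] [T2Space Y] [MeasurableSpace Y] [BorelSpace Y] {π : X → Y}
    (hπc : Continuous π) (hπs : Function.Surjective π) {g : X → ℝ} (hg : Continuous g) {ε : ℝ}
    (hε : ∀ x x', π x = π x' → dist (g x) (g x') ≤ ε) :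
    ∃ h : Y → ℝ, Measurable h ∧ ∀ x, dist (g x) (h (π x)) ≤ ε := by
  have hmax : ∀ y, ∃ x, π x = y ∧ ∀ x', π x' = y → g x' ≤ g x := fun y ↦ by
    have hy : IsCompact (π ⁻¹' {y}) := (isClosed_singleton.preimage hπc).isCompact
    obtain ⟨x, hx, hxm⟩ := hy.exists_isMaxOn (hπs y) hg.continuousOn
    exact ⟨x, hx, fun x' hx' ↦ hxm hx'⟩
  choose s hs hsmax using hmax
  refine ⟨g ∘ s, measurable_of_Ici fun c ↦ ?_, fun x ↦ hε _ _ (hs _).symm⟩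
  have : g ∘ s ⁻¹' Ici c = π '' (g ⁻¹' Ici c) := by
    ext y
    constructor
    · exact fun hy ↦ ⟨s y, hy, hs y⟩
    · rintro ⟨x, hx, rfl⟩
      exact le_trans hx (hsmax _ x rfl)
  rw [this]
  exact (hπc.isClosedMap _ (isClosed_Ici.preimage hg)).measurableSet

/-- Over a system with shrinking fibers, an invariant probability measure is determined by its
projection. -/
theorem ShrinkingFibers.eq_of_map_eq_s13 {X Y : Type*} [MetricSpace X] [CompactSpace X]
    [MeasurableSpace X] [BorelSpace X] [TopologicalSpace Y] [T2Space Y] [MeasurableSpace Y]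
    [BorelSpace Y] {T : X → X} {π : X → Y} {a : ℕ → ℝ} (h : ShrinkingFibers T π a)
    (hT : Continuous T) (hπc : Continuous π) (hπs : Function.Surjective π) {μ ν : Measure X}
    [IsProbabilityMeasure μ] [IsProbabilityMeasure ν] (hμ : MeasurePreserving T μ μ)
    (hν : MeasurePreserving T ν ν) (hμν : μ.map π = ν.map π) : μ = ν := by
  refine ext_of_forall_integral_eq_of_IsFiniteMeasure fun f ↦ ?_
  refine eq_of_forall_dist_le fun ε hε ↦ ?_
  obtain ⟨δ, hδ, hfδ⟩ := Metric.uniformContinuous_iff.1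
    (CompactSpace.uniformContinuous_of_continuous f.continuous) (ε / 2) (half_pos hε)
  obtain ⟨n, hn⟩ := (h.2.2.1.eventually_lt_const hδ).exists
  have hgc : Continuous fun x ↦ f (T^[n] x) := f.continuous.comp (hT.iterate n)
  obtain ⟨k, hk, hfk⟩ := exists_measurable_comp_dist_le hπc hπs hgc (ε := ε / 2)
    fun x x' hx ↦ (hfδ ((h.2.2.2 n x x' hx).trans_lt hn)).le
  have key : ∀ ρ : Measure X, IsProbabilityMeasure ρ → MeasurePreserving T ρ ρ →
      dist (∫ x, f x ∂ρ) (∫ y, k y ∂ρ.map π) ≤ ε / 2 := by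
    intro ρ _ hρ
    have hgi : Integrable (fun x ↦ f (T^[n] x)) ρ :=
      (hρ.iterate n).integrable_comp_of_integrable (f.integrable ρ)
    have hdi : Integrable (fun x ↦ f (T^[n] x) - k (π x)) ρ :=
      Integrable.of_bound (hgc.measurable.sub (hk.comp hπc.measurable)).aestronglyMeasurable (ε / 2)
        (.of_forall fun x ↦ by simpa [dist_eq_norm] using hfk x)
    have hki : Integrable (fun x ↦ k (π x)) ρ := by
      simpa [Pi.sub_def] using hgi.sub hdi
    rw [integral_map hπc.aemeasurable hk.aestronglyMeasurable, ← (hρ.iterate n).map_eq,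
      integral_map (hρ.iterate n).aemeasurable f.continuous.aestronglyMeasurable,
      (hρ.iterate n).map_eq, dist_eq_norm, ← integral_sub hgi hki]
    refine (norm_integral_le_of_norm_le_const (C := ε / 2)
      (.of_forall fun x ↦ (dist_eq_norm _ _).symm.trans_le (hfk x))).trans_eq (by simp)
  have h₁ := key μ inferInstance hμ
  have h₂ := key ν inferInstance hν
  rw [← hμν] at h₂
  linarith [dist_triangle_right (∫ x, f x ∂μ) (∫ x, f x ∂ν) (∫ y, k y ∂μ.map π)]

theorem coe_empirical {X : Type*} [MeasurableSpace X] (T : X → X) (x : X) (n : ℕ) :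
    (empirical T x n : Measure X) =
      ((n : ℝ≥0∞) + 1)⁻¹ • ∑ k ∈ Finset.range (n + 1), Measure.dirac (T^[k] x) := rfl

theorem integral_empirical {X : Type*} [MeasurableSpace X] (T : X → X) (x : X) (n : ℕ)
    {f : X → ℝ} (hf : StronglyMeasurable f) :
    ∫ z, f z ∂(empirical T x n : Measure X) = birkhoffAverage ℝ T f (n + 1) x := by
  rw [coe_empirical, integral_smul_measure,
    integral_finsetSum_measure fun k _ ↦ (integrable_dirac' hf (by simp))]
  simp [birkhoffAverage, birkhoffSum, integral_dirac' _ _ hf, ENNReal.toReal_add]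

theorem continuous_empirical {X : Type*} [TopologicalSpace X] [CompactSpace X]
    [MeasurableSpace X] [BorelSpace X] [SecondCountableTopology X] {T : X → X} (hT : Continuous T)
    (n : ℕ) : Continuous fun x ↦ empirical T x n := by
  rw [ProbabilityMeasure.continuous_iff_forall_continuousMap_continuous_integral]
  intro f
  simp only [integral_empirical T _ n f.continuous.stronglyMeasurable, birkhoffAverage, birkhoffSum]
  exact Continuous.const_smul (M := ℝ)
    (continuous_finsetSum _ fun k _ ↦ f.continuous.comp (hT.iterate k)) _

theorem map_empirical {X Y : Type*} [MeasurableSpace X] [MeasurableSpace Y] {T : X → X} {S : Y → Y}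
    {π : X → Y} (hπ : Measurable π) (h : Function.Semiconj π T S) (x : X) (n : ℕ) :
    (empirical T x n).map hπ.aemeasurable = empirical S (π x) n := by
  apply ProbabilityMeasure.toMeasure_injective
  rw [ProbabilityMeasure.toMeasure_map, coe_empirical, coe_empirical, Measure.map_smul,
    ← Measure.mapₗ_apply_of_measurable hπ, map_sum]
  simp only [Measure.mapₗ_apply_of_measurable hπ, Measure.map_dirac' hπ, (h.iterate_right _).eq]

/-- Limits of empirical measures of a continuous map are invariant. -/
theorem map_eq_of_tendsto_empirical {X : Type*} [MetricSpace X] [CompactSpace X]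
    [MeasurableSpace X] [BorelSpace X] {T : X → X} (hT : Continuous T) {x : X} {F : Filter ℕ}
    [F.NeBot] (hF : F ≤ atTop) {ν : ProbabilityMeasure X} (h : Tendsto (empirical T x) F (𝓝 ν)) :
    ν.map hT.aemeasurable = ν := by
  refine tendsto_nhds_unique
    (((ProbabilityMeasure.continuous_map hT).tendsto ν).comp h) ?_
  simp only [Function.comp_def, map_empirical hT.measurable (fun _ ↦ rfl : Function.Semiconj T T T)]
  rw [ProbabilityMeasure.tendsto_iff_forall_integral_tendsto] at h ⊢
  intro f
  have hf := f.continuous.stronglyMeasurable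
  have hd := (tendsto_birkhoffAverage_apply_sub_birkhoffAverage (𝕜 := ℝ) (f := T) (x := x)
    (f.isBounded_range.subset (range_comp_subset_range (fun n ↦ T^[n] x) f))).comp
      ((tendsto_add_atTop_nat 1).mono_left hF)
  have := hd.add (h f)
  simpa [Function.comp_def, integral_empirical, hf] using this

/-- Every cluster point of the projected empirical measures lifts to a cluster point of the
empirical measures of the extension, which is invariant. -/
theorem exists_mem_clusterMeasures_map_eq {X Y : Type*} [MetricSpace X] [CompactSpace X]
    [MeasurableSpace X] [BorelSpace X] [MetricSpace Y] [CompactSpace Y] [MeasurableSpace Y]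
    [BorelSpace Y] {T : X → X} {S : Y → Y} {π : X → Y} (hT : Continuous T) (hπ : Continuous π)
    (hcomm : Function.Semiconj π T S) {x : X} {ν : ProbabilityMeasure Y}
    (hν : ν ∈ clusterMeasures S (π x)) :
    ∃ ρ ∈ clusterMeasures T x, ρ.map hT.aemeasurable = ρ ∧ ρ.map hπ.aemeasurable = ν := by
  obtain ⟨F, hF, hFν⟩ := mapClusterPt_iff_ultrafilter.1 hν
  obtain ⟨ρ, -, hρ⟩ := isCompact_univ.ultrafilter_le_nhds (F.map (empirical T x)) (by simp)
  replace hρ : Tendsto (empirical T x) F (𝓝 ρ) := hρ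
  refine ⟨ρ, mapClusterPt_iff_ultrafilter.2 ⟨F, hF, hρ⟩, map_eq_of_tendsto_empirical hT hF hρ, ?_⟩
  refine tendsto_nhds_unique (((ProbabilityMeasure.continuous_map hπ).tendsto ρ).comp hρ) ?_
  simpa only [Function.comp_def, map_empirical hπ.measurable hcomm] using hFν

theorem map_mem_clusterMeasures {X Y : Type*} [TopologicalSpace X] [MeasurableSpace X]
    [BorelSpace X] [TopologicalSpace Y] [MeasurableSpace Y] [BorelSpace Y] {T : X → X} {S : Y → Y}
    {π : X → Y} (hπ : Continuous π) (hcomm : Function.Semiconj π T S) {x : X}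
    {ν : ProbabilityMeasure X} (hν : ν ∈ clusterMeasures T x) :
    ν.map hπ.aemeasurable ∈ clusterMeasures S (π x) := by
  have := MapClusterPt.continuousAt_comp (ProbabilityMeasure.continuous_map hπ).continuousAt hν
  simpa only [clusterMeasures, Set.mem_ofPred_eq, Function.comp_def,
    map_empirical hπ.measurable hcomm] using this

/-- Proposition 4.8: for a continuous extension with shrinking fibers and a projection `π`
non-singular with respect to reference measures `lamX`, `lamY`, a `T`-invariant probability
measure `μ` is observable if and only if `π_* μ` is observable for `S`. -/
theorem observable_iff_observable_factor
    {X Y : Type*} [MetricSpace X] [CompactSpace X] [MeasurableSpace X] [BorelSpace X]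
    [MetricSpace Y] [CompactSpace Y] [MeasurableSpace Y] [BorelSpace Y]
    (T : X → X) (S : Y → Y) (π : X → Y)
    (hT : Measurable T) (hS : Measurable S) (hTc : Continuous T)
    (hπc : Continuous π) (hπs : Function.Surjective π)
    (hcomm : ∀ x, π (T x) = S (π x))
    (a : ℕ → ℝ) (hshrink : ShrinkingFibers T π a)
    (lamX : Measure X) (lamY : Measure Y)
    (hnonsing : ∀ B : Set Y, MeasurableSet B → (0 < lamY B ↔ 0 < lamX (π ⁻¹' B)))
    (μ : Measure X) (hμprob : IsProbabilityMeasure μ) (hμinv : Measure.map T μ = μ)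
    (hμπprob : IsProbabilityMeasure (Measure.map π μ)) :
    Observable T lamX ⟨μ, hμprob⟩ ↔ Observable S lamY ⟨Measure.map π μ, hμπprob⟩ := by
  have hsemi : Function.Semiconj π T S := hcomm
  have hπm := hπc.measurable
  have hSc : Continuous S := by
    rw [(hπc.isClosedMap.isQuotientMap hπc hπs).continuous_iff, ← hsemi.comp_eq]
    exact hπc.comp hTc
  have hproj : Continuous fun ρ : ProbabilityMeasure X ↦ ρ.map hπm.aemeasurable :=
    ProbabilityMeasure.continuous_map hπc
  constructor
  · intro h U hU hμU
    have hpos := h _ (hU.preimage hproj) hμU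
    set B := {y : Y | ∃ ν ∈ clusterMeasures S y, ν ∈ U}
    rw [← measure_toMeasurable B, hnonsing _ (measurableSet_toMeasurable _ _)]
    refine hpos.trans_le (measure_mono ?_)
    rintro x ⟨ν, hν, hνU⟩
    exact subset_toMeasurable _ _ ⟨_, map_mem_clusterMeasures hπc hsemi hν, hνU⟩
  · intro h U hU hμU
    set K : Set (ProbabilityMeasure X) := {ρ | ρ.map hTc.aemeasurable = ρ} \ U
    have hK : IsClosed ((fun ρ : ProbabilityMeasure X ↦ ρ.map hπm.aemeasurable) '' K) :=
      (((isClosed_eq (ProbabilityMeasure.continuous_map hTc) continuous_id).sdiff hU).isCompact.image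
        hproj).isClosed
    have hμK : (⟨Measure.map π μ, hμπprob⟩ : ProbabilityMeasure Y) ∉
        (fun ρ : ProbabilityMeasure X ↦ ρ.map hπm.aemeasurable) '' K := by
      rintro ⟨ρ, ⟨hρ, hρU⟩, hρμ⟩
      have hρT : MeasurePreserving T (ρ : Measure X) ρ :=
        ⟨hT, congrArg ProbabilityMeasure.toMeasure hρ⟩
      have : (ρ : Measure X) = μ := hshrink.eq_of_map_eq_s13 hTc hπc hπs hρT ⟨hT, hμinv⟩
        (congrArg ProbabilityMeasure.toMeasure hρμ)
      exact hρU ((ProbabilityMeasure.toMeasure_injective this : ρ = ⟨μ, hμprob⟩) ▸ hμU)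
    obtain ⟨V, hV, hVcl, hVK⟩ :=
      exists_mem_nhds_isClosed_subset (hK.isOpen_compl.mem_nhds hμK)
    set C := {y : Y | ∃ᶠ n in atTop, empirical S y n ∈ interior V}
    have hC : MeasurableSet C := by
      have : C = limsup (fun n ↦ {y | empirical S y n ∈ interior V}) atTop := by
        ext y
        simp [C, limsup_eq_iInf_iSup_of_nat, frequently_atTop]
      rw [this]
      exact .measurableSet_limsup fun n ↦
        (isOpen_interior.preimage (continuous_empirical hSc n)).measurableSet
    have hCpos : 0 < lamY C := by
      refine (h _ isOpen_interior (mem_interior_iff_mem_nhds.2 hV)).trans_le (measure_mono ?_)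
      rintro y ⟨ν, hν, hνV⟩
      exact hν.frequently (isOpen_interior.mem_nhds hνV)
    refine ((hnonsing C hC).1 hCpos).trans_le (measure_mono fun x hx ↦ ?_)
    obtain ⟨ν, hνV, hν⟩ := hVcl.isCompact.exists_mapClusterPt_of_frequently
      (Frequently.mono hx fun n hn ↦ interior_subset hn)
    obtain ⟨ρ, hρ, hρT, rfl⟩ := exists_mem_clusterMeasures_map_eq hTc hπc hsemi hν
    exact ⟨ρ, hρ, by_contra fun hρU ↦ hVK hνV ⟨ρ, ⟨hρT, hρU⟩, rfl⟩⟩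
end

section
/- Lemma 5.1 (coboundary construction): Assume T has (a_n)-shrinking fibers and π admits a continuous section σ : Y → X (i.e. σ is continuous with π∘σ = id_Y). Let ω be a modulus of continuity with Σ_{n≥0} ω(a_n) < ∞ and let φ : X → ℝ satisfy |φ(x) − φ(x')| ≤ H·ω(d(x,x')) for all x,x' and some H ≥ 0. Then the series h(x) := Σ_{n=0}^∞ (φ(T^n(σ(π(x)))) − φ(T^n(x))) converges uniformly on X, the function φ̂ := φ + h − h∘T is constant on each fiber π⁻¹(y), and if T is continuous then h is continuous. -/
open MeasureTheory Filter Topology Metric Set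

/-- Lemma 5.1 (coboundary construction): for an `ω`-continuous potential `φ` with
`Σ ω(a n) < ∞`, the series `h(x) = Σ_n (φ(T^n σ π x) − φ(T^n x))` converges uniformly on
`X`, the potential `φ̂ = φ + h − h∘T` is constant on each fiber of `π`, and `h` is
continuous whenever `T` is. -/
theorem coboundary_construction
    {X Y : Type*} [MetricSpace X] [CompactSpace X] [MeasurableSpace X] [BorelSpace X]
    [MetricSpace Y] [CompactSpace Y] [MeasurableSpace Y] [BorelSpace Y]
    (T : X → X) (S : Y → Y) (π : X → Y)
    (hT : Measurable T) (hS : Measurable S)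
    (hπc : Continuous π) (hπs : Function.Surjective π)
    (hcomm : ∀ x, π (T x) = S (π x))
    (a : ℕ → ℝ) (hshrink : ShrinkingFibers T π a)
    (σ : Y → X) (hσc : Continuous σ) (hσ : ∀ y, π (σ y) = y)
    (ω : ℝ → ℝ) (hω : IsModulus ω) (hsum : Summable fun n => ω (a n))
    (φ : X → ℝ) (H : ℝ) (hH : 0 ≤ H)
    (hφ : ∀ x x' : X, |φ x - φ x'| ≤ H * ω (dist x x')) :
    ∃ h : X → ℝ,
      TendstoUniformly
        (fun (N : ℕ) (x : X) =>
          ∑ n ∈ Finset.range N, (φ (T^[n] (σ (π x))) - φ (T^[n] x))) h Filter.atTop ∧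
      (∀ x x' : X, π x = π x' →
        φ x + h x - h (T x) = φ x' + h x' - h (T x')) ∧
      (Continuous T → Continuous h) := by
  obtain ⟨-, ha, ha0, hTa⟩ := hshrink
  obtain ⟨hωc, hωm, -, hω0, -⟩ := hω
  have hφfiber : ∀ n (x x' : X), π x = π x' →
      |φ (T^[n] x) - φ (T^[n] x')| ≤ H * ω (a n) := fun n x x' hx =>
    (hφ _ _).trans <| mul_le_mul_of_nonneg_left
      (hωm dist_nonneg (ha n).le (hTa n x x' hx)) hH
  have hunif := tendstoUniformly_tsum_nat
    (f := fun n x => φ (T^[n] (σ (π x))) - φ (T^[n] x)) (hsum.mul_left H)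
    fun n x => hφfiber n _ _ (hσ (π x))
  refine ⟨_, hunif, fun x x' hx => ?_, fun hTc => ?_⟩
  · rw [← sub_eq_zero]
    have hlim := (((hunif.tendsto_at x).const_add (φ x)).sub (hunif.tendsto_at (T x))).sub
      (((hunif.tendsto_at x').const_add (φ x')).sub (hunif.tendsto_at (T x')))
    refine tendsto_nhds_unique hlim ?_
    refine squeeze_zero_norm (fun N => ?_) (hsum.mul_left H).tendsto_atTop_zero
    refine le_of_eq_of_le (congrArg _ ?_) (hφfiber N x x' hx)
    have htel : ∀ z, ∑ n ∈ Finset.range N, φ (T^[n] (T z)) =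
        ∑ n ∈ Finset.range N, φ (T^[n] z) + φ (T^[N] z) - φ z := fun z => by
      rw [← Finset.sum_range_succ, Finset.sum_range_succ']
      simp
    simp only [Finset.sum_sub_distrib, htel, hcomm, hx]
    ring
  · have hφc : Continuous φ := by
      refine continuous_iff_continuousAt.2 fun x => ?_
      rw [ContinuousAt, tendsto_iff_dist_tendsto_zero]
      have hdist : Tendsto (fun z => dist z x) (𝓝 x) (𝓝[Ici 0] 0) :=
        tendsto_nhdsWithin_iff.2 ⟨tendsto_iff_dist_tendsto_zero.1 tendsto_id,
          Eventually.of_forall fun _ => dist_nonneg⟩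
      have hωlim := (((hωc 0 self_mem_Ici).tendsto.comp hdist).const_mul H)
      rw [hω0, mul_zero] at hωlim
      exact squeeze_zero (fun _ => dist_nonneg) (fun z => hφ z x) hωlim
    refine hunif.continuous (Frequently.of_forall fun N => ?_)
    exact continuous_finsetSum _ fun n _ =>
      (hφc.comp ((hTc.iterate n).comp (hσc.comp hπc))).sub (hφc.comp (hTc.iterate n))
end

section
/- Proposition 5.5 (transfer of the Central Limit Theorem, CLT case): Let μ be a T-invariant Borel probability measure on X and μ̌ = π_*μ. Let f : X → ℝ be continuous, h : X → ℝ continuous, and f̌ : Y → ℝ bounded Borel such that f(x) + h(x) − h(T(x)) = f̌(π(x)) for all x ∈ X; note ∫ f dμ = ∫ f̌ dμ̌. Suppose that for some σ > 0 and every r ∈ ℝ, μ̌({y ∈ Y : (1/√n)·Σ_{k=1}^n (f̌(S^k y) − ∫ f̌ dμ̌) ≤ r}) → Φ_{0,σ²}(r) as n → ∞, where Φ_{0,σ²} is the cumulative distribution function of the centered Gaussian law of variance σ². Then for every r ∈ ℝ, μ({x ∈ X : (1/√n)·Σ_{k=1}^n (f(T^k x) − ∫ f dμ) ≤ r}) →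 Φ_{0,σ²}(r) as n → ∞, with the same variance σ². -/
open MeasureTheory Filter Topology Metric Set ProbabilityTheory

/-- The cumulative distribution function of an atomless probability measure is continuous. -/
lemma continuous_measureReal_Iic (ν : Measure ℝ) [IsProbabilityMeasure ν] [NullSingletonClass ν] :
    Continuous fun r => ν.real (Iic r) := by
  simp_rw [← cdf_eq_real]
  refine continuous_iff_continuousAt.2 fun a => ?_
  rw [(monotone_cdf ν).continuousAt_iff_leftLim_eq_rightLim, (cdf ν).rightLim_eq]
  have hsing : (cdf ν).measure {a} = 0 := by rw [measure_cdf, measure_singleton]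
  rw [StieltjesFunction.measure_singleton, ENNReal.ofReal_eq_zero] at hsing
  exact le_antisymm ((monotone_cdf ν).leftLim_le le_rfl) (by linarith)

/-- Pointwise convergence of distribution functions to a continuous limit is stable under
perturbations that tend to zero uniformly. -/
lemma tendsto_measureReal_le_of_abs_sub_le {Ω : Type*} [MeasurableSpace Ω] {μ : Measure Ω}
    [IsFiniteMeasure μ] {u v : ℕ → Ω → ℝ} {ε : ℕ → ℝ} (hε : Tendsto ε atTop (𝓝 0))
    (huv : ∀ n x, |u n x - v n x| ≤ ε n) {F : ℝ → ℝ} (hF : Continuous F)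
    (hu : ∀ r, Tendsto (fun n => μ.real {x | u n x ≤ r}) atTop (𝓝 (F r))) (r : ℝ) :
    Tendsto (fun n => μ.real {x | v n x ≤ r}) atTop (𝓝 (F r)) := by
  rw [tendsto_order]
  constructor
  · intro a ha
    have hleft : Tendsto (fun δ => F (r - δ)) (𝓝[>] 0) (𝓝 (F r)) := by
      have hc : Continuous fun δ => F (r - δ) := by fun_prop
      simpa using (hc.tendsto 0).mono_left nhdsWithin_le_nhds
    obtain ⟨δ, hδa, hδ⟩ := ((hleft.eventually_const_lt ha).and self_mem_nhdsWithin).exists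
    filter_upwards [(hu (r - δ)).eventually_const_lt hδa, hε.eventually_lt_const hδ] with n hn hεn
    refine hn.trans_le (measureReal_mono fun x hx => ?_)
    have := (abs_le.1 (huv n x)).1
    simp only [mem_ofPred_eq] at hx ⊢
    linarith
  · intro a ha
    have hright : Tendsto (fun δ => F (r + δ)) (𝓝[>] 0) (𝓝 (F r)) := by
      have hc : Continuous fun δ => F (r + δ) := by fun_prop
      simpa using (hc.tendsto 0).mono_left nhdsWithin_le_nhds
    obtain ⟨δ, hδa, hδ⟩ := ((hright.eventually_lt_const ha).and self_mem_nhdsWithin).exists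
    filter_upwards [(hu (r + δ)).eventually_lt_const hδa, hε.eventually_lt_const hδ] with n hn hεn
    refine (measureReal_mono fun x hx => ?_).trans_lt hn
    have := (abs_le.1 (huv n x)).2
    simp only [mem_ofPred_eq] at hx ⊢
    linarith

/-- Birkhoff sums of cohomologous functions differ by a telescoping boundary term. -/
lemma sum_Icc_iterate_of_coboundary {X Y : Type*} {T : X → X} {S : Y → Y} {π : X → Y}
    (hcomm : Function.Semiconj π T S) {f h : X → ℝ} {g : Y → ℝ}
    (hcobound : ∀ x, f x + h x - h (T x) = g (π x)) (c : ℝ) (n : ℕ) (x : X) :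
    ∑ k ∈ Finset.Icc 1 n, (g (S^[k] (π x)) - c) =
      ∑ k ∈ Finset.Icc 1 n, (f (T^[k] x) - c) + (h (T x) - h (T^[n + 1] x)) := by
  induction n with
  | zero => simp
  | succ n ih =>
    rw [Finset.sum_Icc_succ_top (by lia), Finset.sum_Icc_succ_top (by lia), ih,
      ← (hcomm.iterate_right (n + 1)).eq x, ← hcobound, Function.iterate_succ_apply' T (n + 1)]
    ring

/-- Proposition 5.5 (transfer of the Central Limit Theorem): if `f` on `X` differs by a
continuous coboundary from `fY ∘ π`, and the Birkhoff sums of `fY` for `(S, μY)` satisfy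
the CLT with variance `σ²`, then the Birkhoff sums of `f` for `(T, μ)` satisfy the CLT
with the same variance. -/
theorem clt_transfer
    {X Y : Type*} [MetricSpace X] [CompactSpace X] [MeasurableSpace X] [BorelSpace X]
    [MetricSpace Y] [CompactSpace Y] [MeasurableSpace Y] [BorelSpace Y]
    (T : X → X) (S : Y → Y) (π : X → Y)
    (hT : Measurable T) (hS : Measurable S)
    (hπc : Continuous π) (hπs : Function.Surjective π)
    (hcomm : ∀ x, π (T x) = S (π x))
    (μ : Measure X) [IsProbabilityMeasure μ] (hμinv : Measure.map T μ = μ)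
    (f : X → ℝ) (hf : Continuous f)
    (h : X → ℝ) (hh : Continuous h)
    (fY : Y → ℝ) (hfYmeas : Measurable fY) (hfYbdd : ∃ M, ∀ y, |fY y| ≤ M)
    (hcobound : ∀ x : X, f x + h x - h (T x) = fY (π x))
    (σ : ℝ) (hσ : 0 < σ)
    (hCLT : ∀ r : ℝ,
      Filter.Tendsto
        (fun n : ℕ =>
          ((Measure.map π μ) {y : Y |
            (1 / Real.sqrt n) *
              ∑ k ∈ Finset.Icc 1 n, (fY (S^[k] y) - ∫ z, fY z ∂(Measure.map π μ)) ≤ r}).toReal)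
        Filter.atTop
        (nhds ((gaussianReal 0 (Real.toNNReal (σ ^ 2)) (Set.Iic r)).toReal))) :
    ∀ r : ℝ,
      Filter.Tendsto
        (fun n : ℕ =>
          (μ {x : X |
            (1 / Real.sqrt n) * ∑ k ∈ Finset.Icc 1 n, (f (T^[k] x) - ∫ z, f z ∂μ) ≤ r}).toReal)
        Filter.atTop
        (nhds ((gaussianReal 0 (Real.toNNReal (σ ^ 2)) (Set.Iic r)).toReal)) := by
  have hcomm' : Function.Semiconj π T S := hcomm
  have hf_int : Integrable f μ :=
    hf.integrable_of_hasCompactSupport (HasCompactSupport.of_compactSpace f)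
  have hh_int : Integrable h μ :=
    hh.integrable_of_hasCompactSupport (HasCompactSupport.of_compactSpace h)
  have hT_mp : MeasurePreserving T μ μ := ⟨hT, hμinv⟩
  have hmean : ∫ z, fY z ∂(Measure.map π μ) = ∫ z, f z ∂μ := by
    have hhT : ∫ x, h (T x) ∂μ = ∫ x, h x ∂μ := by
      conv_rhs => rw [← hμinv]
      exact (integral_map hT.aemeasurable hh.aestronglyMeasurable).symm
    have hhT_int : Integrable (fun x => h (T x)) μ := hT_mp.integrable_comp_of_integrable hh_int
    rw [integral_map hπc.aemeasurable hfYmeas.aestronglyMeasurable]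
    simp_rw [← hcobound]
    rw [integral_sub (by exact hf_int.add hh_int) hhT_int, integral_add hf_int hh_int, hhT,
      add_sub_cancel_right]
  obtain ⟨C, hC⟩ := isCompact_univ.exists_bound_of_continuousOn hh.continuousOn
  have hvar : (σ ^ 2).toNNReal ≠ 0 := (Real.toNNReal_pos.2 (by positivity)).ne'
  have := nullSingletonClass_gaussianReal (μ := 0) hvar
  rw [hmean] at hCLT
  have hε : Tendsto (fun n : ℕ => 1 / √(n : ℝ) * (C + C)) atTop (𝓝 0) := by
    have hsqrt : Tendsto (fun n : ℕ => √(n : ℝ)) atTop atTop :=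
      Real.tendsto_sqrt_atTop.comp tendsto_natCast_atTop_atTop
    simpa using hsqrt.inv_tendsto_atTop.mul_const (C + C)
  refine tendsto_measureReal_le_of_abs_sub_le
    (u := fun n x => 1 / √(n : ℝ) *
      ∑ k ∈ Finset.Icc 1 n, (fY (S^[k] (π x)) - ∫ z, f z ∂μ)) hε (fun n x => ?_)
    (continuous_measureReal_Iic (gaussianReal 0 (σ ^ 2).toNNReal)) fun r => ?_
  · rw [← mul_sub, sum_Icc_iterate_of_coboundary hcomm' hcobound, add_sub_cancel_left, abs_mul,
      abs_of_nonneg (by positivity : 0 ≤ 1 / √(n : ℝ))]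
    gcongr
    exact (abs_sub _ _).trans (add_le_add (hC _ (mem_univ _)) (hC _ (mem_univ _)))
  · refine (hCLT r).congr fun n => ?_
    have hmeas : Measurable fun y => 1 / √(n : ℝ) *
        ∑ k ∈ Finset.Icc 1 n, (fY (S^[k] y) - ∫ z, f z ∂μ) :=
      (Finset.measurable_fun_sum _ fun k _ =>
        (hfYmeas.comp (hS.iterate k)).sub_const _).const_mul _
    rw [Measure.map_apply hπc.measurable (measurableSet_le hmeas measurable_const)]
    rfl
end

section
/- Theorem 6.4, item 1 (Hölder regularity of the disintegration): Assume T is L-Lipschitz (L ≥ 1) and has (a_n)-shrinking fibers with a_n ≤ C₀·θ^n for some C₀ > 0 and θ ∈ (0,1), and that π admits a Lipschitz section σ : Y → X. Let μ be a T-invariant Borel probability measure on X, μ̌ = π_*μ, and (ξ_y)_{y∈Y} a disintegration of μ over π. Fix α ∈ (0,1] and assume the transfer operator of (S,μ̌) is iteratively bounded with respect to the α-Hölder modulus in the following sense: there is D ≥ 0 and for each n ∈ ℕ a Borel measurable family (η^n_y)_{y∈Y} of Borel probability measures on Y with η^n_y(S^{-n}({y})) = 1 for all y, with ∫_Y (∫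 u dη^n_y) dμ̌(y) = ∫ u dμ̌ for every bounded Borel u : Y → ℝ, and with Hol_α(y ↦ ∫ u dη^n_y) ≤ D·Hol_α(u) for every bounded u with Hol_α(u) < ∞. Set β = α/(1 − log L/log θ). Then there exists C > 0 such that for every bounded f : X → ℝ with Hol_α(f) < ∞ there is u : Y → ℝ with Hol_β(u) ≤ C·Hol_α(f) and u(y) = ∫ f dξ_y for μ̌-almost every y ∈ Y. -/
open MeasureTheory Filter Topology Metric Set

/-- McShane extension of a real-valued Hölder function defined on a nonempty subset. -/
lemma exists_holder_extension {Y : Type*} [PseudoMetricSpace Y] {s : Set Y} (hs : s.Nonempty)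
    {β K : ℝ} (hβ : 0 < β) (hβ' : β ≤ 1) (hK : 0 ≤ K) {F : Y → ℝ}
    (hF : ∀ y ∈ s, ∀ y' ∈ s, |F y - F y'| ≤ K * dist y y' ^ β) :
    ∃ u : Y → ℝ, (∀ y y', |u y - u y'| ≤ K * dist y y' ^ β) ∧ ∀ y ∈ s, u y = F y := by
  have htri : ∀ x y z : Y, K * dist x z ^ β ≤ K * dist x y ^ β + K * dist y z ^ β := by
    intro x y z
    rw [← mul_add]
    refine mul_le_mul_of_nonneg_left ?_ hK
    exact (Real.rpow_le_rpow dist_nonneg (dist_triangle x y z) hβ.le).trans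
      (Real.rpow_add_le_add_rpow dist_nonneg dist_nonneg hβ.le hβ')
  obtain ⟨z₀, hz₀⟩ := hs
  have : Nonempty s := ⟨⟨z₀, hz₀⟩⟩
  have hbdd : ∀ y, BddBelow (Set.range fun z : s => F z + K * dist y (z : Y) ^ β) := by
    intro y
    refine ⟨F z₀ - K * dist z₀ y ^ β, ?_⟩
    rintro _ ⟨z, rfl⟩
    have h1 := (abs_le.1 (hF z₀ hz₀ z z.2)).2
    have h2 := htri z₀ y z
    linarith
  have hle : ∀ y y', (⨅ z : s, F z + K * dist y (z : Y) ^ β) ≤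
      (⨅ z : s, F z + K * dist y' (z : Y) ^ β) + K * dist y y' ^ β := by
    intro y y'
    rw [← sub_le_iff_le_add]
    refine le_ciInf fun z => ?_
    have h1 := ciInf_le (hbdd y) z
    have h2 := htri y y' z
    linarith
  refine ⟨fun y => ⨅ z : s, F z + K * dist y (z : Y) ^ β, fun y y' => ?_, fun y hy => ?_⟩
  · rw [abs_le]
    have h1 := hle y y'
    have h2 := hle y' y
    rw [dist_comm y' y] at h2
    constructor <;> linarith
  · refine le_antisymm ?_ (le_ciInf fun z => ?_)
    · have h1 := ciInf_le (hbdd y) ⟨y, hy⟩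
      simpa [Real.zero_rpow hβ.ne'] using h1
    · have h1 := (abs_le.1 (hF y hy z z.2)).2
      linarith

/-- The exponent at which the decay of `θ ^ n` balances the growth of `L ^ n * d`. -/
lemma exists_pow_balance {L θ d : ℝ} (hL : 1 ≤ L) (hθ : θ ∈ Set.Ioo (0 : ℝ) 1) (hd : 0 < d)
    (hd' : d ≤ 1) :
    ∃ n : ℕ, θ ^ n ≤ θ⁻¹ * d ^ (1 / (1 - Real.log L / Real.log θ)) ∧
      L ^ n * d ≤ d ^ (1 / (1 - Real.log L / Real.log θ)) := by
  have hlθ : Real.log θ < 0 := Real.log_neg hθ.1 hθ.2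
  have hlL : 0 ≤ Real.log L := Real.log_nonneg hL
  have hld : Real.log d ≤ 0 := Real.log_nonpos hd.le hd'
  have hL0 : 0 < L := by linarith
  have hne : Real.log θ - Real.log L ≠ 0 := by linarith
  obtain ⟨t, ht⟩ : ∃ t, t = Real.log d / (Real.log θ - Real.log L) := ⟨_, rfl⟩
  have ht0 : 0 ≤ t := ht ▸ div_nonneg_of_nonpos hld (by linarith)
  have htd : t * (Real.log θ - Real.log L) = Real.log d := by
    rw [ht, div_mul_cancel₀ _ hne]
  have hs : d ^ (1 / (1 - Real.log L / Real.log θ)) = Real.exp (t * Real.log θ) := by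
    rw [Real.rpow_def_of_pos hd]
    congr 1
    have : 1 - Real.log L / Real.log θ = (Real.log θ - Real.log L) / Real.log θ := by
      rw [sub_div, div_self hlθ.ne]
    rw [this, ht]
    field_simp
  have hfl := Nat.floor_le ht0
  have hfl' := (Nat.lt_floor_add_one t).le
  refine ⟨⌊t⌋₊, ?_, ?_⟩
  · rw [hs, ← Real.exp_log hθ.1, ← Real.exp_nat_mul, ← Real.exp_neg, ← Real.exp_add,
      Real.log_exp]
    refine Real.exp_le_exp.2 ?_
    nlinarith
  · have hd_exp : Real.exp (⌊t⌋₊ * Real.log L) * d =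
        Real.exp (⌊t⌋₊ * Real.log L) * Real.exp (Real.log d) := by rw [Real.exp_log hd]
    have hL_exp : L ^ ⌊t⌋₊ = Real.exp (⌊t⌋₊ * Real.log L) := by
      rw [Real.exp_nat_mul, Real.exp_log hL0]
    rw [hs, hL_exp, hd_exp, ← Real.exp_add]
    refine Real.exp_le_exp.2 ?_
    nlinarith

lemma continuous_of_holder_bound {X : Type*} [PseudoMetricSpace X] {f : X → ℝ} {H α : ℝ}
    (hα : 0 < α) (hf : ∀ x x', |f x - f x'| ≤ H * dist x x' ^ α) : Continuous f := by
  rw [continuous_iff_continuousAt]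
  intro x
  rw [ContinuousAt, tendsto_iff_dist_tendsto_zero]
  refine squeeze_zero (fun _ => dist_nonneg) (fun y => hf y x) ?_
  have h : Continuous fun y => H * dist y x ^ α :=
    continuous_const.mul ((continuous_id.dist continuous_const).rpow_const fun _ => Or.inr hα.le)
  simpa [Real.zero_rpow hα.ne'] using h.tendsto x

lemma ae_eq_of_fiber_measure_eq_one {X Y : Type*} [MeasurableSpace X] [MeasurableSpace Y]
    [MeasurableSingletonClass Y] {p : X → Y} (hp : Measurable p) {ν : Measure X}
    [IsProbabilityMeasure ν] {y : Y} (h : ν (p ⁻¹' {y}) = 1) : ∀ᵐ x ∂ν, p x = y := by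
  have := (prob_compl_eq_zero_iff (hp (measurableSet_singleton y))).2 h
  exact this

lemma measurable_integral_of_measurable {X Y : Type*} [MeasurableSpace X] [MeasurableSpace Y]
    {ξ : Y → Measure X} (hξ : Measurable ξ) (hξp : ∀ y, IsProbabilityMeasure (ξ y)) {h : X → ℝ}
    (hh : Measurable h) : Measurable fun y => ∫ x, h x ∂(ξ y) := by
  let κ : ProbabilityTheory.Kernel Y X := ⟨ξ, hξ⟩
  have : ProbabilityTheory.IsMarkovKernel κ := ⟨hξp⟩
  exact (StronglyMeasurable.integral_kernel (κ := κ) hh.stronglyMeasurable).measurable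

lemma abs_integral_le_of_abs_le {X : Type*} [MeasurableSpace X] {ν : Measure X}
    [IsProbabilityMeasure ν] {h : X → ℝ} {M : ℝ} (hM : ∀ᵐ x ∂ν, |h x| ≤ M) :
    |∫ x, h x ∂ν| ≤ M := by
  simpa using norm_integral_le_of_norm_le_const (μ := ν) (f := h) (C := M) hM

/-- Functions of the base point factor out of the integrals of a disintegration. -/
lemma integral_mul_disintegration {X Y : Type*} [MeasurableSpace X] [MeasurableSpace Y]
    [MeasurableSingletonClass Y] {p : X → Y} (hp : Measurable p) {μ : Measure X} {ν : Measure Y}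
    {ξ : Y → Measure X} (hξprob : ∀ y, IsProbabilityMeasure (ξ y))
    (hξconc : ∀ y, ξ y (p ⁻¹' {y}) = 1)
    (hξdis : ∀ f : X → ℝ, Measurable f → (∃ M, ∀ x, |f x| ≤ M) →
      (∫ y, (∫ x, f x ∂(ξ y)) ∂ν) = ∫ x, f x ∂μ)
    {g : Y → ℝ} (hg : Measurable g) (hgb : ∃ M, ∀ y, |g y| ≤ M)
    {h : X → ℝ} (hh : Measurable h) (hhb : ∃ M, ∀ x, |h x| ≤ M) :
    ∫ y, g y * (∫ x, h x ∂(ξ y)) ∂ν = ∫ x, g (p x) * h x ∂μ := by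
  obtain ⟨M, hM⟩ := hgb
  obtain ⟨N, hN⟩ := hhb
  rw [← hξdis (fun x => g (p x) * h x) ((hg.comp hp).mul hh) ⟨M * N, fun x => ?_⟩]
  · refine integral_congr_ae (Eventually.of_forall fun y => ?_)
    have := hξprob y
    dsimp only
    rw [← integral_const_mul]
    refine integral_congr_ae ?_
    filter_upwards [ae_eq_of_fiber_measure_eq_one hp (hξconc y)] with x hx
    rw [hx]
  · rw [abs_mul]
    exact mul_le_mul (hM _) (hN _) (abs_nonneg _) ((abs_nonneg _).trans (hM (p x)))

/-- Invariance of a disintegration: `ξ_y` is the average over the backward disintegration of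
`(S, map π μ)` of the push-forwards of the measures `ξ_z` by `T`. -/
lemma ae_integral_disintegration_eq {X Y : Type*} [MeasurableSpace X] [MeasurableSpace Y]
    [MeasurableSingletonClass Y] {T : X → X} {S : Y → Y} {π : X → Y}
    (hS : Measurable S) (hπ : Measurable π) (hcomm : ∀ x, π (T x) = S (π x))
    {μ : Measure X} [IsProbabilityMeasure μ] (hμ : MeasurePreserving T μ μ)
    {ξ : Y → Measure X} (hξmeas : Measurable ξ) (hξprob : ∀ y, IsProbabilityMeasure (ξ y))
    (hξconc : ∀ y, ξ y (π ⁻¹' {y}) = 1)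
    (hξdis : ∀ f : X → ℝ, Measurable f → (∃ M, ∀ x, |f x| ≤ M) →
      (∫ y, (∫ x, f x ∂(ξ y)) ∂(Measure.map π μ)) = ∫ x, f x ∂μ)
    {η : Y → Measure Y} (hηmeas : Measurable η) (hηprob : ∀ y, IsProbabilityMeasure (η y))
    (hηconc : ∀ y, η y (S ⁻¹' {y}) = 1)
    (hηdis : ∀ u : Y → ℝ, Measurable u → (∃ M, ∀ y, |u y| ≤ M) →
      (∫ y, (∫ z, u z ∂(η y)) ∂(Measure.map π μ)) = ∫ y, u y ∂(Measure.map π μ))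
    {f : X → ℝ} (hf : Measurable f) (hfb : ∃ M, ∀ x, |f x| ≤ M) :
    ∀ᵐ y ∂(Measure.map π μ),
      ∫ x, f x ∂(ξ y) = ∫ z, (∫ x, f (T x) ∂(ξ z)) ∂(η y) := by
  obtain ⟨M, hM⟩ := hfb
  have hT := hμ.measurable
  have : IsProbabilityMeasure (Measure.map π μ) := Measure.isProbabilityMeasure_map hπ.aemeasurable
  have hm1 := measurable_integral_of_measurable hξmeas hξprob hf
  have hm2 := measurable_integral_of_measurable hξmeas hξprob (hf.comp hT)
  have hm3 := measurable_integral_of_measurable hηmeas hηprob hm2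
  have hb1 : ∀ y, |∫ x, f x ∂(ξ y)| ≤ M := fun y => by
    have := hξprob y
    exact abs_integral_le_of_abs_le (Eventually.of_forall hM)
  have hb2 : ∀ z, |∫ x, f (T x) ∂(ξ z)| ≤ M := fun z => by
    have := hξprob z
    exact abs_integral_le_of_abs_le (Eventually.of_forall fun x => hM (T x))
  have hb3 : ∀ y, |∫ z, (∫ x, f (T x) ∂(ξ z)) ∂(η y)| ≤ M := fun y => by
    have := hηprob y
    exact abs_integral_le_of_abs_le (Eventually.of_forall hb2)
  refine Integrable.ae_eq_of_forall_setIntegral_eq _ _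
    (Integrable.of_bound hm1.aestronglyMeasurable M (Eventually.of_forall hb1))
    (Integrable.of_bound hm3.aestronglyMeasurable M (Eventually.of_forall hb3)) ?_
  intro A hA _
  have hg : Measurable (A.indicator fun _ => (1 : ℝ)) := measurable_const.indicator hA
  have hgb : ∃ M, ∀ y, |A.indicator (fun _ => (1 : ℝ)) y| ≤ M :=
    ⟨1, fun y => by by_cases hy : y ∈ A <;> simp [hy]⟩
  have hset : ∀ φ : Y → ℝ, ∫ y in A, φ y ∂(Measure.map π μ) =
      ∫ y, A.indicator (fun _ => (1 : ℝ)) y * φ y ∂(Measure.map π μ) := by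
    intro φ
    rw [← integral_indicator hA]
    refine integral_congr_ae (Eventually.of_forall fun y => ?_)
    by_cases hy : y ∈ A <;> simp [hy]
  rw [hset, hset]
  generalize A.indicator (fun _ => (1 : ℝ)) = g at hg hgb
  obtain ⟨N, hN⟩ := hgb
  have hgS : Measurable fun z => g (S z) := hg.comp hS
  calc ∫ y, g y * (∫ x, f x ∂(ξ y)) ∂(Measure.map π μ)
      = ∫ x, g (π x) * f x ∂μ :=
        integral_mul_disintegration hπ hξprob hξconc hξdis hg ⟨N, hN⟩ hf ⟨M, hM⟩
    _ = ∫ x, g (π (T x)) * f (T x) ∂μ := by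
        conv_lhs => rw [← hμ.map_eq]
        exact integral_map hT.aemeasurable ((hg.comp hπ).mul hf).aestronglyMeasurable
    _ = ∫ x, g (S (π x)) * f (T x) ∂μ := by simp only [hcomm]
    _ = ∫ z, g (S z) * (∫ x, f (T x) ∂(ξ z)) ∂(Measure.map π μ) :=
        (integral_mul_disintegration hπ hξprob hξconc hξdis hgS ⟨N, fun z => hN (S z)⟩
          (hf.comp hT) ⟨M, fun x => hM (T x)⟩).symm
    _ = ∫ y, g y * (∫ z, (∫ x, f (T x) ∂(ξ z)) ∂(η y)) ∂(Measure.map π μ) :=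
        (integral_mul_disintegration hS hηprob hηconc hηdis hg ⟨N, hN⟩ hm2 ⟨M, hb2⟩).symm

/-- Theorem 6.4, item 1 (Hölder regularity of the disintegration): with exponentially
shrinking fibers, a Lipschitz `T`, a Lipschitz section, and a transfer operator of
`(S, π_* μ)` iteratively bounded on `α`-Hölder functions (expressed through the backward
disintegrations `η^n`), the disintegration `ξ` of `μ` over `π` sends bounded `α`-Hölder
functions on `X` to (`μY`-a.e. versions of) `β`-Hölder functions on `Y`, with
`β = α/(1 − log L/log θ)` and linear control of the Hölder constants. -/
theorem holder_regularity_of_disintegration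
    {X Y : Type*} [MetricSpace X] [CompactSpace X] [MeasurableSpace X] [BorelSpace X]
    [MetricSpace Y] [CompactSpace Y] [MeasurableSpace Y] [BorelSpace Y]
    (T : X → X) (S : Y → Y) (π : X → Y)
    (hT : Measurable T) (hS : Measurable S)
    (L : ℝ) (hL : 1 ≤ L) (hTLip : LipschitzWith (Real.toNNReal L) T)
    (hπc : Continuous π) (hπs : Function.Surjective π)
    (hcomm : ∀ x, π (T x) = S (π x))
    (a : ℕ → ℝ) (hshrink : ShrinkingFibers T π a)
    (C₀ : ℝ) (hC₀ : 0 < C₀) (θ : ℝ) (hθ : θ ∈ Set.Ioo (0 : ℝ) 1)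
    (ha : ∀ n, a n ≤ C₀ * θ ^ n)
    (σ : Y → X) (Lσ : NNReal) (hσLip : LipschitzWith Lσ σ) (hσ : ∀ y, π (σ y) = y)
    (μ : Measure X) [IsProbabilityMeasure μ] (hμinv : Measure.map T μ = μ)
    -- `ξ` is a disintegration of `μ` over `π`:
    (ξ : Y → Measure X) (hξmeas : Measurable ξ)
    (hξprob : ∀ y, IsProbabilityMeasure (ξ y))
    (hξconc : ∀ y, ξ y (π ⁻¹' {y}) = 1)
    (hξdis : ∀ f : X → ℝ, Measurable f → (∃ M, ∀ x, |f x| ≤ M) →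
      (∫ y, (∫ x, f x ∂(ξ y)) ∂(Measure.map π μ)) = ∫ x, f x ∂μ)
    (α : ℝ) (hα : α ∈ Set.Ioc (0 : ℝ) 1)
    -- the transfer operator of `(S, π_* μ)`, given by the backward disintegrations `η n`,
    -- is iteratively bounded with respect to the `α`-Hölder modulus:
    (η : ℕ → Y → Measure Y) (hηmeas : ∀ n, Measurable (η n))
    (hηprob : ∀ n y, IsProbabilityMeasure (η n y))
    (hηconc : ∀ n y, η n y (S^[n] ⁻¹' {y}) = 1)
    (hηdis : ∀ (n : ℕ) (u : Y → ℝ), Measurable u → (∃ M, ∀ y, |u y| ≤ M) →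
      (∫ y, (∫ z, u z ∂(η n y)) ∂(Measure.map π μ)) = ∫ y, u y ∂(Measure.map π μ))
    (D : ℝ) (hD : 0 ≤ D)
    (hηbound : ∀ (n : ℕ) (u : Y → ℝ), (∃ M, ∀ y, |u y| ≤ M) →
      ∀ H : ℝ, 0 ≤ H → (∀ y y' : Y, |u y - u y'| ≤ H * dist y y' ^ α) →
        ∀ y y' : Y, |(∫ z, u z ∂(η n y)) - ∫ z, u z ∂(η n y')| ≤ D * H * dist y y' ^ α)
    (β : ℝ) (hβ : β = α / (1 - Real.log L / Real.log θ)) :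
    ∃ C > (0 : ℝ), ∀ f : X → ℝ, (∃ M, ∀ x, |f x| ≤ M) →
      ∀ H : ℝ, 0 ≤ H → (∀ x x' : X, |f x - f x'| ≤ H * dist x x' ^ α) →
      ∃ u : Y → ℝ,
        (∀ y y' : Y, |u y - u y'| ≤ C * H * dist y y' ^ β) ∧
        ∀ᵐ y ∂(Measure.map π μ), u y = ∫ x, f x ∂(ξ y) := by
  obtain ⟨-, -, -, hfib⟩ := hshrink
  have hα0 : 0 < α := hα.1
  have hlθ : Real.log θ < 0 := Real.log_neg hθ.1 hθ.2
  have hlL : 0 ≤ Real.log L := Real.log_nonneg hL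
  have hden : 1 ≤ 1 - Real.log L / Real.log θ := by
    linarith [div_nonpos_of_nonneg_of_nonpos hlL hlθ.le]
  have hβ0 : 0 < β := hβ ▸ div_pos hα0 (by linarith)
  have hβ1 : β ≤ 1 := by
    rw [hβ, div_le_one (by linarith)]
    linarith [hα.2]
  have hβs : β = 1 / (1 - Real.log L / Real.log θ) * α := by rw [hβ]; ring
  have hL0 : 0 ≤ L := by linarith
  have hθ0 : 0 ≤ θ := hθ.1.le
  have hπm : Measurable π := hπc.measurable
  have : IsProbabilityMeasure (Measure.map π μ) :=
    Measure.isProbabilityMeasure_map hπm.aemeasurable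
  set A : ℝ := C₀ ^ α with hA
  set B : ℝ := (Lσ : ℝ) ^ α with hB
  set R : ℝ := diam (Set.univ : Set Y) ^ α with hR
  set t : ℝ := θ⁻¹ ^ α with ht
  have hA0 : 0 ≤ A := Real.rpow_nonneg hC₀.le _
  have hB0 : 0 ≤ B := Real.rpow_nonneg Lσ.coe_nonneg _
  have hR0 : 0 ≤ R := Real.rpow_nonneg diam_nonneg _
  have ht1 : 1 ≤ t := Real.one_le_rpow ((one_le_inv₀ hθ.1).2 hθ.2.le) hα0.le
  have hDB : 0 ≤ D * B := mul_nonneg hD hB0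
  -- the estimate of order `n`, optimised over `n`
  have hopt : ∀ d : ℝ, 0 < d → d ≤ diam (Set.univ : Set Y) → ∃ n : ℕ,
      2 * (A * (θ ^ n) ^ α) + D * (B * (L ^ n) ^ α) * d ^ α ≤
        (2 * A * t + D * B * (1 + R) + 1) * d ^ β := by
    intro d hd hdR
    rcases le_total d 1 with hd1 | hd1
    · obtain ⟨n, h1, h2⟩ := exists_pow_balance hL hθ hd hd1
      refine ⟨n, ?_⟩
      have h1' : (θ ^ n) ^ α ≤ t * d ^ β := by
        refine (Real.rpow_le_rpow (pow_nonneg hθ0 n) h1 hα0.le).trans_eq ?_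
        rw [Real.mul_rpow (inv_nonneg.2 hθ0) (Real.rpow_nonneg hd.le _), ← Real.rpow_mul hd.le,
          ← hβs]
      have h2' : (L ^ n) ^ α * d ^ α ≤ d ^ β := by
        rw [← Real.mul_rpow (pow_nonneg hL0 n) hd.le]
        refine (Real.rpow_le_rpow (mul_nonneg (pow_nonneg hL0 n) hd.le) h2 hα0.le).trans_eq ?_
        rw [← Real.rpow_mul hd.le, ← hβs]
      have h3 := mul_le_mul_of_nonneg_left h1' hA0
      have h4 := mul_le_mul_of_nonneg_left h2' hDB
      have h5 : 0 ≤ d ^ β := Real.rpow_nonneg hd.le _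
      have h6 : 0 ≤ D * B * R * d ^ β := mul_nonneg (mul_nonneg hDB hR0) h5
      linarith
    · refine ⟨0, ?_⟩
      have h5 : 1 ≤ d ^ β := Real.one_le_rpow hd1 hβ0.le
      have h6 : d ^ α ≤ R := Real.rpow_le_rpow hd.le hdR hα0.le
      simp only [pow_zero, Real.one_rpow, mul_one]
      have h7 := mul_le_mul_of_nonneg_left h6 hDB
      have h8 : 2 * A ≤ 2 * A * t := le_mul_of_one_le_right (by linarith) ht1
      have h9 : 0 ≤ 2 * A * t + D * B * (1 + R) + 1 := by positivity
      have h10 := le_mul_of_one_le_right h9 h5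
      linarith
  refine ⟨2 * A * t + D * B * (1 + R) + 1, by positivity, ?_⟩
  rintro f ⟨M, hM⟩ H hH hf
  have hfc : Continuous f := continuous_of_holder_bound hα0 hf
  have hsemi : ∀ n x, π (T^[n] x) = S^[n] (π x) := fun n x =>
    (Function.Semiconj.iterate_right (f := π) hcomm n) x
  have hmp : MeasurePreserving T μ μ := ⟨hT, hμinv⟩
  have hae : ∀ᵐ y ∂(Measure.map π μ), ∀ n : ℕ,
      ∫ x, f x ∂(ξ y) = ∫ z, (∫ x, f (T^[n] x) ∂(ξ z)) ∂(η n y) :=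
    ae_all_iff.2 fun n => ae_integral_disintegration_eq (hS.iterate n) hπm (hsemi n)
      (hmp.iterate n) hξmeas hξprob hξconc hξdis (hηmeas n) (hηprob n) (hηconc n) (hηdis n)
      hfc.measurable ⟨M, hM⟩
  -- comparison of `∫ f dξ_y` with the integral over the section
  have hcmp : ∀ n y, |(∫ z, (∫ x, f (T^[n] x) ∂(ξ z)) ∂(η n y)) -
      ∫ z, f (T^[n] (σ z)) ∂(η n y)| ≤ H * (A * (θ ^ n) ^ α) := by
    intro n y
    have := hηprob n y
    have hfn : Measurable fun x => f (T^[n] x) := hfc.measurable.comp (hT.iterate n)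
    have hb : ∀ z, |∫ x, f (T^[n] x) ∂(ξ z)| ≤ M := fun z => by
      have := hξprob z
      exact abs_integral_le_of_abs_le (Eventually.of_forall fun x => hM _)
    have hfσ : Measurable fun z => f (T^[n] (σ z)) := hfn.comp hσLip.continuous.measurable
    rw [← integral_sub
      (Integrable.of_bound
        (measurable_integral_of_measurable hξmeas hξprob hfn).aestronglyMeasurable M
        (Eventually.of_forall hb))
      (Integrable.of_bound hfσ.aestronglyMeasurable M (Eventually.of_forall fun z => hM _))]
    refine abs_integral_le_of_abs_le (Eventually.of_forall fun z => ?_)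
    have := hξprob z
    have hconst : f (T^[n] (σ z)) = ∫ _, f (T^[n] (σ z)) ∂(ξ z) := by simp
    rw [hconst, ← integral_sub
      (Integrable.of_bound hfn.aestronglyMeasurable M (Eventually.of_forall fun x => hM _))
      (integrable_const _)]
    refine abs_integral_le_of_abs_le ?_
    filter_upwards [ae_eq_of_fiber_measure_eq_one hπm (hξconc z)] with x hx
    refine (hf _ _).trans (mul_le_mul_of_nonneg_left ?_ hH)
    rw [hA, ← Real.mul_rpow hC₀.le (pow_nonneg hθ0 n)]
    exact Real.rpow_le_rpow dist_nonneg
      ((hfib n x (σ z) (by rw [hx, hσ])).trans (ha n)) hα0.le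
  have hsec : ∀ n y y', |f (T^[n] (σ y)) - f (T^[n] (σ y'))| ≤
      H * (B * (L ^ n) ^ α) * dist y y' ^ α := by
    intro n y y'
    refine (hf _ _).trans ?_
    rw [mul_assoc]
    refine mul_le_mul_of_nonneg_left ?_ hH
    rw [hB, ← Real.mul_rpow Lσ.coe_nonneg (pow_nonneg hL0 n),
      ← Real.mul_rpow (mul_nonneg Lσ.coe_nonneg (pow_nonneg hL0 n)) dist_nonneg]
    refine Real.rpow_le_rpow dist_nonneg ?_ hα0.le
    have h := ((hTLip.iterate n).comp hσLip).dist_le_mul y y'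
    simp only [Function.comp_apply, NNReal.coe_mul, NNReal.coe_pow,
      Real.coe_toNNReal L hL0] at h
    rwa [mul_comm (Lσ : ℝ)]
  have hne : {y | ∀ n : ℕ,
      ∫ x, f x ∂(ξ y) = ∫ z, (∫ x, f (T^[n] x) ∂(ξ z)) ∂(η n y)}.Nonempty := hae.exists
  obtain ⟨u, hu, huF⟩ := exists_holder_extension hne hβ0 hβ1
    (K := (2 * A * t + D * B * (1 + R) + 1) * H) (by positivity)
    (F := fun y => ∫ x, f x ∂(ξ y)) (by
      intro y hy y' hy'
      rcases eq_or_ne y y' with rfl | hyy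
      · simp [Real.zero_rpow hβ0.ne']
      obtain ⟨n, hn⟩ := hopt (dist y y') (dist_pos.2 hyy)
        (dist_le_diam_of_mem isCompact_univ.isBounded (mem_univ y) (mem_univ y'))
      have h1 := hcmp n y
      have h2 := hcmp n y'
      rw [← hy n] at h1
      rw [← hy' n] at h2
      have h3 := hηbound n (fun z => f (T^[n] (σ z))) ⟨M, fun z => hM _⟩
        (H * (B * (L ^ n) ^ α)) (by positivity) (hsec n) y y'
      have h4 := mul_le_mul_of_nonneg_left hn hH
      rw [abs_le] at h1 h2 h3 ⊢
      constructor <;> linarith)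
  refine ⟨u, hu, ?_⟩
  filter_upwards [hae] with y hy
  exact huF y hy
end
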